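/- Let 0 < α < 1 and for every odd prime p let M(p) be a set of pairs (a,b) with 1 ≤ a, b ≤ p-1, of cardinality |M(p)| = α·p² + O(p) as p → ∞. Let T_M be the set of products pqr with 3 ≤ p < q < r odd primes such that the pair (q mod p, r mod p) belongs to M(p). Then the number of elements of T_M that are ≤ x equals (α·x·(log log x)²)/(2·log x)·(1 + O(1/log log log x)) as x → ∞. -/

import Mathlib

open Real Filter

namespace TP
open Complex in
/-- fractional part beyond one -/
noncomputable def fr (t : ℝ) : ℂ := Set.indicator (Set.Ioi 1) (fun t => ((Int.fract t : ℝ) : ℂ)) t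

noncomputable def HH (s : ℂ) : ℂ := mellin fr (-s)

lemma fr_norm (t : ℝ) : ‖fr t‖ ≤ 1 := by
  unfold fr
  by_cases h : t ∈ Set.Ioi (1:ℝ)
  · rw [Set.indicator_of_mem h, Complex.norm_real, Real.norm_eq_abs, abs_of_nonneg (Int.fract_nonneg t)]
    exact (Int.fract_lt_one t).le
  · rw [Set.indicator_of_notMem h]; simp

lemma fr_meas : Measurable fr := by
  unfold fr
  exact (Complex.measurable_ofReal.comp measurable_fract).indicator measurableSet_Ioi

lemma fr_locint : MeasureTheory.LocallyIntegrableOn fr (Set.Ioi 0) := by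
  apply MeasureTheory.LocallyIntegrable.locallyIntegrableOn
  have h1 : MeasureTheory.LocallyIntegrable (fun _ : ℝ => (1:ℝ)) := MeasureTheory.locallyIntegrable_const 1
  refine h1.mono fr_meas.aestronglyMeasurable ?_
  filter_upwards with t
  simpa using fr_norm t

lemma HH_diff {s : ℂ} (hs : 0 < s.re) : DifferentiableAt ℂ HH s := by
  have h : DifferentiableAt ℂ (mellin fr) (-s) := by
    refine mellin_differentiableAt_of_isBigO_rpow (a := 0) (b := -s.re - 1) fr_locint ?_ ?_ ?_ ?_
    · simp only [neg_zero, Real.rpow_zero]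
      exact Asymptotics.isBigO_of_le _ (fun t => by simpa using fr_norm t)
    · simpa using hs
    · apply Asymptotics.IsBigO.of_bound 1
      have : Set.Ioo (0:ℝ) 1 ∈ nhdsWithin (0:ℝ) (Set.Ioi 0) := Ioo_mem_nhdsGT one_pos
      filter_upwards [this] with t ht
      have : fr t = 0 := by
        unfold fr
        rw [Set.indicator_of_notMem]
        simp [ht.2.le]
      rw [this]; simp
    · simp
  unfold HH
  exact DifferentiableAt.comp (g := mellin fr) s h (by fun_prop)

lemma HH_eq (s : ℂ) : HH s = ∫ t in Set.Ioi (1:ℝ), ((Int.fract t : ℝ) : ℂ) * (t:ℂ) ^ (-(s+1)) := by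
  unfold HH mellin
  have : ∀ t : ℝ, (t:ℂ) ^ (-s - 1) • fr t =
     Set.indicator (Set.Ioi 1) (fun t : ℝ => ((Int.fract t : ℝ) : ℂ) * (t:ℂ) ^ (-(s+1))) t := by
    intro t
    unfold fr
    by_cases h : t ∈ Set.Ioi (1:ℝ)
    · rw [Set.indicator_of_mem h, Set.indicator_of_mem h, smul_eq_mul, mul_comm]
      congr 2; ring
    · rw [Set.indicator_of_notMem h, Set.indicator_of_notMem h, smul_zero]
  simp_rw [this]
  rw [MeasureTheory.setIntegral_indicator measurableSet_Ioi]
  congr 2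
  ext t; simp

lemma HH_norm {s : ℂ} (hs : 0 < s.re) : ‖HH s‖ ≤ 1 / s.re := by
  rw [HH_eq]
  have h1 : MeasureTheory.IntegrableOn (fun t : ℝ => t ^ (-(s.re+1))) (Set.Ioi 1) :=
    integrableOn_Ioi_rpow_of_lt (by linarith) one_pos
  refine (MeasureTheory.norm_integral_le_of_norm_le h1 ?_).trans ?_
  · filter_upwards [MeasureTheory.ae_restrict_mem measurableSet_Ioi] with t ht
    have ht0 : (0:ℝ) < t := lt_trans one_pos ht
    rw [norm_mul, Complex.norm_cpow_eq_rpow_re_of_pos ht0, Complex.norm_real, Real.norm_eq_abs,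
      abs_of_nonneg (Int.fract_nonneg t)]
    have := (Int.fract_lt_one t).le
    have h2 : 0 ≤ t ^ (-(s.re+1)) := by positivity
    simp only [Complex.neg_re, Complex.add_re, Complex.one_re]
    nlinarith
  · rw [integral_Ioi_rpow_of_lt (by linarith) one_pos]
    simp

lemma zeta_eq {s : ℂ} (hs : 1 < s.re) : riemannZeta s = s / (s - 1) - s * HH s := by
  have h := LSeries_eq_mul_integral' (fun _ => (1:ℂ)) (r := 1) zero_le_one (s := s) hs (by
    simp only [norm_one, Finset.sum_const, Nat.card_Icc, add_tsub_cancel_right, nsmul_eq_mul, mul_one, Real.rpow_one]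
    exact Asymptotics.isBigO_refl _ _)
  have h0 : LSeries (fun _ => (1:ℂ)) s = riemannZeta s := by
    have := LSeries_one_eq_riemannZeta hs
    exact this
  rw [h0] at h
  rw [h, HH_eq]
  have hs0 : s - 1 ≠ 0 := by
    intro h; have : s = 1 := by linear_combination h
    rw [this] at hs; simp at hs
  have hi1 : MeasureTheory.IntegrableOn (fun t : ℝ => (t:ℂ) ^ (-s)) (Set.Ioi 1) :=
    integrableOn_Ioi_cpow_of_lt (by simpa using hs) one_pos
  have hi2 : MeasureTheory.IntegrableOn (fun t : ℝ => ((Int.fract t : ℝ) : ℂ) * (t:ℂ) ^ (-(s+1))) (Set.Ioi 1) := by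
    have hi3 : MeasureTheory.IntegrableOn (fun t : ℝ => (t:ℂ) ^ (-(s+1))) (Set.Ioi 1) :=
      integrableOn_Ioi_cpow_of_lt (by simp; linarith) one_pos
    refine MeasureTheory.Integrable.bdd_mul (c := 1) hi3 ?_ ?_
    · exact (Complex.measurable_ofReal.comp measurable_fract).aestronglyMeasurable
    · filter_upwards with t
      rw [Complex.norm_real, Real.norm_eq_abs, abs_of_nonneg (Int.fract_nonneg t)]
      exact (Int.fract_lt_one t).le
  have : ∫ t in Set.Ioi (1:ℝ), (∑ k ∈ Finset.Icc 1 ⌊t⌋₊, (1:ℂ)) * (t:ℂ) ^ (-(s+1)) =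
     (∫ t in Set.Ioi (1:ℝ), (t:ℂ) ^ (-s)) - ∫ t in Set.Ioi (1:ℝ), ((Int.fract t : ℝ) : ℂ) * (t:ℂ) ^ (-(s+1)) := by
    rw [← MeasureTheory.integral_sub hi1 hi2]
    refine MeasureTheory.setIntegral_congr_fun measurableSet_Ioi ?_
    intro t ht
    have ht0 : (0:ℝ) < t := lt_trans one_pos ht
    have ht1 : (t:ℂ) ≠ 0 := by exact_mod_cast ht0.ne'
    have e1 : (t:ℂ) ^ (-s) = t * (t:ℂ) ^ (-(s+1)) := by
      have : -s = 1 + -(s+1) := by ring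
      rw [this, Complex.cpow_add _ _ ht1, Complex.cpow_one]
    simp only [e1]
    rw [← sub_mul]
    congr 1
    simp only [Finset.sum_const, Nat.card_Icc, add_tsub_cancel_right, nsmul_eq_mul, mul_one]
    have : ((⌊t⌋₊ : ℝ)) = t - Int.fract t := by
      rw [natCast_floor_eq_intCast_floor ht0.le]
      linarith [Int.floor_add_fract t]
    calc ((⌊t⌋₊ : ℕ) : ℂ) = (((⌊t⌋₊ : ℕ) : ℝ) : ℂ) := by simp
      _ = _ := by rw [this]; push_cast; rfl
  rw [this, integral_Ioi_cpow_of_lt (by simpa using hs) one_pos]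
  have : -s + 1 ≠ 0 := by intro h; apply hs0; linear_combination -h
  simp
  field_simp
  ring

/-- entire version of (s-1)ζ(s) with formula -/
lemma Z_eq {s : ℂ} (hs : 0 < s.re) : riemannZeta₁ s = s - s * (s - 1) * HH s := by
  have hopen : IsOpen {s : ℂ | 0 < s.re} := isOpen_lt continuous_const Complex.continuous_re
  have h1 : AnalyticOnNhd ℂ riemannZeta₁ {s : ℂ | 0 < s.re} :=
    differentiable_riemannZeta₁.differentiableOn.analyticOnNhd hopen
  have h2 : AnalyticOnNhd ℂ (fun s => s - s * (s - 1) * HH s) {s : ℂ | 0 < s.re} := by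
    apply DifferentiableOn.analyticOnNhd _ hopen
    intro s hs
    apply DifferentiableAt.differentiableWithinAt
    have := HH_diff hs
    fun_prop
  have hconv : IsPreconnected {s : ℂ | 0 < s.re} := (convex_halfSpace_re_gt 0).isPreconnected
  refine h1.eqOn_of_preconnected_of_eventuallyEq h2 hconv (z₀ := 2) (by simp) ?_ hs
  have : {s : ℂ | 1 < s.re} ∈ nhds (2:ℂ) := (isOpen_lt continuous_const Complex.continuous_re).mem_nhds (by simp)
  filter_upwards [this] with s hs
  have hs0 : s - 1 ≠ 0 := by
    intro h; have : s = 1 := by linear_combination h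
    rw [this] at hs; simp at hs
  have h3 := riemannZeta_eq_inv_sub_mul (s := s) (by intro h; apply hs0; rw [h]; ring)
  rw [zeta_eq hs] at h3
  field_simp at h3
  linear_combination -h3

end TP


namespace TP

lemma norm_le_b (s : ℂ) (A : ℝ) (hA : |s.re| ≤ A) : ‖s‖ ≤ A + |s.im| :=
  (Complex.norm_le_abs_re_add_abs_im s).trans (by linarith)

lemma Z_bd {s : ℂ} (h1 : 1/2 ≤ s.re) (h2 : s.re ≤ 3) : ‖riemannZeta₁ s‖ ≤ 15 * (1 + |s.im|)^2 := by
  rw [Z_eq (by linarith)]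
  have a1 := norm_le_b s 3 (by rw [abs_le]; constructor <;> linarith)
  have a2 := norm_le_b (s-1) 2 (by simp; rw [abs_le]; constructor <;> linarith)
  have a3 := HH_norm (s := s) (by linarith)
  have a4 : ‖HH s‖ ≤ 2 := a3.trans (by rw [div_le_iff₀ (by linarith)]; linarith)
  simp at a2
  have h0 := abs_nonneg s.im
  calc ‖s - s * (s - 1) * HH s‖ ≤ ‖s‖ + ‖s‖ * ‖s - 1‖ * ‖HH s‖ := by
        refine (norm_sub_le _ _).trans ?_
        rw [norm_mul, norm_mul]
    _ ≤ (3 + |s.im|) + (3 + |s.im|) * (2 + |s.im|) * 2 := by gcongr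
    _ ≤ _ := by nlinarith

lemma deriv_bd (f : ℂ → ℂ) (hf : Differentiable ℂ f) (K l r : ℝ) (hK : 0 ≤ K)
    (h : ∀ s : ℂ, l ≤ s.re → s.re ≤ r → ‖f s‖ ≤ K * (1+|s.im|)^2) {s : ℂ}
    (h1 : l + 1/4 ≤ s.re) (h2 : s.re ≤ r - 1/4) : ‖deriv f s‖ ≤ 7 * K * (1 + |s.im|)^2 := by
  have := Complex.norm_deriv_le_of_forall_mem_sphere_norm_le (f := f) (c := s) (R := 1/4)
    (C := K * (5/4 + |s.im|)^2) (by norm_num) hf.diffContOnCl (by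
      intro z hz
      have hz' : ‖z - s‖ = 1/4 := by simpa [Complex.dist_eq] using hz
      have b1 := Complex.abs_re_le_norm (z - s)
      have b2 := Complex.abs_im_le_norm (z - s)
      rw [hz'] at b1 b2
      simp only [Complex.sub_re, Complex.sub_im] at b1 b2
      rw [abs_le] at b1
      refine (h z (by linarith) (by linarith)).trans ?_
      have : |z.im| ≤ |s.im| + 1/4 := by
        have := abs_sub_abs_le_abs_sub z.im s.im
        linarith
      gcongr K * ?_^2
      linarith)
  refine this.trans ?_
  rw [div_le_iff₀ (by norm_num)]
  have h0 := abs_nonneg s.im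
  have : (5/4 + |s.im|)^2 ≤ 7/4 * (1+|s.im|)^2 := by nlinarith
  nlinarith

lemma Z'_diff : Differentiable ℂ (deriv riemannZeta₁) :=
  fun s => ((differentiable_riemannZeta₁.analyticAt s).deriv).differentiableAt

lemma Z'_bd {s : ℂ} (h1 : 3/4 ≤ s.re) (h2 : s.re ≤ 11/4) :
    ‖deriv riemannZeta₁ s‖ ≤ 105 * (1 + |s.im|)^2 := by
  have := deriv_bd riemannZeta₁ differentiable_riemannZeta₁ 15 (1/2) 3 (by norm_num)
    (fun s a b => Z_bd a b) (s := s) (by linarith) (by linarith)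
  linarith

lemma Z''_bd {s : ℂ} (h1 : 1 ≤ s.re) (h2 : s.re ≤ 5/2) :
    ‖deriv (deriv riemannZeta₁) s‖ ≤ 735 * (1 + |s.im|)^2 := by
  have := deriv_bd (deriv riemannZeta₁) Z'_diff 105 (3/4) (11/4) (by norm_num)
    (fun s a b => Z'_bd a b) (s := s) (by linarith) (by linarith)
  linarith

lemma zeta341 {x : ℝ} (hx : 0 < x) (y : ℝ) :
    1 ≤ ‖riemannZeta (1 + x)‖^3 * ‖riemannZeta (1 + x + Complex.I * y)‖^4 *
      ‖riemannZeta (1 + x + 2 * Complex.I * y)‖ := by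
  have := DirichletCharacter.norm_LFunction_product_ge_one (1 : DirichletCharacter ℂ 1) hx y
  simpa [DirichletCharacter.LFunctionTrivChar, DirichletCharacter.LFunction_modOne_eq] using this

lemma Z341 {x : ℝ} (hx : 0 < x) (y : ℝ) (hy : y ≠ 0) :
    x^3 * |y|^5 ≤ ‖riemannZeta₁ (1 + x)‖^3 * ‖riemannZeta₁ (1 + x + Complex.I * y)‖^4 *
      ‖riemannZeta₁ (1 + x + 2 * Complex.I * y)‖ := by
  have h := zeta341 hx y
  have key : ∀ w : ℂ, w ≠ 0 → ‖riemannZeta₁ (1 + w)‖ = ‖w‖ * ‖riemannZeta (1+w)‖ := by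
    intro w hw
    have := riemannZeta_eq_inv_sub_mul (s := 1 + w) (by intro h; apply hw; linear_combination h)
    rw [this, ← norm_mul]
    congr 1
    simp only [add_sub_cancel_left]
    field_simp
  have i1 : (x:ℂ) ≠ 0 := by exact_mod_cast hx.ne'
  have i2 : (x:ℂ) + Complex.I * y ≠ 0 := by
    intro h; have := congrArg Complex.re h; simp at this; exact hx.ne' this
  have i3 : (x:ℂ) + 2 * Complex.I * y ≠ 0 := by
    intro h; have := congrArg Complex.re h; simp at this; exact hx.ne' this
  have k1 := key _ i1
  have k2 := key _ i2
  have k3 := key _ i3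
  rw [← add_assoc] at k2 k3
  rw [k1, k2, k3]
  have n1 : ‖(x:ℂ)‖ = x := by simp [abs_of_pos hx]
  have n2 : |y| ≤ ‖(x:ℂ) + Complex.I * y‖ := by
    have := Complex.abs_im_le_norm ((x:ℂ) + Complex.I * y); simpa using this
  have n3 : |y| ≤ ‖(x:ℂ) + 2 * Complex.I * y‖ := by
    have := Complex.abs_im_le_norm ((x:ℂ) + 2 * Complex.I * y)
    simp at this
    have h0 := abs_nonneg y
    linarith
  rw [n1]
  calc x^3 * |y|^5 = (x^3 * (|y|^4 * |y|)) * 1 := by ring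
    _ ≤ (x^3 * (‖(x:ℂ) + Complex.I * y‖^4 * ‖(x:ℂ) + 2 * Complex.I * y‖)) * (‖riemannZeta (1 + x)‖^3 * ‖riemannZeta (1 + x + Complex.I * y)‖^4 *
      ‖riemannZeta (1 + x + 2 * Complex.I * y)‖) := by gcongr
    _ = _ := by ring

lemma Z_low4 {x : ℝ} (hx : 0 < x) (hx1 : x ≤ 1) (y : ℝ) (hy : 1/4 ≤ |y|) :
    x^3 / 10^9 ≤ ‖riemannZeta₁ (1 + x + Complex.I * y)‖^4 := by
  have h := Z341 hx y (by intro h; rw [h] at hy; norm_num at hy)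
  have u1 := Z_bd (s := 1 + x) (by simp; linarith) (by simp; linarith)
  have u3 := Z_bd (s := 1 + x + 2 * Complex.I * y) (by simp; linarith) (by simp; linarith)
  simp at u1 u3
  set m := ‖riemannZeta₁ (1 + x + Complex.I * y)‖^4 with hm
  have hm0 : 0 ≤ m := by positivity
  set b := |y| with hb
  have : x^3 * b^5 ≤ 15^3 * m * (15 * (1 + 2*b)^2) := by
    refine h.trans ?_
    gcongr
  have h2 : (1+2*b)^2 ≤ 36 * b^2 := by nlinarith
  have h3 : x^3 * b^5 ≤ 15^3 * m * (15 * (36 * b^2)) := this.trans (by gcongr)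
  have hb2 : 0 < b^2 := by positivity
  have h4 : x^3 * b^3 ≤ 15^3*15*36 * m := by
    have : (x^3 * b^3) * b^2 ≤ (15^3*15*36 * m) * b^2 := by nlinarith
    exact le_of_mul_le_mul_right this hb2
  have h5 : (1/4)^3 ≤ b^3 := by gcongr
  have h6 : 0 ≤ x^3 := by positivity
  rw [div_le_iff₀ (by norm_num)]
  nlinarith

lemma Z_low {x : ℝ} (hx : 0 < x) (hx1 : x ≤ 1/4) (y : ℝ) :
    1 / (10^17 * (1+|y|)^6) ≤ ‖riemannZeta₁ (1 + x + Complex.I * y)‖ := by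
  set b := 1 + |y| with hb
  have hb1 : 1 ≤ b := by have := abs_nonneg y; linarith
  have hb6 : 1 ≤ b^6 := one_le_pow₀ hb1
  rcases le_or_gt (1/4) |y| with hy | hy
  · set δ : ℝ := 1 / (10^19 * b^8) with hδ
    have hb8 : 1 ≤ b^8 := one_le_pow₀ hb1
    have hδ0 : 0 < δ := by positivity
    have hδ1 : δ ≤ 1/4 := by
      rw [hδ, div_le_div_iff₀ (by positivity) (by norm_num)]; linarith
    have hval : 100 * b^2 * δ ≥ 1 / (10^17 * b^6) := by
      rw [hδ]; apply le_of_eq; field_simp; norm_num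
    have low : ∀ x' : ℝ, δ ≤ x' → x' ≤ 1 → 210 * b^2 * δ ≤ ‖riemannZeta₁ (1 + x' + Complex.I * y)‖ := by
      intro x' h1 h2
      have h := Z_low4 (lt_of_lt_of_le hδ0 h1) h2 y hy
      have h3 : (210 * b^2 * δ)^4 ≤ x'^3/10^9 := by
        have : δ^3 ≤ x'^3 := by gcongr
        have h5 : (210 * b^2 * δ)^4 = 210^4 * b^8 * δ * δ^3 := by ring
        have h6 : b^8 * δ = 1/10^19 := by rw [hδ]; field_simp
        have h7 : (210 * b^2 * δ)^4 = 210^4 /10^19 * δ^3 := by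
          rw [h5, mul_assoc (210^4) (b^8) δ, h6]; ring
        rw [h7]
        have : 0 ≤ δ^3 := by positivity
        have h8 : (210:ℝ)^4/10^19 ≤ 1/10^9 := by norm_num
        calc (210:ℝ)^4/10^19 * δ^3 ≤ 1/10^9 * x'^3 := by gcongr
          _ = _ := by ring
      exact le_of_pow_le_pow_left₀ (by norm_num) (norm_nonneg _) (h3.trans h)
    rcases le_or_gt δ x with h | h
    · have := low x h (by linarith)
      have h0 : 0 ≤ b^2 * δ := by positivity
      nlinarith
    · have h1 := low δ le_rfl (by linarith)
      have h2 : ‖riemannZeta₁ (1 + δ + Complex.I * y) - riemannZeta₁ (1 + x + Complex.I * y)‖ ≤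
          105 * b^2 * ‖(1 + δ + Complex.I * y : ℂ) - (1 + x + Complex.I * y)‖ := by
        refine (convex_halfSpace_re_ge (1:ℝ) |>.inter (convex_halfSpace_re_le (11/4:ℝ)) |>.inter
          ((convex_halfSpace_im_ge y).inter (convex_halfSpace_im_le y))).norm_image_sub_le_of_norm_deriv_le (f := riemannZeta₁) ?_ ?_ ?_ ?_
        · intro z _; exact differentiable_riemannZeta₁ z
        · rintro z ⟨⟨a1, a2⟩, a3, a4⟩
          simp only [Set.mem_ofPred_eq] at a1 a2 a3 a4
          have a5 : z.im = y := le_antisymm a4 a3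
          have := Z'_bd (s := z) (by linarith) (by linarith)
          rwa [a5] at this
        · simp; refine ⟨hx.le, by linarith⟩
        · simp; refine ⟨hδ0.le, by linarith⟩
      have h3 : ‖(1 + δ + Complex.I * y : ℂ) - (1 + x + Complex.I * y)‖ ≤ δ := by
        have : (1 + δ + Complex.I * y : ℂ) - (1 + x + Complex.I * y) = ((δ - x : ℝ) : ℂ) := by push_cast; ring
        rw [this, Complex.norm_real, Real.norm_eq_abs, abs_of_nonneg (by linarith)]
        linarith
      have h4 := norm_sub_norm_le (riemannZeta₁ (1 + δ + Complex.I * y)) (riemannZeta₁ (1 + x + Complex.I * y))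
      have h5 : 105 * b^2 * ‖(1 + δ + Complex.I * y : ℂ) - (1 + x + Complex.I * y)‖ ≤ 105 * b^2 * δ := by gcongr
      have h6 : 0 ≤ b^2 * δ := by positivity
      nlinarith
  · have h1 : (1:ℝ) / (10^17 * b^6) ≤ 1/2 := by
      rw [div_le_div_iff₀ (by positivity) (by norm_num)]; linarith
    refine h1.trans ?_
    set s : ℂ := 1 + x + Complex.I * y with hs
    have hre : s.re = 1 + x := by simp [hs]
    rw [Z_eq (by rw [hre]; linarith)]
    have a1 : 1 ≤ ‖s‖ := by
      have := Complex.abs_re_le_norm s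
      rw [hre, abs_of_pos (by linarith)] at this
      linarith
    have a2 : ‖s - 1‖ ≤ 1/2 := by
      have := Complex.norm_le_abs_re_add_abs_im (s - 1)
      simp [hs] at this
      rw [abs_of_pos hx] at this
      linarith
    have a3 : ‖HH s‖ ≤ 1 := by
      refine (HH_norm (by rw [hre]; linarith)).trans ?_
      rw [hre, div_le_iff₀ (by linarith)]; linarith
    have : s - s * (s-1) * HH s = s * (1 - (s-1) * HH s) := by ring
    rw [this, norm_mul]
    have a4 : 1/2 ≤ ‖1 - (s-1) * HH s‖ := by
      have := norm_sub_norm_le (1:ℂ) ((s-1)*HH s)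
      rw [norm_one, norm_mul] at this
      have : ‖s-1‖ * ‖HH s‖ ≤ 1/2 * 1 := by gcongr
      linarith
    nlinarith

/-- The regularised Laplace transform. -/
noncomputable def GG (s : ℂ) : ℂ := -(1/s) * (1 + deriv riemannZeta₁ s / riemannZeta₁ s)

lemma GG_bd : ∃ K : ℝ, 0 < K ∧ ∀ x : ℝ, 0 < x → x ≤ 1/4 → ∀ y : ℝ,
    ‖GG (1 + x + Complex.I * y)‖ ≤ K * (1+|y|)^16 ∧
    ∃ D : ℂ, HasDerivAt GG D (1 + x + Complex.I * y) ∧ ‖D‖ ≤ K * (1+|y|)^16 := by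
  refine ⟨10^45, by positivity, fun x hx hx1 y => ?_⟩
  set s : ℂ := 1 + x + Complex.I * y with hs
  have hre : s.re = 1 + x := by simp [hs]
  have him : s.im = y := by simp [hs]
  set b := 1 + |y| with hb
  have hb1 : 1 ≤ b := by have := abs_nonneg y; linarith
  have l0 := Z_low hx hx1 y
  rw [← hs, ← hb] at l0
  have hb6 : 0 < b^6 := by positivity
  have hZpos : 0 < ‖riemannZeta₁ s‖ := lt_of_lt_of_le (by positivity) l0
  have hZ0 : riemannZeta₁ s ≠ 0 := norm_pos_iff.mp hZpos
  have linv : 1 / ‖riemannZeta₁ s‖ ≤ 10^17 * b^6 := by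
    rw [div_le_iff₀ hZpos]
    rw [div_le_iff₀ (by positivity)] at l0
    linarith
  have u1 := Z'_bd (s := s) (by rw [hre]; linarith) (by rw [hre]; linarith)
  have u2 := Z''_bd (s := s) (by rw [hre]; linarith) (by rw [hre]; linarith)
  rw [him, ← hb] at u1 u2
  have a1 : 1 ≤ ‖s‖ := by
    have := Complex.abs_re_le_norm s
    rw [hre, abs_of_pos (by linarith)] at this
    linarith
  have hs0 : s ≠ 0 := by intro h; rw [h] at a1; norm_num at a1
  have a2 : ‖1/s‖ ≤ 1 := by
    rw [norm_div, norm_one, div_le_iff₀ (by linarith)]; linarith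
  have q1 : ‖deriv riemannZeta₁ s / riemannZeta₁ s‖ ≤ 10^20 * b^8 := by
    rw [norm_div, div_eq_mul_one_div]
    calc ‖deriv riemannZeta₁ s‖ * (1 / ‖riemannZeta₁ s‖) ≤ (105 * b^2) * (10^17 * b^6) := by gcongr
      _ ≤ _ := by nlinarith [show 0 ≤ b^8 by positivity]
  have q2 : ‖deriv (deriv riemannZeta₁) s / riemannZeta₁ s‖ ≤ 10^20 * b^8 := by
    rw [norm_div, div_eq_mul_one_div]
    calc ‖deriv (deriv riemannZeta₁) s‖ * (1 / ‖riemannZeta₁ s‖) ≤ (735 * b^2) * (10^17 * b^6) := by gcongr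
      _ ≤ _ := by nlinarith [show 0 ≤ b^8 by positivity]
  have hb8 : 1 ≤ b^8 := one_le_pow₀ hb1
  have hb16 : b^8 ≤ b^16 := pow_le_pow_right₀ hb1 (by norm_num)
  have q3 : ‖1 + deriv riemannZeta₁ s / riemannZeta₁ s‖ ≤ 10^21 * b^8 := by
    refine (norm_add_le _ _).trans ?_
    rw [norm_one]; linarith
  constructor
  · unfold GG
    rw [norm_mul, norm_neg]
    calc ‖1/s‖ * _ ≤ 1 * (10^21 * b^8) := by gcongr
      _ ≤ _ := by linarith
  · have d1 : HasDerivAt riemannZeta₁ (deriv riemannZeta₁ s) s := (differentiable_riemannZeta₁ s).hasDerivAt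
    have d2 : HasDerivAt (deriv riemannZeta₁) (deriv (deriv riemannZeta₁) s) s := (Z'_diff s).hasDerivAt
    have d3 := (d2.div d1 hZ0).const_add 1
    have d4 : HasDerivAt (fun s : ℂ => -(1/s)) (1/s^2) s := by
      have := (hasDerivAt_inv hs0).fun_neg
      simpa using this
    have d5 := d4.mul d3
    refine ⟨_, d5, ?_⟩
    have e1 : (deriv (deriv riemannZeta₁) s * riemannZeta₁ s - deriv riemannZeta₁ s * deriv riemannZeta₁ s) /
        riemannZeta₁ s ^ 2 = deriv (deriv riemannZeta₁) s / riemannZeta₁ s - (deriv riemannZeta₁ s / riemannZeta₁ s)^2 := by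
      field_simp
    have e2 : ‖deriv (deriv riemannZeta₁) s / riemannZeta₁ s - (deriv riemannZeta₁ s / riemannZeta₁ s)^2‖ ≤ 10^41 * b^16 := by
      refine (norm_sub_le _ _).trans ?_
      rw [norm_pow]
      calc _ ≤ 10^20*b^8 + (10^20*b^8)^2 := by gcongr
        _ = 10^20*b^8 + 10^40 * b^16 := by ring
        _ ≤ _ := by linarith
    refine (norm_add_le _ _).trans ?_
    rw [norm_mul, norm_mul, norm_neg]
    have e3 : ‖1/s^2‖ ≤ 1 := by
      have : 1/s^2 = (1/s)^2 := by rw [div_pow, one_pow]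
      rw [this, norm_pow]; exact pow_le_one₀ (norm_nonneg _) a2
    rw [e1]
    calc _ ≤ 1 * (10^21*b^8) + 1 * (10^41*b^16) := by
          gcongr
          exact q3
      _ ≤ _ := by linarith

end TP


namespace TP
open MeasureTheory

/-- normalised error in the prime number theorem -/
noncomputable def dd (v : ℝ) : ℝ := Chebyshev.psi (Real.exp v) * Real.exp (-v) - 1

lemma dd_bd (v : ℝ) : |dd v| ≤ 6 := by
  unfold dd
  have h1 := Chebyshev.psi_nonneg (Real.exp v)
  have h2 := Chebyshev.psi_le_const_mul_self (Real.exp_pos v).le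
  have h3 : Real.log 4 ≤ 3 := by
    have := Real.log_le_sub_one_of_pos (show (0:ℝ) < 4 by norm_num); linarith
  have h4 : Chebyshev.psi (Real.exp v) * Real.exp (-v) ≤ 7 := by
    calc _ ≤ ((Real.log 4 + 4) * Real.exp v) * Real.exp (-v) := by gcongr
      _ = Real.log 4 + 4 := by rw [mul_assoc, ← Real.exp_add]; simp
      _ ≤ 7 := by linarith
  have h5 : 0 ≤ Chebyshev.psi (Real.exp v) * Real.exp (-v) := by positivity
  rw [abs_le]; constructor <;> linarith

lemma dd_meas : Measurable dd := by
  unfold dd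
  have : Measurable Chebyshev.psi := Chebyshev.psi_mono.measurable
  exact ((this.comp Real.measurable_exp).mul (Real.measurable_exp.comp measurable_neg)).sub_const 1

lemma psi_integral {s : ℂ} (hs : 1 < s.re) :
    -deriv riemannZeta s / riemannZeta s = s * ∫ v in Set.Ioi (0:ℝ), (Chebyshev.psi (Real.exp v) : ℂ) * Complex.exp (-s * v) := by
  rw [← ArithmeticFunction.LSeries_vonMangoldt_eq_deriv_riemannZeta_div hs]
  have hsum : ∀ n : ℕ, ∑ k ∈ Finset.Icc 1 n, ArithmeticFunction.vonMangoldt k = Chebyshev.psi n := by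
    intro n
    rw [Chebyshev.psi_eq_sum_Icc, Nat.floor_natCast]
    rw [← Finset.insert_Icc_add_one_left_eq_Icc n.zero_le, Finset.sum_insert (by simp)]
    simp
  rw [LSeries_eq_mul_integral_of_nonneg ArithmeticFunction.vonMangoldt (r := 1) zero_le_one hs ?_
    (fun n => ArithmeticFunction.vonMangoldt_nonneg)]
  · congr 1
    have e : Set.Ioi (1:ℝ) = Real.exp '' Set.Ioi 0 := by rw [Real.image_exp_Ioi, Real.exp_zero]
    rw [e, integral_image_eq_integral_abs_deriv_smul (f' := Real.exp) measurableSet_Ioi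
      (fun x _ => (Real.hasDerivAt_exp x).hasDerivWithinAt) Real.exp_injective.injOn]
    refine setIntegral_congr_fun measurableSet_Ioi ?_
    intro v hv
    simp only [abs_of_pos (Real.exp_pos v)]
    have h1 : (∑ k ∈ Finset.Icc 1 ⌊Real.exp v⌋₊, (ArithmeticFunction.vonMangoldt k : ℂ)) = (Chebyshev.psi (Real.exp v) : ℂ) := by
      rw [Chebyshev.psi_eq_psi_coe_floor, ← hsum]; push_cast; rfl
    rw [h1, Complex.ofReal_exp, ← Complex.ofReal_exp, Complex.real_smul]
    have h2 : ((Real.exp v : ℝ) : ℂ) ^ (-(s+1)) = Complex.exp (-(s+1) * v) := by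
      rw [Complex.cpow_def_of_ne_zero (by exact_mod_cast (Real.exp_pos v).ne'), ← Complex.ofReal_log (Real.exp_pos v).le,
        Real.log_exp]
      ring_nf
    rw [h2]
    have h3 : Complex.exp (-s * v) = Complex.exp v * Complex.exp (-(s+1) * v) := by
      rw [← Complex.exp_add]; ring_nf
    rw [h3]; push_cast; ring
  · simp_rw [hsum, Real.rpow_one]
    apply Asymptotics.IsBigO.of_bound (Real.log 4 + 4)
    filter_upwards with n
    rw [Real.norm_of_nonneg (Chebyshev.psi_nonneg _), Real.norm_of_nonneg (by positivity)]
    exact Chebyshev.psi_le_const_mul_self (by positivity)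

lemma dd_int {w : ℂ} (hw : 0 < w.re) : IntegrableOn (fun v : ℝ => (dd v : ℂ) * Complex.exp (-w * v)) (Set.Ioi 0) := by
  refine Integrable.bdd_mul (c := 6) (integrableOn_exp_mul_complex_Ioi (by simpa using hw) 0) ?_ ?_
  · exact (Complex.measurable_ofReal.comp dd_meas).aestronglyMeasurable
  · filter_upwards with t
    rw [Complex.norm_real]; exact dd_bd t

lemma laplace {w : ℂ} (hw : 0 < w.re) (hW : riemannZeta₁ (1 + w) ≠ 0) :
    ∫ v in Set.Ioi (0:ℝ), (dd v : ℂ) * Complex.exp (-w * v) = GG (1 + w) := by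
  have h1 := psi_integral (s := 1 + w) (by simpa using hw)
  have hw0 : w ≠ 0 := by intro h; rw [h] at hw; simp at hw
  have hs0 : 1 + w ≠ 0 := by
    intro h; have := congrArg Complex.re h; simp at this; linarith
  have hi : IntegrableOn (fun v : ℝ => Complex.exp (-w * v)) (Set.Ioi 0) :=
    integrableOn_exp_mul_complex_Ioi (by simpa using hw) 0
  have h2 : ∫ v in Set.Ioi (0:ℝ), (Chebyshev.psi (Real.exp v) : ℂ) * Complex.exp (-(1+w) * v) =
     (∫ v in Set.Ioi (0:ℝ), (dd v : ℂ) * Complex.exp (-w * v)) + ∫ v in Set.Ioi (0:ℝ), Complex.exp (-w * v) := by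
    rw [← integral_add (dd_int hw) hi]
    refine setIntegral_congr_fun measurableSet_Ioi ?_
    intro v hv
    simp only [dd]
    have : Complex.exp (-(1+w) * v) = Complex.exp (-v) * Complex.exp (-w * v) := by
      rw [← Complex.exp_add]; ring_nf
    rw [this]; push_cast; ring
  rw [h2, integral_exp_mul_complex_Ioi (by simpa using hw)] at h1
  have hs1 : (1 + w) ≠ 1 := by intro h; apply hw0; linear_combination h
  rw [deriv_riemannZeta_eq_neg_inv_sub_sq_mul_add hs1, riemannZeta_eq_inv_sub_mul hs1] at h1
  unfold GG
  generalize (∫ v in Set.Ioi (0:ℝ), (dd v : ℂ) * Complex.exp (-w * v)) = X at *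
  simp only [add_sub_cancel_left, Complex.ofReal_zero, mul_zero, Complex.exp_zero] at h1
  generalize deriv riemannZeta₁ (1+w) = A at *
  generalize riemannZeta₁ (1+w) = B at *
  field_simp at h1 ⊢
  apply mul_left_cancel₀ hw0
  linear_combination -h1

/-- Fejér kernel -/
noncomputable def kk (l a : ℝ) : ℝ := (1 - Real.cos (l * a)) / (l * a^2)

lemma fejer (l : ℝ) (hl : 0 < l) (a : ℝ) (ha : a ≠ 0) :
    (∫ u in (0:ℝ)..l, ((1 - u / l : ℝ) : ℂ) * Complex.exp (Complex.I * u * a)).re = kk l a := by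
  have hI : Complex.I * a ≠ 0 := mul_ne_zero Complex.I_ne_zero (by exact_mod_cast ha)
  have hla : (l:ℂ) ≠ 0 := by exact_mod_cast hl.ne'
  have haa : (a:ℂ) ≠ 0 := by exact_mod_cast ha
  have hder : ∀ u ∈ Set.uIcc (0:ℝ) l, HasDerivAt (fun u : ℝ => (1 - u/l : ℂ) * Complex.exp (Complex.I * u * a) / (Complex.I * a)
      + Complex.exp (Complex.I * u * a) / (l * (Complex.I * a)^2)) (((1 - u / l : ℝ) : ℂ) * Complex.exp (Complex.I * u * a)) u := by
    intro u _
    have d0 : HasDerivAt (fun u : ℝ => (u:ℂ)) 1 u := Complex.ofRealCLM.hasDerivAt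
    have d1 : HasDerivAt (fun u : ℝ => Complex.exp (Complex.I * u * a)) (Complex.exp (Complex.I * u * a) * (Complex.I * 1 * a)) u :=
      ((d0.const_mul Complex.I).mul_const (a:ℂ)).cexp
    have d2 := ((d0.div_const (l:ℂ)).const_sub 1)
    have d3 := ((d2.fun_mul d1).div_const (Complex.I * a)).fun_add (d1.div_const (l * (Complex.I * a)^2))
    refine d3.congr_deriv ?_
    push_cast
    field_simp
    ring
  rw [intervalIntegral.integral_eq_sub_of_hasDerivAt hder (Continuous.intervalIntegrable (by fun_prop) _ _)]
  have hx : Complex.exp (Complex.I * l * a) = Complex.cos (l*a) + Complex.sin (l*a) * Complex.I := by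
    rw [← Complex.exp_mul_I]; ring_nf
  rw [hx]
  have : (1 - (l:ℂ) / l) = 0 := by field_simp; simp
  rw [this]
  simp only [Complex.ofReal_zero, mul_zero, zero_mul, Complex.exp_zero, zero_div, sub_zero, zero_add]
  have e : (Complex.cos (l*a) + Complex.sin (l*a) * Complex.I) / (l * (Complex.I * a)^2) - (1 * 1 / (Complex.I * a) + 1 / (l * (Complex.I * a)^2))
    = (((1 - Real.cos (l*a)) / (l * a^2) : ℝ) : ℂ) + ((1/a - Real.sin (l*a) / (l * a^2) : ℝ) : ℂ) * Complex.I := by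
    push_cast
    rw [mul_pow, Complex.I_sq]
    field_simp
    ring_nf
    simp only [Complex.I_sq]
    ring
  rw [e]
  simp only [Complex.add_re, Complex.ofReal_re, Complex.mul_re, Complex.I_re, Complex.I_im, Complex.ofReal_im, mul_zero, zero_mul, sub_zero, add_zero, mul_one]
  rfl
end TP


namespace TP
open MeasureTheory

lemma laplace' {ε : ℝ} (hε : 0 < ε) (hε' : ε ≤ 1/4) (u : ℝ) :
    ∫ v in Set.Ioi (0:ℝ), (dd v : ℂ) * Complex.exp (-(ε + Complex.I * u) * v) = GG (1 + ε + Complex.I * u) := by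
  rw [laplace (w := ε + Complex.I * u) (by simpa using hε)]
  · rw [add_assoc]
  · rw [← add_assoc]
    have := Z_low hε hε' u
    intro h
    rw [h, norm_zero] at this
    have h2 : (0:ℝ) < 1/(10^17*(1+|u|)^6) := by positivity
    linarith

lemma FF_int {ε l T : ℝ} (hε : 0 < ε) (hl : 0 < l) :
    Integrable (Function.uncurry (fun (u v : ℝ) => (((1 - u / l : ℝ) : ℂ) * (dd v * Complex.exp (-(ε:ℂ) * v))) * Complex.exp (Complex.I * u * (T - v : ℝ))))
      ((volume.restrict (Set.Ioc 0 l)).prod (volume.restrict (Set.Ioi (0:ℝ)))) := by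
  have h1 : Integrable (fun u : ℝ => ((1 - u / l : ℝ) : ℂ)) (volume.restrict (Set.Ioc 0 l)) := by
    have : IntervalIntegrable (fun u : ℝ => ((1 - u / l : ℝ) : ℂ)) volume 0 l := Continuous.intervalIntegrable (by fun_prop) _ _
    rwa [intervalIntegrable_iff_integrableOn_Ioc_of_le hl.le] at this
  have h2 : Integrable (fun v : ℝ => (dd v : ℂ) * Complex.exp (-(ε:ℂ) * v)) (volume.restrict (Set.Ioi (0:ℝ))) :=
    dd_int (w := ε) (by simpa using hε)
  refine Integrable.mul_bdd (c := 1) (h1.mul_prod h2) ?_ ?_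
  · apply Continuous.aestronglyMeasurable
    fun_prop
  · filter_upwards with z
    rw [Complex.norm_exp]
    simp

lemma conv {ε l T : ℝ} (hε : 0 < ε) (hε' : ε ≤ 1/4) (hl : 0 < l) :
    ∫ v in Set.Ioi (0:ℝ), dd v * Real.exp (-ε * v) * kk l (T - v) =
    (∫ u in (0:ℝ)..l, (((1 - u / l : ℝ) : ℂ) * GG (1 + ε + Complex.I * u)) * Complex.exp (Complex.I * u * T)).re := by
  have hF := FF_int (T := T) hε hl
  have e1 : (∫ u in (0:ℝ)..l, (((1 - u / l : ℝ) : ℂ) * GG (1 + ε + Complex.I * u)) * Complex.exp (Complex.I * u * T)) =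
      ∫ u in Set.Ioc 0 l, ∫ v in Set.Ioi (0:ℝ), (((1 - u / l : ℝ) : ℂ) * (dd v * Complex.exp (-(ε:ℂ) * v))) * Complex.exp (Complex.I * u * (T - v : ℝ)) := by
    rw [intervalIntegral.integral_of_le hl.le]
    congr 1; ext u
    rw [← laplace' hε hε' u, ← integral_const_mul, ← integral_mul_const]
    congr 1; ext v
    have : Complex.exp (-(ε + Complex.I * u) * v) * Complex.exp (Complex.I * u * T) = Complex.exp (-(ε:ℂ) * v) * Complex.exp (Complex.I * u * (T - v : ℝ)) := by
      rw [← Complex.exp_add, ← Complex.exp_add]; push_cast; ring_nf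
    linear_combination ((1 - u / l : ℝ) : ℂ) * dd v * this
  rw [e1, integral_integral_swap hF]
  have hI := hF.integral_prod_right
  simp only [Function.uncurry_apply_pair] at hI
  rw [show ∀ z : ℂ, z.re = RCLike.re z from fun _ => rfl]
  rw [← integral_re hI]
  apply integral_congr_ae
  have hne : ∀ᵐ v ∂(volume.restrict (Set.Ioi (0:ℝ))), v ≠ T := by
    apply ae_restrict_of_ae
    simp [ae_iff]
  filter_upwards [hne] with v hv
  have := fejer l hl (T - v) (sub_ne_zero.mpr (Ne.symm hv))
  rw [← this]
  rw [← intervalIntegral.integral_of_le hl.le]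
  have e2 : (∫ u in (0:ℝ)..l, ((1 - u / l : ℝ) : ℂ) * (dd v * Complex.exp (-(ε:ℂ) * v)) * Complex.exp (Complex.I * u * (T - v : ℝ))) =
    ((dd v * Real.exp (-ε * v) : ℝ) : ℂ) * ∫ u in (0:ℝ)..l, ((1 - u / l : ℝ) : ℂ) * Complex.exp (Complex.I * u * (T - v : ℝ)) := by
    rw [← intervalIntegral.integral_const_mul]
    congr 1; ext u
    push_cast; ring
  rw [e2]
  change _ = Complex.re _
  rw [Complex.re_ofReal_mul]

lemma J_bd : ∃ K > 0, ∀ ε l T : ℝ, 0 < ε → ε ≤ 1/4 → 0 < l → 0 < T →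
    |∫ v in Set.Ioi (0:ℝ), dd v * Real.exp (-ε * v) * kk l (T - v)| ≤ K * (1 + l)^17 / T := by
  obtain ⟨K, hK, hG⟩ := GG_bd
  refine ⟨2 * K, by positivity, ?_⟩
  intro ε l T hε hε' hl hT
  rw [conv hε hε' hl]
  refine (Complex.abs_re_le_norm _).trans ?_
  have hT0 : (T:ℂ) ≠ 0 := by exact_mod_cast hT.ne'
  set g : ℝ → ℂ := fun u => ((1 - u / l : ℝ) : ℂ) * GG (1 + ε + Complex.I * u) with hg
  have hgd : ∀ u ∈ Set.uIcc 0 l, HasDerivAt g (deriv g u) u ∧ ‖deriv g u‖ ≤ K * (1+l)^16 * (1/l + 1) := by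
    intro u hu
    rw [Set.uIcc_of_le hl.le] at hu
    obtain ⟨hb, D, hD, hDb⟩ := hG ε hε hε' u
    have d0 : HasDerivAt (fun u : ℝ => (u:ℂ)) 1 u := Complex.ofRealCLM.hasDerivAt
    have d1 : HasDerivAt (fun u : ℝ => 1 + (ε:ℂ) + Complex.I * u) (Complex.I * 1) u := (d0.const_mul Complex.I).const_add _
    have d2 : HasDerivAt (fun u : ℝ => GG (1 + ε + Complex.I * u)) (D * (Complex.I * 1)) u := HasDerivAt.comp (h₂ := GG) u hD d1
    have d3 : HasDerivAt (fun u : ℝ => ((1 - u / l : ℝ) : ℂ)) ((-(1/l) : ℝ) : ℂ) u := by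
      have : HasDerivAt (fun u : ℝ => 1 - u / l) (-(1/l)) u := ((hasDerivAt_id u).div_const l).const_sub 1
      exact this.ofReal_comp
    have d4 := d3.fun_mul d2
    have hd : HasDerivAt g _ u := d4
    refine ⟨by rw [hd.deriv]; exact hd, ?_⟩
    rw [hd.deriv]
    have hp : K * (1 + |u|)^16 ≤ K * (1+l)^16 := by
      rw [abs_of_nonneg hu.1]; have := hu.1; have := hu.2; gcongr
    have h1 : ‖((-(1/l) : ℝ) : ℂ)‖ = 1/l := by rw [Complex.norm_real, norm_neg, Real.norm_of_nonneg (by positivity)]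
    have h2 : ‖((1 - u/l : ℝ) : ℂ)‖ ≤ 1 := by
      have : u / l ≤ 1 := by rw [div_le_one hl]; exact hu.2
      have h' : 0 ≤ u / l := div_nonneg hu.1 hl.le
      rw [Complex.norm_real, Real.norm_of_nonneg (by linarith)]; linarith
    calc _ ≤ ‖((-(1/l) : ℝ) : ℂ)‖ * ‖GG (1 + ε + Complex.I * u)‖ + ‖((1 - u/l : ℝ) : ℂ)‖ * (‖D‖ * 1) := by
          refine (norm_add_le _ _).trans ?_
          rw [norm_mul, norm_mul, norm_mul]; simp
      _ ≤ (1/l) * (K * (1+l)^16) + 1 * (K * (1+l)^16 * 1) := by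
          rw [h1]; gcongr
          · exact hb.trans hp
          · exact hDb.trans hp
      _ = _ := by ring
  have hE : ∀ u ∈ Set.uIcc 0 l, HasDerivAt (fun u : ℝ => Complex.exp (Complex.I * u * T) / (Complex.I * T)) (Complex.exp (Complex.I * u * T)) u := by
    intro u _
    have d0 : HasDerivAt (fun u : ℝ => (u:ℂ)) 1 u := Complex.ofRealCLM.hasDerivAt
    have d1 : HasDerivAt (fun u : ℝ => Complex.exp (Complex.I * u * T)) (Complex.exp (Complex.I * u * T) * (Complex.I * 1 * T)) u :=
      ((d0.const_mul Complex.I).mul_const (T:ℂ)).cexp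
    refine (d1.div_const (Complex.I * T)).congr_deriv ?_
    field_simp
  have hgi : IntervalIntegrable (deriv g) volume 0 l := by
    have : IntervalIntegrable (fun _ : ℝ => K * (1+l)^16 * (1/l + 1)) volume 0 l := intervalIntegrable_const
    refine this.mono_fun (measurable_deriv g).aestronglyMeasurable ?_
    apply ae_restrict_of_forall_mem measurableSet_uIoc
    intro u hu
    rw [Real.norm_of_nonneg (by positivity)]
    exact (hgd u (Set.uIoc_subset_uIcc hu)).2
  rw [intervalIntegral.integral_mul_deriv_eq_deriv_mul (fun u hu => (hgd u hu).1) hE hgi (Continuous.intervalIntegrable (by fun_prop) _ _)]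
  have hgl : g l = 0 := by simp [hg, hl.ne']
  have hEn : ∀ u : ℝ, ‖Complex.exp (Complex.I * u * T) / (Complex.I * T)‖ = 1 / T := by
    intro u
    rw [norm_div, norm_mul, Complex.norm_I, Complex.norm_real, Real.norm_of_nonneg hT.le, Complex.norm_exp]
    simp
  have hg0 : ‖g 0‖ ≤ K := by
    have := (hG ε hε hε' 0).1
    simp only [hg]
    simpa using this
  have hderint : ‖∫ u in (0:ℝ)..l, deriv g u * (Complex.exp (Complex.I * u * T) / (Complex.I * T))‖ ≤ (K * (1+l)^16 * (1/l + 1) * (1/T)) * |l - 0| := by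
    apply intervalIntegral.norm_integral_le_of_norm_le_const
    intro u hu
    rw [norm_mul, hEn]
    gcongr
    exact (hgd u (Set.uIoc_subset_uIcc hu)).2
  rw [hgl, zero_mul]
  have : (K * (1+l)^16 * (1/l + 1) * (1/T)) * |l - 0| = K * (1+l)^17 / T := by
    rw [sub_zero, abs_of_pos hl]; field_simp
  rw [this] at hderint
  have h1 : (1:ℝ) ≤ (1+l)^17 := one_le_pow₀ (by linarith)
  calc _ ≤ ‖g 0‖ * (1/T) + K * (1+l)^17 / T := by
        refine (norm_sub_le _ _).trans ?_
        rw [zero_sub, norm_neg, norm_mul, hEn]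
        gcongr
    _ ≤ K * (1+l)^17 * (1/T) + K * (1+l)^17 / T := by
        gcongr; nlinarith
    _ = _ := by ring
end TP


namespace TP
open MeasureTheory

lemma kk_nonneg {l : ℝ} (hl : 0 < l) (a : ℝ) : 0 ≤ kk l a := by
  unfold kk
  have := Real.cos_le_one (l*a)
  apply div_nonneg (by linarith) (by positivity)

lemma kk_le {l : ℝ} (hl : 0 < l) (a : ℝ) : kk l a ≤ l := by
  unfold kk
  have := Real.one_sub_sq_div_two_le_cos (x := l*a)
  by_cases ha : a = 0
  · simp [ha, hl.le]
  rw [div_le_iff₀ (by positivity)]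
  nlinarith [sq_nonneg (l*a)]

lemma kk_le' {l : ℝ} (hl : 0 < l) (a : ℝ) : kk l a ≤ 2 / (l * a^2) := by
  unfold kk
  have := Real.neg_one_le_cos (l*a)
  gcongr; linarith

lemma kk_ge {l : ℝ} (hl : 0 < l) {a : ℝ} (ha : a ≠ 0) (h : |a| ≤ 1/l) : l / 5 ≤ kk l a := by
  unfold kk
  have h1 : |l * a| ≤ 1 := by
    rw [abs_mul, abs_of_pos hl]; rwa [le_div_iff₀ hl, mul_comm] at h
  have h2 := Real.cos_le_one_sub_mul_cos_sq (x := l*a) (h1.trans (by linarith [Real.pi_gt_three]))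
  rw [le_div_iff₀ (by positivity)]
  have h3 : 2 / π^2 ≥ 1/5 := by
    rw [ge_iff_le, div_le_div_iff₀ (by norm_num) (by positivity)]
    nlinarith [Real.pi_lt_d2, Real.pi_gt_three]
  nlinarith [sq_nonneg (l*a)]

lemma kk_meas (l : ℝ) : Measurable (kk l) := by
  unfold kk; fun_prop

lemma cauchy_int (T : ℝ) {c : ℝ} (hc : 0 < c) : Integrable (fun v : ℝ => 1 / ((v - T)^2 + c^2)) ∧
    ∫ v : ℝ, 1 / ((v - T)^2 + c^2) = π / c := by
  have e : (fun v : ℝ => 1 / ((v - T)^2 + c^2)) = fun v => (1 / c^2) * (fun w => (fun x => (1 + x^2)⁻¹) (w / c)) (v - T) := by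
    ext v
    simp only
    field_simp
    ring
  rw [e]
  constructor
  · exact ((integrable_inv_one_add_sq.comp_div hc.ne').comp_sub_right T).const_mul _
  · rw [integral_const_mul, integral_sub_right_eq_self (fun w => (fun x : ℝ => (1 + x^2)⁻¹) (w / c)) T, Measure.integral_comp_div (fun x : ℝ => (1 + x^2)⁻¹) c, integral_univ_inv_one_add_sq,
      abs_of_pos hc, smul_eq_mul]
    field_simp

lemma dd_kk_int {ε l T : ℝ} (hε : 0 < ε) (hl : 0 < l) :
    IntegrableOn (fun v => dd v * Real.exp (-ε * v) * kk l (T - v)) (Set.Ioi 0) := by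
  have h1 : IntegrableOn (fun v : ℝ => Real.exp (-ε * v)) (Set.Ioi 0) := integrableOn_exp_mul_Ioi (by linarith) 0
  refine Integrable.mul_bdd (c := l) (Integrable.bdd_mul (c := 6) h1 dd_meas.aestronglyMeasurable ?_) ?_ ?_
  · filter_upwards with v; exact dd_bd v
  · exact ((kk_meas l).comp (measurable_const.sub measurable_id)).aestronglyMeasurable
  · filter_upwards with v
    rw [Real.norm_of_nonneg (kk_nonneg hl _)]; exact kk_le hl _

lemma taub : ∃ K > 0, ∀ σ T η c l : ℝ, |σ| = 1 → 3 ≤ T → 0 < η → 0 < c → c ≤ 1 → 1/l ≤ c → 0 < l →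
    (∀ v, |v - T| ≤ c → η/2 ≤ σ * dd v) → η/15 ≤ 100 / (l*c) + K * (1+l)^17 / T := by
  obtain ⟨K, hK, hJ⟩ := J_bd
  refine ⟨K, hK, ?_⟩
  intro σ T η c l hσ hT hη hc hc1 hlc hl hd
  set ε := 1/(T+1) with hεd
  have hε : 0 < ε := by positivity
  have hε' : ε ≤ 1/4 := by rw [hεd]; gcongr; linarith
  have hJ1 := hJ ε l T hε hε' hl (by linarith)
  obtain ⟨ci, cv⟩ := cauchy_int T hc
  set W := Set.Icc (T - 1/l) (T + 1/l) with hW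
  have hpt : ∀ v ∈ Set.Ioi (0:ℝ), v ≠ T → W.indicator (fun _ => η*l/30) v - 24/l * (1 / ((v - T)^2 + c^2)) ≤ σ * (dd v * Real.exp (-ε * v) * kk l (T - v)) := by
    intro v hv hvT
    have hv0 : 0 < v := hv
    have hk := kk_nonneg hl (T - v)
    have hpos : 0 ≤ 24/l * (1 / ((v - T)^2 + c^2)) := by positivity
    by_cases hvc : |v - T| ≤ c
    · have h1 := hd v hvc
      have : 0 ≤ σ * (dd v * Real.exp (-ε * v) * kk l (T - v)) := by
        rw [show σ * (dd v * Real.exp (-ε * v) * kk l (T - v)) = (σ * dd v) * (Real.exp (-ε * v) * kk l (T - v)) by ring]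
        have := Real.exp_pos (-ε * v)
        apply mul_nonneg (by linarith) (by positivity)
      by_cases hw : v ∈ W
      · rw [Set.indicator_of_mem hw]
        have hw1 : |T - v| ≤ 1/l := by rw [abs_le]; constructor <;> linarith [hw.1, hw.2]
        have h2 := kk_ge hl (sub_ne_zero.mpr (Ne.symm hvT)) hw1
        have h3 : (1:ℝ)/3 ≤ Real.exp (-ε * v) := by
          have : -1 ≤ -ε * v := by
            have : ε * v ≤ 1 := by
              rw [hεd, div_mul_eq_mul_div, one_mul, div_le_one (by linarith)]
              linarith [hw.2]
            linarith
          have h4 : Real.exp (-1) ≤ Real.exp (-ε * v) := Real.exp_le_exp.mpr this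
          have h5 : (1:ℝ)/3 ≤ Real.exp (-1) := by
            rw [Real.exp_neg, one_div]; gcongr; linarith [Real.exp_one_lt_d9]
          linarith
        have h6 : η*l/30 ≤ σ * (dd v * Real.exp (-ε * v) * kk l (T - v)) := by
          rw [show σ * (dd v * Real.exp (-ε * v) * kk l (T - v)) = (σ * dd v) * (Real.exp (-ε * v) * kk l (T - v)) by ring]
          calc η*l/30 = (η/2) * ((1/3) * (l/5)) := by ring
            _ ≤ _ := by
              have : 0 ≤ σ * dd v := by linarith
              gcongr
        linarith
      · rw [Set.indicator_of_notMem hw]; linarith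
    · have hw : v ∉ W := by
        intro hw; apply hvc; rw [abs_le]; constructor <;> linarith [hw.1, hw.2]
      rw [Set.indicator_of_notMem hw, zero_sub]
      push Not at hvc
      have hsq : c^2 ≤ (v-T)^2 := by rw [← sq_abs (v-T)]; gcongr
      have hc2 : 0 < c^2 := by positivity
      have h1 : |σ * (dd v * Real.exp (-ε * v) * kk l (T - v))| ≤ 6 * (1 * (2 / (l * (T-v)^2))) := by
        rw [abs_mul, hσ, one_mul, abs_mul, abs_mul, abs_of_nonneg hk, abs_of_pos (Real.exp_pos _), mul_assoc]
        gcongr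
        · exact dd_bd v
        · apply Real.exp_le_one_iff.mpr; nlinarith
        · exact kk_le' hl _
      have h2 : 6 * (1 * (2 / (l * (T-v)^2))) ≤ 24/l * (1 / ((v - T)^2 + c^2)) := by
        have e : (T-v)^2 = (v-T)^2 := by ring
        rw [e]
        have : 1 / (v-T)^2 ≤ 2 / ((v - T)^2 + c^2) := by
          rw [div_le_div_iff₀ (by linarith) (by linarith)]; linarith
        calc 6 * (1 * (2 / (l * (v-T)^2))) = 12/l * (1/(v-T)^2) := by
              have : (v-T)^2 ≠ 0 := by linarith
              field_simp; ring
          _ ≤ 12/l * (2 / ((v - T)^2 + c^2)) := by gcongr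
          _ = _ := by ring
      have := (abs_le.mp h1).1
      linarith
  have hne : ∀ᵐ v ∂(volume.restrict (Set.Ioi (0:ℝ))), v ≠ T := by
    apply ae_restrict_of_ae
    simp [ae_iff]
  have hWi : IntegrableOn (W.indicator (fun _ => η*l/30)) (Set.Ioi (0:ℝ)) := by
    apply Integrable.integrableOn
    rw [integrable_indicator_iff measurableSet_Icc]
    exact integrableOn_const (by simp [hW])
  have hmono : ∫ v in Set.Ioi (0:ℝ), (W.indicator (fun _ => η*l/30) v - 24/l * (1 / ((v - T)^2 + c^2))) ≤
      ∫ v in Set.Ioi (0:ℝ), σ * (dd v * Real.exp (-ε * v) * kk l (T - v)) := by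
    apply integral_mono_ae
    · exact hWi.sub (ci.integrableOn.const_mul _)
    · exact (dd_kk_int hε hl).const_mul _
    · filter_upwards [hne, ae_restrict_mem measurableSet_Ioi] with v h1 h2
      exact hpt v h2 h1
  rw [integral_sub hWi (ci.integrableOn.const_mul _), integral_const_mul, integral_const_mul] at hmono
  have hWv : ∫ v in Set.Ioi (0:ℝ), W.indicator (fun _ => η*l/30) v = η / 15 := by
    rw [setIntegral_indicator measurableSet_Icc]
    have : Set.Ioi (0:ℝ) ∩ W = W := by
      apply Set.inter_eq_right.mpr
      intro v hv
      have := hv.1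
      show 0 < v
      linarith
    rw [this, setIntegral_const, smul_eq_mul, Measure.real, hW, Real.volume_Icc, ENNReal.toReal_ofReal (by
      have : 0 < 1/l := by positivity
      linarith)]
    field_simp; ring
  have hCv : ∫ v in Set.Ioi (0:ℝ), 1 / ((v - T)^2 + c^2) ≤ π / c := by
    rw [← cv]
    apply setIntegral_le_integral ci
    filter_upwards with v
    positivity
  have hσJ : σ * ∫ v in Set.Ioi (0:ℝ), dd v * Real.exp (-ε * v) * kk l (T - v) ≤ K * (1+l)^17 / T := by
    refine le_trans (le_abs_self _) ?_
    rw [abs_mul, hσ, one_mul]; exact hJ1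
  rw [hWv] at hmono
  have h7 : 24/l * ∫ v in Set.Ioi (0:ℝ), 1 / ((v - T)^2 + c^2) ≤ 100 / (l*c) := by
    calc _ ≤ 24/l * (π/c) := by gcongr
      _ = 24*π/(l*c) := by field_simp
      _ ≤ _ := by gcongr; linarith [Real.pi_lt_d2]
  linarith

lemma dd_bound : ∃ M > 0, ∃ μ₀ : ℝ, ∀ μ ≥ μ₀, |dd (μ^40)| ≤ M / μ := by
  obtain ⟨K, hK, hJ⟩ := taub
  set M := 15*(800 + K * 2^18) + 1 with hM
  have hM1 : 1 ≤ M := by rw [hM]; nlinarith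
  refine ⟨M, by positivity, max 8 M, ?_⟩
  intro μ hμ
  have hμ8 : 8 ≤ μ := (le_max_left _ _).trans hμ
  have hμM : M ≤ μ := (le_max_right _ _).trans hμ
  by_contra! hcon
  set η := M/μ with hη
  have hη0 : 0 < η := by positivity
  have hη1 : η ≤ 1 := by rw [hη, div_le_one (by linarith)]; exact hμM
  set T0 := μ^40 with hT0
  have hT0b : 8 ≤ T0 := by
    calc 8 ≤ μ := hμ8
      _ = μ^1 := by ring
      _ ≤ μ^40 := pow_le_pow_right₀ (by linarith) (by norm_num)
  set c := η/8 with hc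
  have key : ∃ σ T : ℝ, |σ| = 1 ∧ |T - T0| ≤ c ∧ ∀ v, |v - T| ≤ c → η/2 ≤ σ * dd v := by
    rcases lt_abs.mp hcon with h | h
    · refine ⟨1, T0 + c, by simp, by simp [abs_of_pos (show 0 < c by positivity)], ?_⟩
      intro v hv
      rw [abs_le] at hv
      have h1 : T0 ≤ v := by linarith
      have h2 : v - T0 ≤ η/4 := by linarith
      unfold dd at h ⊢
      have h3 : Chebyshev.psi (Real.exp T0) ≤ Chebyshev.psi (Real.exp v) := Chebyshev.psi_mono (Real.exp_le_exp.mpr h1)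
      have h4 : Chebyshev.psi (Real.exp T0) * Real.exp (-T0) * Real.exp (-(v-T0)) ≤ Chebyshev.psi (Real.exp v) * Real.exp (-v) := by
        rw [mul_assoc, ← Real.exp_add]
        rw [show -T0 + -(v - T0) = -v by ring]; gcongr
      have h5 : 1 - η/4 ≤ Real.exp (-(v-T0)) := by
        have := Real.add_one_le_exp (-(v-T0)); linarith
      have h6 : (1+η)*(1-η/4) ≤ Chebyshev.psi (Real.exp T0) * Real.exp (-T0) * Real.exp (-(v-T0)) := by
        apply mul_le_mul (by linarith) h5 (by linarith) (by linarith)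
      nlinarith
    · refine ⟨-1, T0 - c, by simp, by simp [abs_of_pos (show 0 < c by positivity)], ?_⟩
      intro v hv
      rw [abs_le] at hv
      have h1 : v ≤ T0 := by linarith
      have h2 : T0 - v ≤ η/4 := by linarith
      unfold dd at h ⊢
      have h3 : Chebyshev.psi (Real.exp v) ≤ Chebyshev.psi (Real.exp T0) := Chebyshev.psi_mono (Real.exp_le_exp.mpr h1)
      have h4 : Chebyshev.psi (Real.exp v) * Real.exp (-v) * Real.exp (-(T0-v)) ≤ Chebyshev.psi (Real.exp T0) * Real.exp (-T0) := by
        rw [mul_assoc, ← Real.exp_add]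
        rw [show -v + -(T0 - v) = -T0 by ring]; gcongr
      have h5 : 1 - η/4 ≤ Real.exp (-(T0-v)) := by
        have := Real.add_one_le_exp (-(T0-v)); linarith
      have h6 : 0 ≤ Chebyshev.psi (Real.exp v) * Real.exp (-v) := mul_nonneg (Chebyshev.psi_nonneg _) (Real.exp_pos _).le
      have h7 : Chebyshev.psi (Real.exp v) * Real.exp (-v) * (1-η/4) ≤ 1 - η := by
        refine le_trans (mul_le_mul_of_nonneg_left h5 h6) ?_
        linarith
      nlinarith
  obtain ⟨σ, T, hσ, hT, hd⟩ := key
  have hTl : T0/2 ≤ T := by have := (abs_le.mp hT).1; linarith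
  have hμ0 : 0 < μ := by linarith
  have := hJ σ T η c (μ^2) hσ (by linarith) hη0 (by positivity) (by linarith) (by
    rw [hc, hη, div_div, div_le_div_iff₀ (by positivity) (by positivity)]
    nlinarith) (by positivity) hd
  have h8 : 100 / (μ^2 * c) = 800 / (M * μ) := by
    rw [hc, hη]; field_simp; norm_num
  have h9 : K * (1+μ^2)^17 / T ≤ K * 2^18 / μ^6 := by
    calc K * (1+μ^2)^17 / T ≤ K * (2*μ^2)^17 / (T0/2) := by gcongr; nlinarith
      _ = _ := by rw [hT0]; field_simp
  have h10 : K * 2^18 / μ^6 ≤ K * 2^18 / (M*μ) := by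
    gcongr
    calc M*μ ≤ μ*μ := by gcongr
      _ = μ^2 := by ring
      _ ≤ μ^6 := pow_le_pow_right₀ (by linarith) (by norm_num)
  rw [h8] at this
  have h11 : M/μ/15 ≤ (800 + K*2^18)/(M*μ) := by
    rw [add_div 800]; exact this.trans (by linarith)
  rw [div_div, div_le_div_iff₀ (by positivity) (by positivity)] at h11
  have h12 : M * M ≤ 15 * (800 + K*2^18) := by
    have : (M*M)*μ ≤ (15 * (800 + K*2^18)) * μ := by linarith
    exact le_of_mul_le_mul_right this hμ0
  nlinarith

end TP


namespace TP
open MeasureTheory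

/-- primes up to y -/
noncomputable def PP (y : ℝ) : Finset ℕ := (Finset.Icc 0 ⌊y⌋₊).filter Nat.Prime

lemma mem_PP {y : ℝ} {p : ℕ} : p ∈ PP y ↔ p.Prime ∧ (p:ℝ) ≤ y := by
  unfold PP
  rw [Finset.mem_filter, Finset.mem_Icc]
  constructor
  · rintro ⟨⟨_, h⟩, hp⟩; exact ⟨hp, (Nat.le_floor_iff' hp.ne_zero).mp h⟩
  · rintro ⟨hp, h⟩; exact ⟨⟨Nat.zero_le _, (Nat.le_floor_iff' hp.ne_zero).mpr h⟩, hp⟩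

lemma card_PP (y : ℝ) : (PP y).card = Nat.primeCounting ⌊y⌋₊ := by
  unfold PP
  rw [Nat.primeCounting, Nat.primeCounting', Nat.count_eq_card_filter_range]
  congr 1
  ext p; simp [Nat.lt_succ_iff]

lemma card_PP_le {y : ℝ} (hy : 0 ≤ y) : ((PP y).card : ℝ) ≤ y := by
  have : (PP y).card ≤ ⌊y⌋₊ := by
    have : PP y ⊆ Finset.Icc 1 ⌊y⌋₊ := by
      intro p hp
      unfold PP at hp
      rw [Finset.mem_filter, Finset.mem_Icc] at hp
      rw [Finset.mem_Icc]; exact ⟨hp.2.one_lt.le, hp.1.2⟩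
    simpa using Finset.card_le_card this
  exact (Nat.cast_le.mpr this).trans (Nat.floor_le hy)

lemma psi_pnt : ∃ M > 0, ∃ y₀ : ℝ, ∀ y ≥ y₀, |Chebyshev.psi y - y| ≤ M * y * (Real.log y) ^ (-(1/40) : ℝ) := by
  obtain ⟨M, hM, μ₀, h⟩ := dd_bound
  refine ⟨M, hM, Real.exp ((max μ₀ 1)^40), ?_⟩
  intro y hy
  have hy0 : 0 < y := (Real.exp_pos _).trans_le hy
  have hl : (max μ₀ 1)^40 ≤ Real.log y := (Real.le_log_iff_exp_le hy0).mpr hy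
  have hl0 : 0 < Real.log y := lt_of_lt_of_le (by positivity) hl
  set μ := (Real.log y) ^ (1/40 : ℝ) with hμ
  have hμ40 : μ^40 = Real.log y := by
    rw [hμ, ← Real.rpow_natCast, ← Real.rpow_mul hl0.le]; norm_num
  have hμ0 : 0 < μ := by positivity
  have hμ1 : μ₀ ≤ μ := by
    refine (le_max_left μ₀ 1).trans ?_
    rw [← hμ40] at hl
    exact le_of_pow_le_pow_left₀ (by norm_num) hμ0.le hl
  have h1 := h μ hμ1
  rw [hμ40] at h1
  unfold dd at h1
  rw [Real.exp_neg, Real.exp_log hy0] at h1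
  have : Chebyshev.psi y - y = (Chebyshev.psi y * y⁻¹ - 1) * y := by field_simp
  rw [this, abs_mul, abs_of_pos hy0, Real.rpow_neg hl0.le, ← hμ]
  calc _ ≤ M / μ * y := by gcongr
    _ = _ := by field_simp

lemma pnt0 : ∃ C > 0, ∃ y₀ : ℝ, ∀ y ≥ y₀, |((PP y).card : ℝ) - y / Real.log y| ≤ C * (y / Real.log y) * (Real.log y) ^ (-(1/40) : ℝ) := by
  obtain ⟨M, hM, y₀, h⟩ := psi_pnt
  obtain ⟨C1, hC1, h1⟩ := Chebyshev.isBigO_psi_sub_theta_sqrt.exists_pos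
  obtain ⟨C2, hC2, h2⟩ := Chebyshev.primeCounting_sub_theta_div_log_isBigO.exists_pos
  rw [Asymptotics.isBigOWith_iff] at h1 h2
  have h3 : ∀ᶠ y in atTop, Real.log y ≤ y ^ (1/2:ℝ) := by
    have := (isLittleO_log_rpow_atTop (show (0:ℝ) < 1/2 by norm_num)).bound (show (0:ℝ) < 1 by norm_num)
    filter_upwards [this, eventually_ge_atTop 1] with y hy hy1
    rw [Real.norm_of_nonneg (Real.log_nonneg hy1), Real.norm_of_nonneg (by positivity), one_mul] at hy
    exact hy
  have key : ∀ᶠ y in atTop, |((PP y).card : ℝ) - y / Real.log y| ≤ (C2 + M + C1) * (y / Real.log y) * (Real.log y) ^ (-(1/40) : ℝ) := by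
    filter_upwards [h1, h2, h3, eventually_ge_atTop y₀, eventually_ge_atTop (Real.exp 1)] with y h1 h2 h3 hy hye
    have hy0 : 0 < y := (Real.exp_pos _).trans_le hye
    have hl : 1 ≤ Real.log y := (Real.le_log_iff_exp_le hy0).mpr hye
    have hl0 : 0 < Real.log y := by linarith
    have h := h y hy
    rw [Pi.sub_apply, Real.norm_eq_abs, Real.norm_of_nonneg (by positivity)] at h1
    rw [Real.norm_eq_abs, Real.norm_of_nonneg (by positivity)] at h2
    rw [card_PP]
    set Lc := (Real.log y) ^ (-(1/40) : ℝ) with hLc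
    have hLc0 : 0 < Lc := by positivity
    have hinv : (Real.log y)⁻¹ ≤ Lc := by
      rw [hLc, ← Real.rpow_neg_one]
      apply Real.rpow_le_rpow_of_exponent_le hl; norm_num
    have hs : √y ≤ y * Lc := by
      have : √y * Real.log y ≤ y := by
        rw [← Real.sqrt_eq_rpow] at h3
        calc √y * Real.log y ≤ √y * √y := by gcongr
          _ = y := Real.mul_self_sqrt hy0.le
      calc √y ≤ y * (Real.log y)⁻¹ := by rw [← div_eq_mul_inv, le_div_iff₀ hl0]; exact this
        _ ≤ _ := by gcongr
    set P := ((Nat.primeCounting ⌊y⌋₊ : ℕ) : ℝ)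
    have e : P - y / Real.log y = (P - Chebyshev.theta y / Real.log y) + ((Chebyshev.psi y - y) - (Chebyshev.psi y - Chebyshev.theta y)) / Real.log y := by ring
    rw [e]
    calc _ ≤ |P - Chebyshev.theta y / Real.log y| + (|Chebyshev.psi y - y| + |Chebyshev.psi y - Chebyshev.theta y|) / Real.log y := by
          refine (abs_add_le _ _).trans ?_
          rw [abs_div, abs_of_pos hl0]; gcongr; exact abs_sub _ _
      _ ≤ C2 * (y / Real.log y ^ 2) + (M * y * Lc + C1 * (y * Lc)) / Real.log y := by
          gcongr
          exact h1.trans (by gcongr)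
      _ = C2 * (y / Real.log y) * (Real.log y)⁻¹ + (M + C1) * (y / Real.log y) * Lc := by field_simp
      _ ≤ C2 * (y / Real.log y) * Lc + (M + C1) * (y / Real.log y) * Lc := by gcongr
      _ = _ := by ring
  obtain ⟨y1, hy1⟩ := eventually_atTop.mp key
  exact ⟨_, by positivity, y1, hy1⟩

lemma pnt : ∃ C > 0, ∀ y ≥ 2, |((PP y).card : ℝ) - y / Real.log y| ≤ C * (y / Real.log y) * (Real.log y) ^ (-(1/40) : ℝ) := by
  obtain ⟨C, hC, y₀, h⟩ := pnt0
  set y1 := max y₀ 2 with hy1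
  have hl1 : 0 < Real.log y1 := Real.log_pos (by linarith [le_max_right y₀ 2])
  set D := (1 + Real.log y1) * (Real.log y1) ^ (1/40:ℝ) with hD
  have hD0 : 0 < D := by positivity
  refine ⟨C + D, by positivity, ?_⟩
  intro y hy
  have hl : 0 < Real.log y := Real.log_pos (by linarith)
  have hq : 0 < (Real.log y) ^ (-(1/40) : ℝ) := by positivity
  have hyl : 0 < y / Real.log y := by positivity
  by_cases hyy : y₀ ≤ y
  · refine (h y hyy).trans ?_
    gcongr; linarith
  · push Not at hyy
    have hly : Real.log y ≤ Real.log y1 := Real.log_le_log (by linarith) (hyy.le.trans (le_max_left _ _))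
    have h1 : |((PP y).card : ℝ) - y / Real.log y| ≤ (1 + Real.log y1) * (y / Real.log y) := by
      have := card_PP_le (show 0 ≤ y by linarith)
      have e : Real.log y * (y / Real.log y) = y := mul_div_cancel₀ _ hl.ne'
      have e2 : Real.log y * (y / Real.log y) ≤ Real.log y1 * (y / Real.log y) := by gcongr
      have h0 : (0:ℝ) ≤ (PP y).card := by positivity
      rw [abs_le]
      have h4 : 0 ≤ Real.log y1 * (y / Real.log y) := by positivity
      constructor <;> nlinarith
    have h2 : (1:ℝ) ≤ (Real.log y1) ^ (1/40:ℝ) * (Real.log y) ^ (-(1/40) : ℝ) := by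
      rw [Real.rpow_neg hl.le, ← div_eq_mul_inv, one_le_div (by positivity)]
      gcongr
    calc _ ≤ (1 + Real.log y1) * (y / Real.log y) := h1
      _ ≤ (1 + Real.log y1) * (y / Real.log y) * ((Real.log y1) ^ (1/40:ℝ) * (Real.log y) ^ (-(1/40) : ℝ)) := by
        apply le_mul_of_one_le_right (by positivity) h2
      _ = D * (y / Real.log y) * (Real.log y) ^ (-(1/40) : ℝ) := by rw [hD]; ring
      _ ≤ _ := by gcongr; linarith

lemma cheb : ∃ C > 0, ∀ y ≥ 2, ((PP y).card : ℝ) ≤ C * (y / Real.log y) := by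
  obtain ⟨C, hC, h⟩ := pnt
  refine ⟨1 + C * (Real.log 2) ^ (-(1/40) : ℝ), by positivity, ?_⟩
  intro y hy
  have hl : Real.log 2 ≤ Real.log y := Real.log_le_log (by norm_num) hy
  have h2 : 0 < Real.log 2 := Real.log_pos (by norm_num)
  have h3 : (Real.log y) ^ (-(1/40) : ℝ) ≤ (Real.log 2) ^ (-(1/40) : ℝ) :=
    Real.rpow_le_rpow_of_nonpos h2 hl (by norm_num)
  have h4 := (abs_le.mp (h y hy)).2
  have hyl : 0 ≤ y / Real.log y := div_nonneg (by linarith) (by linarith)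
  have : C * (y / Real.log y) * (Real.log y) ^ (-(1/40) : ℝ) ≤ C * (y / Real.log y) * (Real.log 2) ^ (-(1/40) : ℝ) := by gcongr
  linarith

/-- sum of reciprocals of primes -/
noncomputable def HR (y : ℝ) : ℝ := ∑ p ∈ PP y, 1 / (p:ℝ)

lemma HR_abel {b : ℝ} (hb : 2 ≤ b) : HR b = (PP b).card / b + ∫ t in (2:ℝ)..b, (PP t).card / t^2 := by
  have h := sum_mul_eq_sub_integral_mul₁ (𝕜 := ℝ) (fun n => if n.Prime then (1:ℝ) else 0) (f := fun t => t⁻¹) (by simp [Nat.not_prime_zero]) (by simp [Nat.not_prime_one]) b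
    (fun t ht => differentiableAt_inv (by linarith [ht.1])) ?_
  · have hs : ∀ t : ℝ, ∑ k ∈ Finset.Icc 0 ⌊t⌋₊, (if k.Prime then (1:ℝ) else 0) = (PP t).card := by
      intro t; rw [← Finset.sum_filter]; simp [PP]
    simp only [hs] at h
    unfold HR
    rw [intervalIntegral.integral_of_le hb]
    have e : ∑ p ∈ PP b, 1 / (p:ℝ) = ∑ k ∈ Finset.Icc 0 ⌊b⌋₊, (k:ℝ)⁻¹ * (if k.Prime then (1:ℝ) else 0) := by
      unfold PP
      rw [Finset.sum_filter]
      apply Finset.sum_congr rfl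
      intro k _; split_ifs <;> simp
    rw [e, h, sub_eq_add_neg, ← integral_neg]
    congr 1
    · field_simp
    · apply setIntegral_congr_fun measurableSet_Ioc
      intro t ht
      simp only [deriv_inv]
      ring
  · simp only [deriv_inv']
    apply ContinuousOn.integrableOn_Icc
    apply ContinuousOn.neg
    apply ContinuousOn.inv₀ (by fun_prop)
    intro t ht; have := ht.1; positivity

lemma mertens : ∃ C > 0, ∀ b ≥ 2, |HR b - Real.log (Real.log b)| ≤ C := by
  obtain ⟨C, hC, h⟩ := pnt
  have h2 : 0 < Real.log 2 := Real.log_pos (by norm_num)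
  refine ⟨1 + |Real.log (Real.log 2)| + C * (40 * (Real.log 2) ^ (-(1/40) : ℝ)), by positivity, ?_⟩
  intro b hb
  rw [HR_abel hb]
  have hlt : ∀ t ∈ Set.Icc 2 b, 0 < Real.log t := fun t ht => Real.log_pos (by linarith [ht.1])
  have huI : Set.uIcc 2 b = Set.Icc 2 b := Set.uIcc_of_le hb
  have i1 : IntervalIntegrable (fun t : ℝ => 1 / (t * Real.log t)) volume 2 b := by
    apply ContinuousOn.intervalIntegrable
    rw [huI]
    apply ContinuousOn.div continuousOn_const
    · apply ContinuousOn.mul continuousOn_id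
      apply Real.continuousOn_log.mono
      intro t ht; have := ht.1; simp; linarith
    · intro t ht; have := hlt t ht; have := ht.1; positivity
  have i2 : IntervalIntegrable (fun t : ℝ => ((PP t).card : ℝ) / t^2) volume 2 b := by
    have hm : Monotone (fun t : ℝ => ((PP t).card : ℝ)) := by
      intro s t hst
      simp only
      exact_mod_cast Finset.card_le_card (fun p hp => mem_PP.mpr ⟨(mem_PP.mp hp).1, (mem_PP.mp hp).2.trans hst⟩)
    have : IntervalIntegrable (fun t : ℝ => ((PP t).card : ℝ)) volume 2 b := hm.intervalIntegrable
    simp only [div_eq_mul_inv]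
    apply this.mul_continuousOn
    apply ContinuousOn.inv₀ (by fun_prop)
    intro t ht; rw [huI] at ht; have := ht.1; positivity
  have v1 : ∫ t in (2:ℝ)..b, 1 / (t * Real.log t) = Real.log (Real.log b) - Real.log (Real.log 2) := by
    apply intervalIntegral.integral_eq_sub_of_hasDerivAt (f := fun t => Real.log (Real.log t)) _ i1
    intro t ht
    rw [huI] at ht
    have h0 := hlt t ht
    have ht0 : t ≠ 0 := by linarith [ht.1]
    refine ((Real.hasDerivAt_log ht0).log h0.ne').congr_deriv ?_
    field_simp
  have hcont : ContinuousOn (fun t : ℝ => (Real.log t) ^ (-(1/40) - 1 : ℝ) * (1/t)) (Set.Icc 2 b) := by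
    apply ContinuousOn.mul
    · apply ContinuousOn.rpow_const
      · apply Real.continuousOn_log.mono
        intro t ht; have := ht.1; simp; linarith
      · intro t ht; left; exact (hlt t ht).ne'
    · apply ContinuousOn.div continuousOn_const continuousOn_id
      intro t ht; have := ht.1; simp; linarith
  have i3 : IntervalIntegrable (fun t : ℝ => (Real.log t) ^ (-(1/40) - 1 : ℝ) * (1/t)) volume 2 b := by
    apply ContinuousOn.intervalIntegrable; rw [huI]; exact hcont
  have v2 : ∫ t in (2:ℝ)..b, (Real.log t) ^ (-(1/40) - 1 : ℝ) * (1/t) = -40 * (Real.log b) ^ (-(1/40) : ℝ) - (-40 * (Real.log 2) ^ (-(1/40) : ℝ)) := by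
    apply intervalIntegral.integral_eq_sub_of_hasDerivAt (f := fun t => -40 * (Real.log t) ^ (-(1/40) : ℝ)) _ i3
    intro t ht
    rw [huI] at ht
    have h0 := hlt t ht
    have ht0 : t ≠ 0 := by linarith [ht.1]
    refine (((Real.hasDerivAt_log ht0).rpow_const (p := (-(1/40) : ℝ)) (Or.inl h0.ne')).const_mul (-40)).congr_deriv ?_
    ring
  have hdiff : |(∫ t in (2:ℝ)..b, ((PP t).card : ℝ) / t^2) - ∫ t in (2:ℝ)..b, 1 / (t * Real.log t)| ≤ C * (40 * (Real.log 2) ^ (-(1/40) : ℝ)) := by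
    rw [← intervalIntegral.integral_sub i2 i1]
    have : ∀ᵐ t, t ∈ Set.Ioc 2 b → ‖((PP t).card : ℝ) / t^2 - 1 / (t * Real.log t)‖ ≤ C * ((Real.log t) ^ (-(1/40) - 1 : ℝ) * (1/t)) := by
      filter_upwards with t ht
      have ht' : t ∈ Set.Icc 2 b := ⟨ht.1.le, ht.2⟩
      have h0 := hlt t ht'
      have ht2 : 2 ≤ t := ht'.1
      have e : ((PP t).card : ℝ) / t^2 - 1 / (t * Real.log t) = (((PP t).card : ℝ) - t / Real.log t) / t^2 := by field_simp
      rw [e, Real.norm_eq_abs, abs_div, abs_of_pos (show 0 < t^2 by positivity), Real.rpow_sub h0, Real.rpow_one]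
      calc _ ≤ C * (t / Real.log t) * (Real.log t) ^ (-(1/40) : ℝ) / t^2 := by gcongr; exact h t ht2
        _ = _ := by field_simp
    have := intervalIntegral.norm_integral_le_of_norm_le hb this (i3.const_mul C)
    rw [Real.norm_eq_abs, intervalIntegral.integral_const_mul, v2] at this
    refine this.trans ?_
    have : 0 ≤ (Real.log b) ^ (-(1/40) : ℝ) := Real.rpow_nonneg (hlt b ⟨hb, le_rfl⟩).le _
    gcongr; linarith
  rw [v1] at hdiff
  have hc0 : 0 ≤ ((PP b).card : ℝ) / b := by positivity
  have hc1 : ((PP b).card : ℝ) / b ≤ 1 := by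
    rw [div_le_one (by linarith)]; exact card_PP_le (by linarith)
  have ha := abs_le.mp hdiff
  have h3 := neg_abs_le (Real.log (Real.log 2))
  have h4 := le_abs_self (Real.log (Real.log 2))
  rw [abs_le]
  constructor <;> linarith [ha.1, ha.2]

end TP


namespace TP

lemma sum_period (f : ℕ → ℝ) (m : ℕ) (hf : ∀ n, f (n + m) = f n) (k r : ℕ) :
    ∑ n ∈ Finset.range (m * k + r), f n = k * ∑ n ∈ Finset.range m, f n + ∑ n ∈ Finset.range r, f n := by
  have h1 : ∀ k n, f (m * k + n) = f n := by
    intro k; induction k with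
    | zero => simp
    | succ k ih => intro n; rw [show m * (k+1) + n = m * k + n + m by ring, hf, ih]
  rw [Finset.sum_range_add]
  simp_rw [h1]
  congr 1
  induction k with
  | zero => simp
  | succ k ih =>
    rw [mul_add, mul_one, Finset.sum_range_add, ih]
    simp_rw [h1]; push_cast; ring

lemma sum_mod_le (g : ℕ → ℝ) (hg : ∀ a, 0 ≤ g a) (p N : ℕ) (hp : 0 < p) :
    ∑ n ∈ Finset.range N, g (n % p) ≤ ((N:ℝ) / p + 1) * ∑ a ∈ Finset.range p, g a := by
  have h := sum_period (fun n => g (n % p)) p (by intro n; simp) (N / p) (N % p)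
  rw [Nat.div_add_mod] at h
  rw [h]
  have e : ∑ n ∈ Finset.range p, g (n % p) = ∑ a ∈ Finset.range p, g a := by
    apply Finset.sum_congr rfl
    intro n hn; rw [Nat.mod_eq_of_lt (Finset.mem_range.mp hn)]
  rw [e]
  have h2 : ∑ n ∈ Finset.range (N % p), g (n % p) ≤ ∑ a ∈ Finset.range p, g a := by
    rw [← e]
    apply Finset.sum_le_sum_of_subset_of_nonneg
    · apply Finset.range_subset_range.mpr (Nat.mod_lt _ hp).le
    · intros; exact hg _
  have h3 : ((N / p : ℕ) : ℝ) ≤ (N:ℝ)/p := Nat.cast_div_le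
  have h4 : 0 ≤ ∑ a ∈ Finset.range p, g a := Finset.sum_nonneg (fun a _ => hg a)
  nlinarith

lemma sum_crt (g h : ℕ → ℝ) (p q : ℕ) (hp : 0 < p) (hq : 0 < q) (hpq : Nat.Coprime p q) :
    ∑ n ∈ Finset.range (p * q), g (n % p) * h (n % q) = (∑ a ∈ Finset.range p, g a) * ∑ b ∈ Finset.range q, h b := by
  rw [Finset.sum_mul_sum, ← Finset.sum_product']
  refine Finset.sum_bij (fun n _ => (n % p, n % q)) ?_ ?_ ?_ ?_
  · intro n _; simp [Nat.mod_lt _ hp, Nat.mod_lt _ hq]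
  · intro n hn m hm hnm
    simp only [Prod.mk.injEq] at hnm
    have : n ≡ m [MOD p * q] := (Nat.modEq_and_modEq_iff_modEq_mul hpq).mp ⟨hnm.1, hnm.2⟩
    exact Nat.ModEq.eq_of_lt_of_lt this (Finset.mem_range.mp hn) (Finset.mem_range.mp hm)
  · rintro ⟨a, b⟩ hab
    simp only [Finset.mem_product, Finset.mem_range] at hab
    obtain ⟨k, hk1, hk2⟩ := Nat.chineseRemainder hpq a b
    refine ⟨k % (p*q), by simp [Nat.mod_lt _ (Nat.mul_pos hp hq)], ?_⟩
    simp only [Prod.mk.injEq]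
    rw [Nat.mod_mul_right_mod, Nat.mod_mul_left_mod]
    exact ⟨by rw [hk1, Nat.mod_eq_of_lt hab.1], by rw [hk2, Nat.mod_eq_of_lt hab.2]⟩
  · intros; rfl

lemma sum_crt_incomplete (g h : ℕ → ℝ) (p q N : ℕ) (hp : 0 < p) (hq : 0 < q) (hpq : Nat.Coprime p q)
    (hg : ∑ a ∈ Finset.range p, g a = 0) :
    ∑ n ∈ Finset.range N, g (n % p) * h (n % q) ≤ (∑ a ∈ Finset.range p, |g a|) * ∑ b ∈ Finset.range q, |h b| := by
  have h1 := sum_period (fun n => g (n % p) * h (n % q)) (p*q) (by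
    intro n
    rw [Nat.add_mul_mod_self_left, Nat.add_mul_mod_self_right]) (N / (p*q)) (N % (p*q))
  rw [Nat.div_add_mod, sum_crt g h p q hp hq hpq, hg, zero_mul, mul_zero, zero_add] at h1
  rw [h1, ← sum_crt (fun a => |g a|) (fun a => |h a|) p q hp hq hpq]
  calc _ ≤ ∑ n ∈ Finset.range (N % (p*q)), |g (n % p)| * |h (n % q)| := by
        apply Finset.sum_le_sum; intro n _; rw [← abs_mul]; exact le_abs_self _
    _ ≤ _ := by
        apply Finset.sum_le_sum_of_subset_of_nonneg
        · apply Finset.range_subset_range.mpr (Nat.mod_lt _ (Nat.mul_pos hp hq)).le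
        · intros; positivity

/-- discrepancy of A in the class a mod p -/
noncomputable def cc (A : Finset ℕ) (p a : ℕ) : ℝ := ((A.filter (fun n => n % p = a)).card : ℝ) - (A.card : ℝ) / p

lemma sum_card_mod (A : Finset ℕ) (p : ℕ) (hp : 0 < p) (f : ℕ → ℝ) :
    ∑ n ∈ A, f (n % p) = ∑ a ∈ Finset.range p, ((A.filter (fun n => n % p = a)).card : ℝ) * f a := by
  rw [← Finset.sum_fiberwise_of_maps_to (t := Finset.range p) (g := fun n => n % p) (fun n _ => by simp [Nat.mod_lt _ hp])]
  apply Finset.sum_congr rfl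
  intro a _
  rw [Finset.sum_congr rfl (g := fun _ => f a)]
  · simp
  · intro n hn; rw [(Finset.mem_filter.mp hn).2]

lemma cc_sum (A : Finset ℕ) (p : ℕ) (hp : 0 < p) : ∑ a ∈ Finset.range p, cc A p a = 0 := by
  unfold cc
  have := sum_card_mod A p hp (fun _ => 1)
  simp only [mul_one, Finset.sum_const, nsmul_eq_mul] at this
  rw [Finset.sum_sub_distrib, ← this, Finset.sum_const, Finset.card_range, nsmul_eq_mul]
  field_simp; simp

/-- total variance -/
noncomputable def VV (Pi A : Finset ℕ) : ℝ := ∑ p ∈ Pi, ∑ a ∈ Finset.range p, cc A p a ^ 2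

lemma VV_nonneg (Pi A : Finset ℕ) : 0 ≤ VV Pi A := by unfold VV; positivity

lemma L1_sq (Pi A : Finset ℕ) (Q : ℝ) (hpos : ∀ p ∈ Pi, 0 < p) (hQ : ∀ p ∈ Pi, (p:ℝ) ≤ Q) (hQ0 : 0 ≤ Q) :
    (∑ p ∈ Pi, ∑ a ∈ Finset.range p, |cc A p a|)^2 ≤ Q^2 * VV Pi A := by
  rw [Finset.sum_sigma', VV, Finset.sum_sigma']
  refine (sq_sum_le_card_mul_sum_sq).trans ?_
  simp only [sq_abs]
  have hc : (((Pi.sigma fun p => Finset.range p).card : ℕ) : ℝ) ≤ Q^2 := by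
    rw [Finset.card_sigma]
    push_cast
    simp only [Finset.card_range]
    have h1 : (Pi.card : ℝ) ≤ Q := by
      have : Pi ⊆ Finset.Icc 1 ⌊Q⌋₊ := by
        intro p hp
        rw [Finset.mem_Icc]
        exact ⟨hpos p hp, Nat.le_floor (hQ p hp)⟩
      have := Finset.card_le_card this
      rw [Nat.card_Icc, Nat.add_sub_cancel] at this
      exact (Nat.cast_le.mpr this).trans (Nat.floor_le hQ0)
    calc ∑ p ∈ Pi, (p:ℝ) ≤ ∑ p ∈ Pi, Q := Finset.sum_le_sum hQ
      _ = Pi.card * Q := by simp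
      _ ≤ Q * Q := by gcongr
      _ = _ := by ring
  gcongr

lemma large_sieve (Pi A : Finset ℕ) (N : ℕ) (P Q : ℝ) (hP : 0 < P) (hcop : ∀ p ∈ Pi, ∀ q ∈ Pi, p ≠ q → Nat.Coprime p q)
    (hpos : ∀ p ∈ Pi, 0 < p) (hPp : ∀ p ∈ Pi, P ≤ p) (hQ : ∀ p ∈ Pi, (p:ℝ) ≤ Q) (hQ0 : 0 ≤ Q) (hA : A ⊆ Finset.range N) :
    VV Pi A ≤ A.card * (N / P + 1 + Q^2) := by
  set S : ℕ → ℝ := fun n => ∑ p ∈ Pi, cc A p (n % p) with hS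
  have c1 : ∑ n ∈ A, S n = VV Pi A := by
    rw [hS, Finset.sum_comm, VV]
    apply Finset.sum_congr rfl
    intro p hp
    rw [sum_card_mod A p (hpos p hp) (fun a => cc A p a)]
    have : ∀ a, ((A.filter (fun n => n % p = a)).card : ℝ) * cc A p a = cc A p a ^ 2 + (A.card : ℝ) / p * cc A p a := by
      intro a; unfold cc; ring
    simp_rw [this]
    rw [Finset.sum_add_distrib, ← Finset.mul_sum, cc_sum A p (hpos p hp)]; simp
  have c2 : (VV Pi A)^2 ≤ A.card * ∑ n ∈ Finset.range N, S n ^ 2 := by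
    rw [← c1]
    refine sq_sum_le_card_mul_sum_sq.trans ?_
    gcongr
  have c3 : ∑ n ∈ Finset.range N, S n ^ 2 ≤ (N / P + 1 + Q^2) * VV Pi A := by
    have e : ∑ n ∈ Finset.range N, S n ^ 2 = ∑ p ∈ Pi, ∑ q ∈ Pi, ∑ n ∈ Finset.range N, cc A p (n % p) * cc A q (n % q) := by
      simp_rw [hS, sq, Finset.sum_mul_sum]
      rw [Finset.sum_comm]
      apply Finset.sum_congr rfl
      intro p _
      rw [Finset.sum_comm]
    rw [e]
    have hb : ∀ p ∈ Pi, ∀ q ∈ Pi, ∑ n ∈ Finset.range N, cc A p (n % p) * cc A q (n % q) ≤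
        (if p = q then (N / P + 1) * ∑ a ∈ Finset.range p, cc A p a ^ 2 else 0) + (∑ a ∈ Finset.range p, |cc A p a|) * ∑ b ∈ Finset.range q, |cc A q b| := by
      intro p hp q hq
      split_ifs with h
      · subst h
        have h1 := sum_mod_le (fun a => cc A p a ^ 2) (fun a => sq_nonneg _) p N (hpos p hp)
        have h2 : (N:ℝ) / p + 1 ≤ N / P + 1 := by gcongr; exact hPp p hp
        have h3 : 0 ≤ ∑ a ∈ Finset.range p, cc A p a ^ 2 := by positivity
        have h4 : 0 ≤ (∑ a ∈ Finset.range p, |cc A p a|) * ∑ b ∈ Finset.range p, |cc A p b| := by positivity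
        simp_rw [← sq]
        nlinarith
      · rw [zero_add]
        exact sum_crt_incomplete (cc A p) (cc A q) p q N (hpos p hp) (hpos q hq) (hcop p hp q hq h) (cc_sum A p (hpos p hp))
    have hL := L1_sq Pi A Q hpos hQ hQ0
    calc _ ≤ ∑ p ∈ Pi, ∑ q ∈ Pi, ((if p = q then (N / P + 1) * ∑ a ∈ Finset.range p, cc A p a ^ 2 else 0) + (∑ a ∈ Finset.range p, |cc A p a|) * ∑ b ∈ Finset.range q, |cc A q b|) :=
          Finset.sum_le_sum (fun p hp => Finset.sum_le_sum (fun q hq => hb p hp q hq))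
      _ = (N / P + 1) * VV Pi A + (∑ p ∈ Pi, ∑ a ∈ Finset.range p, |cc A p a|)^2 := by
          simp_rw [Finset.sum_add_distrib]
          congr 1
          · rw [VV, Finset.mul_sum]
            apply Finset.sum_congr rfl
            intro p hp
            rw [Finset.sum_ite_eq]; simp [hp]
          · rw [sq, Finset.sum_mul_sum]
      _ ≤ _ := by linarith
  have hV := VV_nonneg Pi A
  rcases hV.eq_or_lt with h0 | h0
  · rw [← h0]; positivity
  · have : VV Pi A * VV Pi A ≤ (A.card * (N / P + 1 + Q^2)) * VV Pi A := by
      calc _ = (VV Pi A)^2 := by ring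
        _ ≤ _ := c2
        _ ≤ A.card * ((N / P + 1 + Q^2) * VV Pi A) := by gcongr
        _ = _ := by ring
    exact le_of_mul_le_mul_right this h0

/-- L1 bound in the convenient range -/
lemma L1_bd (Pi A : Finset ℕ) (N : ℝ) (P : ℝ) (hP : 1 ≤ P) (hpr : ∀ p ∈ Pi, p.Prime)
    (hPp : ∀ p ∈ Pi, P ≤ p) (hQ : ∀ p ∈ Pi, (p:ℝ) ≤ 3*P) (hA : ∀ n ∈ A, 1 ≤ n ∧ (n:ℝ) ≤ N) (hN : P^3 ≤ N) :
    ∑ p ∈ Pi, ∑ a ∈ Finset.range p, |cc A p a| ≤ 12 * N * √P := by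
  have hN1 : 1 ≤ N := le_trans (one_le_pow₀ hP) hN
  have hcard : (A.card : ℝ) ≤ N := by
    have : A ⊆ Finset.Icc 1 ⌊N⌋₊ := by
      intro n hn; rw [Finset.mem_Icc]; exact ⟨(hA n hn).1, Nat.le_floor (hA n hn).2⟩
    have := Finset.card_le_card this
    rw [Nat.card_Icc, Nat.add_sub_cancel] at this
    exact (Nat.cast_le.mpr this).trans (Nat.floor_le (by linarith))
  have h1 := large_sieve Pi A (⌊N⌋₊ + 1) P (3*P) (by linarith)
    (fun p hp q hq hpq => (Nat.coprime_primes (hpr p hp) (hpr q hq)).mpr hpq) (fun p hp => (hpr p hp).pos) hPp hQ (by linarith)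
    (by intro n hn; rw [Finset.mem_range]; exact Nat.lt_succ_of_le (Nat.le_floor (hA n hn).2))
  have h2 := L1_sq Pi A (3*P) (fun p hp => (hpr p hp).pos) hQ (by linarith)
  have hfl : ((⌊N⌋₊ + 1 : ℕ) : ℝ) ≤ 2 * N := by
    push_cast; have := Nat.floor_le (show 0 ≤ N by linarith); linarith
  have h3 : ((⌊N⌋₊ + 1 : ℕ) : ℝ) / P + 1 + (3*P)^2 ≤ 12 * (N / P) := by
    have a1 : ((⌊N⌋₊ + 1 : ℕ) : ℝ) / P ≤ 2 * (N / P) := by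
      rw [← mul_div_assoc]; gcongr
    have a2 : P^2 ≤ N / P := by rw [le_div_iff₀ (by linarith)]; linarith
    have a3 : 1 ≤ P^2 := one_le_pow₀ hP
    nlinarith
  have h4 : VV Pi A ≤ N * (12 * (N/P)) := by
    refine h1.trans ?_
    have : 0 ≤ N / P := by positivity
    gcongr
  have h5 : (∑ p ∈ Pi, ∑ a ∈ Finset.range p, |cc A p a|)^2 ≤ (12 * N * √P)^2 := by
    calc _ ≤ (3*P)^2 * (N * (12 * (N/P))) := h2.trans (by gcongr)
      _ = 108 * N^2 * P := by field_simp; ring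
      _ ≤ 144 * N^2 * P := by gcongr; norm_num
      _ = _ := by rw [mul_pow, Real.sq_sqrt (by linarith)]; ring
  exact le_of_pow_le_pow_left₀ (by norm_num) (by positivity) h5

end TP


namespace TP

/-- weight of a triple -/
noncomputable def WW (M : ℕ → Finset (ℕ × ℕ)) (p q r : ℕ) : ℝ :=
  (if (q % p, r % p) ∈ M p then (1:ℝ) else 0) - ((M p).card : ℝ) / (p:ℝ)^2

lemma box_one (Mp : Finset (ℕ × ℕ)) (p : ℕ) (hp : 0 < p) (hM : ∀ ab ∈ Mp, ab.1 < p ∧ ab.2 < p) (A R : Finset ℕ) :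
    |∑ q ∈ A, ∑ r ∈ R, ((if (q % p, r % p) ∈ Mp then (1:ℝ) else 0) - (Mp.card : ℝ) / (p:ℝ)^2)| ≤
      R.card * ∑ a ∈ Finset.range p, |cc A p a| + A.card * ∑ a ∈ Finset.range p, |cc R p a| := by
  have hp0 : (0:ℝ) < p := by exact_mod_cast hp
  set Aa : ℕ → ℝ := fun a => ((A.filter (fun n => n % p = a)).card : ℝ) with hAa
  set Ra : ℕ → ℝ := fun a => ((R.filter (fun n => n % p = a)).card : ℝ) with hRa
  have e1 : ∑ q ∈ A, ∑ r ∈ R, (if (q % p, r % p) ∈ Mp then (1:ℝ) else 0) = ∑ ab ∈ Mp, Aa ab.1 * Ra ab.2 := by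
    have : ∀ q r : ℕ, (if (q % p, r % p) ∈ Mp then (1:ℝ) else 0) = ∑ ab ∈ Mp, (if q % p = ab.1 then (1:ℝ) else 0) * (if r % p = ab.2 then (1:ℝ) else 0) := by
      intro q r
      have : ∀ ab : ℕ × ℕ, (if q % p = ab.1 then (1:ℝ) else 0) * (if r % p = ab.2 then (1:ℝ) else 0) = if (q % p, r % p) = ab then (1:ℝ) else 0 := by
        rintro ⟨a, b⟩
        simp only [Prod.mk.injEq]
        split_ifs <;> simp_all
      simp_rw [this]
      rw [Finset.sum_ite_eq]
    simp_rw [this]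
    rw [Finset.sum_congr rfl (fun q _ => Finset.sum_comm), Finset.sum_comm]
    apply Finset.sum_congr rfl
    intro ab _
    rw [← Finset.sum_mul_sum]
    simp [hAa, hRa]
  have e2 : ∑ q ∈ A, ∑ r ∈ R, ((if (q % p, r % p) ∈ Mp then (1:ℝ) else 0) - (Mp.card : ℝ) / (p:ℝ)^2) =
      ∑ ab ∈ Mp, (cc A p ab.1 * Ra ab.2 + (A.card : ℝ) / p * cc R p ab.2) := by
    simp_rw [Finset.sum_sub_distrib]
    rw [e1]
    have : ∀ ab : ℕ × ℕ, cc A p ab.1 * Ra ab.2 + (A.card : ℝ) / p * cc R p ab.2 = Aa ab.1 * Ra ab.2 - (A.card : ℝ) * R.card / p^2 := by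
      intro ab; unfold cc; simp only [hAa, hRa]; field_simp; ring
    simp_rw [this]
    rw [Finset.sum_sub_distrib]
    simp only [Finset.sum_const, nsmul_eq_mul]
    ring
  rw [e2]
  have hsub : Mp ⊆ Finset.range p ×ˢ Finset.range p := by
    intro ab hab; simp [hM ab hab]
  have hRs : ∑ b ∈ Finset.range p, Ra b = R.card := by
    have := sum_card_mod R p hp (fun _ => 1)
    simp only [mul_one, Finset.sum_const, nsmul_eq_mul] at this
    exact this.symm
  calc _ ≤ ∑ ab ∈ Mp, |cc A p ab.1 * Ra ab.2 + (A.card : ℝ) / p * cc R p ab.2| := Finset.abs_sum_le_sum_abs _ _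
    _ ≤ ∑ ab ∈ Mp, (|cc A p ab.1| * Ra ab.2 + (A.card : ℝ) / p * |cc R p ab.2|) := by
        apply Finset.sum_le_sum
        intro ab _
        refine (abs_add_le _ _).trans ?_
        rw [abs_mul, abs_mul, abs_of_nonneg (show 0 ≤ Ra ab.2 by positivity), abs_of_nonneg (show 0 ≤ (A.card : ℝ) / p by positivity)]
    _ ≤ ∑ ab ∈ Finset.range p ×ˢ Finset.range p, (|cc A p ab.1| * Ra ab.2 + (A.card : ℝ) / p * |cc R p ab.2|) := by
        apply Finset.sum_le_sum_of_subset_of_nonneg hsub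
        intros; positivity
    _ = ∑ a ∈ Finset.range p, ∑ b ∈ Finset.range p, (|cc A p a| * Ra b + (A.card : ℝ) / p * |cc R p b|) := by
        rw [Finset.sum_product]
    _ = (∑ a ∈ Finset.range p, |cc A p a|) * (∑ b ∈ Finset.range p, Ra b) + A.card * ∑ a ∈ Finset.range p, |cc R p a| := by
        simp_rw [Finset.sum_add_distrib]
        rw [Finset.sum_mul_sum]
        congr 1
        rw [Finset.sum_const, Finset.card_range, nsmul_eq_mul, ← Finset.mul_sum]
        field_simp
    _ = _ := by rw [hRs]; ring

lemma box_bd (M : ℕ → Finset (ℕ × ℕ)) (Pi A R : Finset ℕ) (NA NR P : ℝ) (hP : 1 ≤ P) (hpr : ∀ p ∈ Pi, p.Prime)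
    (hM : ∀ p ∈ Pi, ∀ ab ∈ M p, ab.1 < p ∧ ab.2 < p)
    (hPp : ∀ p ∈ Pi, P ≤ p) (hQ : ∀ p ∈ Pi, (p:ℝ) ≤ 3*P) (hA : ∀ n ∈ A, 1 ≤ n ∧ (n:ℝ) ≤ NA) (hNA : P^3 ≤ NA)
    (hR : ∀ n ∈ R, 1 ≤ n ∧ (n:ℝ) ≤ NR) (hNR : P^3 ≤ NR) :
    |∑ p ∈ Pi, ∑ q ∈ A, ∑ r ∈ R, WW M p q r| ≤ 24 * NA * NR * √P := by
  have hc : ∀ (A : Finset ℕ) (N : ℝ), P^3 ≤ N → (∀ n ∈ A, 1 ≤ n ∧ (n:ℝ) ≤ N) → (A.card : ℝ) ≤ N := by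
    intro A N hN hA
    have hN1 : 1 ≤ N := le_trans (one_le_pow₀ hP) hN
    have : A ⊆ Finset.Icc 1 ⌊N⌋₊ := by
      intro n hn; rw [Finset.mem_Icc]; exact ⟨(hA n hn).1, Nat.le_floor (hA n hn).2⟩
    have := Finset.card_le_card this
    rw [Nat.card_Icc, Nat.add_sub_cancel] at this
    exact (Nat.cast_le.mpr this).trans (Nat.floor_le (by linarith))
  have h1 := L1_bd Pi A NA P hP hpr hPp hQ hA hNA
  have h2 := L1_bd Pi R NR P hP hpr hPp hQ hR hNR
  have h3 := hc A NA hNA hA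
  have h4 := hc R NR hNR hR
  have hA0 : 0 ≤ NA := le_trans (by positivity) hNA
  have hR0 : 0 ≤ NR := le_trans (by positivity) hNR
  calc _ ≤ ∑ p ∈ Pi, |∑ q ∈ A, ∑ r ∈ R, WW M p q r| := Finset.abs_sum_le_sum_abs _ _
    _ ≤ ∑ p ∈ Pi, ((R.card : ℝ) * ∑ a ∈ Finset.range p, |cc A p a| + A.card * ∑ a ∈ Finset.range p, |cc R p a|) := by
        apply Finset.sum_le_sum
        intro p hp
        exact box_one (M p) p (hpr p hp).pos (hM p hp) A R
    _ = (R.card : ℝ) * (∑ p ∈ Pi, ∑ a ∈ Finset.range p, |cc A p a|) + A.card * ∑ p ∈ Pi, ∑ a ∈ Finset.range p, |cc R p a| := by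
        rw [Finset.sum_add_distrib, ← Finset.mul_sum, ← Finset.mul_sum]
    _ ≤ NR * (12 * NA * √P) + NA * (12 * NR * √P) := by gcongr
    _ = _ := by ring

/-- iterated logarithms -/
noncomputable def l1 (x : ℝ) : ℝ := Real.log x
/-- iterated logarithms -/
noncomputable def l2 (x : ℝ) : ℝ := Real.log (Real.log x)
/-- iterated logarithms -/
noncomputable def l3 (x : ℝ) : ℝ := Real.log (Real.log (Real.log x))

/-- the large-x regime -/
structure Reg (x : ℝ) : Prop where
  pos : 0 < x
  h3 : 100 ≤ l3 x
  h2 : l3 x ^ 4 ≤ l2 x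
  h1 : l2 x ^ 100 ≤ l1 x

lemma reg_ev : ∀ᶠ x in atTop, Reg x := by
  have t1 : Tendsto l1 atTop atTop := Real.tendsto_log_atTop
  have t2 : Tendsto l2 atTop atTop := Real.tendsto_log_atTop.comp t1
  have t3 : Tendsto l3 atTop atTop := Real.tendsto_log_atTop.comp t2
  have key : ∀ n : ℕ, ∀ᶠ y : ℝ in atTop, Real.log y ^ n ≤ y := by
    intro n
    have := (Real.isLittleO_pow_log_id_atTop (n := n)).bound (show (0:ℝ) < 1 by norm_num)
    filter_upwards [this, eventually_ge_atTop 1] with y hy hy1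
    rw [Real.norm_eq_abs, id, Real.norm_of_nonneg (by linarith), one_mul] at hy
    exact (le_abs_self _).trans hy
  filter_upwards [eventually_gt_atTop 0, t3.eventually (eventually_ge_atTop 100), t2.eventually (key 4), t1.eventually (key 100)] with x h0 h3 h2 h1
  exact ⟨h0, h3, h2, h1⟩

namespace Reg
lemma l2_ge {x : ℝ} (h : Reg x) : 10^6 ≤ l2 x := by
  have : (100:ℝ)^4 ≤ l3 x ^ 4 := by gcongr; exact h.h3
  have := h.h2; linarith
lemma l3_le_l2 {x : ℝ} (h : Reg x) : l3 x ≤ l2 x := by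
  have := h.h2; have h3 := h.h3
  have : l3 x ≤ l3 x ^ 4 := le_self_pow₀ (by linarith) (by norm_num)
  linarith
lemma l2_le_l1 {x : ℝ} (h : Reg x) : l2 x ≤ l1 x := by
  have := h.h1; have h3 := h.l2_ge
  have : l2 x ≤ l2 x ^ 100 := le_self_pow₀ (by linarith) (by norm_num)
  linarith
lemma l1_ge {x : ℝ} (h : Reg x) : 10^6 ≤ l1 x := h.l2_ge.trans h.l2_le_l1
lemma x_eq {x : ℝ} (h : Reg x) : x = Real.exp (l1 x) := (Real.exp_log h.pos).symm
lemma l1_eq {x : ℝ} (h : Reg x) : l1 x = Real.exp (l2 x) := (Real.exp_log (by have := h.l1_ge; linarith)).symm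
lemma l2_eq {x : ℝ} (h : Reg x) : l2 x = Real.exp (l3 x) := (Real.exp_log (by have := h.l2_ge; linarith)).symm
lemma pow_le {x : ℝ} (h : Reg x) (k : ℕ) (hk : k ≤ 99) : l2 x ^ k * 100 ≤ l1 x := by
  have h2 := h.l2_ge
  calc l2 x ^ k * 100 ≤ l2 x ^ 99 * l2 x := by
        gcongr
        · linarith
        · linarith
    _ = l2 x ^ 100 := by ring
    _ ≤ _ := h.h1
end Reg

lemma PI_bd : ∃ C > 0, ∀ x, Reg x → ∀ y, x * Real.exp (-(4 * l1 x / l3 x)) ≤ y → y ≤ x →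
    |((PP y).card : ℝ) - y / l1 x| ≤ C / l3 x * (y / l1 x) := by
  obtain ⟨C, hC, h⟩ := pnt
  refine ⟨8 + 2 * C, by positivity, ?_⟩
  intro x hx y hy hyx
  have hl1 := hx.l1_ge
  have hl3 := hx.h3
  have hl10 : 0 < l1 x := by linarith
  have hl30 : 0 < l3 x := by linarith
  have hy0 : 0 < y := lt_of_lt_of_le (mul_pos hx.pos (Real.exp_pos _)) hy
  set ly := Real.log y with hly
  have hlo : l1 x - 4 * l1 x / l3 x ≤ ly := by
    have := Real.log_le_log (mul_pos hx.pos (Real.exp_pos _)) hy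
    rw [Real.log_mul hx.pos.ne' (Real.exp_pos _).ne', Real.log_exp] at this
    exact this
  have hhi : ly ≤ l1 x := Real.log_le_log hy0 hyx
  have hhalf : l1 x / 2 ≤ ly := by
    have : 4 * l1 x / l3 x ≤ l1 x / 2 := by
      rw [div_le_div_iff₀ hl30 (by norm_num)]; nlinarith
    linarith
  have hly0 : 0 < ly := by linarith
  have hy2 : 2 ≤ y := by
    have : Real.log 2 ≤ ly := by
      have := Real.log_le_sub_one_of_pos (show (0:ℝ) < 2 by norm_num); linarith
    exact (Real.log_le_log_iff (by norm_num) hy0).mp this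
  have hp := h y hy2
  rw [← hly] at hp
  have hpow : ly ^ (-(1/40) : ℝ) ≤ 1 / l3 x := by
    rw [Real.rpow_neg hly0.le, one_div (l3 x)]
    gcongr
    have h40 : l3 x ^ 40 ≤ ly := by
      calc l3 x ^ 40 ≤ l2 x ^ 40 := by gcongr; exact hx.l3_le_l2
        _ ≤ l1 x / 2 := by have := hx.pow_le 40 (by norm_num); linarith
        _ ≤ ly := hhalf
    calc l3 x = (l3 x ^ 40) ^ (1/40 : ℝ) := by
          rw [← Real.rpow_natCast, ← Real.rpow_mul hl30.le]; norm_num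
      _ ≤ _ := by gcongr
  have hyl : y / ly ≤ 2 * (y / l1 x) := by
    rw [← mul_div_assoc, div_le_div_iff₀ hly0 hl10]; nlinarith
  have hdif : |y / ly - y / l1 x| ≤ 8 / l3 x * (y / l1 x) := by
    have e : y / ly - y / l1 x = (y / ly) * ((l1 x - ly) / l1 x) := by field_simp
    rw [e, abs_of_nonneg (mul_nonneg (by positivity) (div_nonneg (by linarith) hl10.le))]
    have : (l1 x - ly) / l1 x ≤ 4 / l3 x := by
      rw [div_le_iff₀ hl10]
      have : 4 / l3 x * l1 x = 4 * l1 x / l3 x := by ring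
      linarith
    calc _ ≤ (2 * (y / l1 x)) * (4 / l3 x) := by
          gcongr
      _ = _ := by ring
  calc _ ≤ |((PP y).card : ℝ) - y / ly| + |y / ly - y / l1 x| := abs_sub_le _ _ _
    _ ≤ C * (2 * (y / l1 x)) * (1 / l3 x) + 8 / l3 x * (y / l1 x) := by
        gcongr
        exact hp.trans (by gcongr)
    _ = _ := by ring

end TP


namespace TP

/-- admissible triples -/
noncomputable def TT (x : ℝ) : Finset (ℕ × ℕ × ℕ) :=
  (PP x ×ˢ PP x ×ˢ PP x).filter (fun t => 3 ≤ t.1 ∧ t.1 < t.2.1 ∧ t.2.1 < t.2.2 ∧ (t.1:ℝ) * t.2.1 * t.2.2 ≤ x)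

lemma mem_TT {x : ℝ} {t : ℕ × ℕ × ℕ} : t ∈ TT x ↔ t.1.Prime ∧ t.2.1.Prime ∧ t.2.2.Prime ∧ 3 ≤ t.1 ∧ t.1 < t.2.1 ∧ t.2.1 < t.2.2 ∧ (t.1:ℝ) * t.2.1 * t.2.2 ≤ x := by
  unfold TT
  rw [Finset.mem_filter, Finset.mem_product, Finset.mem_product, mem_PP, mem_PP, mem_PP]
  constructor
  · rintro ⟨⟨h1, h2, h3⟩, h4⟩; exact ⟨h1.1, h2.1, h3.1, h4⟩
  · rintro ⟨h1, h2, h3, h4, h5, h6, h7⟩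
    have a1 : (1:ℝ) ≤ t.1 := by exact_mod_cast h1.one_lt.le
    have a2 : (1:ℝ) ≤ t.2.1 := by exact_mod_cast h2.one_lt.le
    have a3 : (1:ℝ) ≤ t.2.2 := by exact_mod_cast h3.one_lt.le
    have b1 : (1:ℝ) ≤ t.1 * t.2.1 := one_le_mul_of_one_le_of_one_le a1 a2
    have c3 : (t.2.2:ℝ) ≤ x := by nlinarith
    have c2 : (t.2.1:ℝ) < t.2.2 := by exact_mod_cast h6
    have c1 : (t.1:ℝ) < t.2.1 := by exact_mod_cast h5
    exact ⟨⟨⟨h1, by linarith⟩, ⟨h2, by linarith⟩, ⟨h3, by linarith⟩⟩, h4, h5, h6, h7⟩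

lemma fib_le (S : Finset (ℕ × ℕ × ℕ)) (d : ℕ × ℕ) (R : Finset ℕ) (h : ∀ t ∈ S, (t.1, t.2.1) = d → t.2.2 ∈ R) :
    (S.filter (fun t => (t.1, t.2.1) = d)).card ≤ R.card := by
  apply Finset.card_le_card_of_injOn (fun t => t.2.2)
  · intro t ht
    have ht := Finset.mem_coe.mp ht
    rw [Finset.mem_filter] at ht; exact h t ht.1 ht.2
  · rintro ⟨a, b, c⟩ ha ⟨a', b', c'⟩ ha' hcc
    have ha := (Finset.mem_filter.mp (Finset.mem_coe.mp ha)).2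
    have ha' := (Finset.mem_filter.mp (Finset.mem_coe.mp ha')).2
    simp only at ha ha' hcc
    rw [← ha'] at ha
    simp only [Prod.mk.injEq] at ha
    rw [ha.1, ha.2, hcc]

lemma GB : ∃ C > 0, ∀ x, Reg x → ∀ S ⊆ TT x, ∀ d : ℕ × ℕ,
    ((S.filter (fun t => (t.1, t.2.1) = d)).card : ℝ) ≤ C * (x / l1 x) * (1 / d.1 * (1 / d.2)) := by
  obtain ⟨C, hC, h⟩ := cheb
  refine ⟨3 * C, by positivity, ?_⟩
  intro x hx S hS d
  have hl1 := hx.l1_ge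
  have hl10 : 0 < l1 x := by linarith
  have hx0 := hx.pos
  rcases Finset.eq_empty_or_nonempty (S.filter (fun t => (t.1, t.2.1) = d)) with he | ⟨t, ht⟩
  · rw [he]; simp; positivity
  rw [Finset.mem_filter] at ht
  obtain ⟨htS, htd⟩ := ht
  obtain ⟨p1, p2, p3, h3, h4, h5, h6⟩ := mem_TT.mp (hS htS)
  have hd1 : d.1 = t.1 := by rw [← htd]
  have hd2 : d.2 = t.2.1 := by rw [← htd]
  rw [hd1, hd2]
  have a1 : (3:ℝ) ≤ t.1 := by exact_mod_cast h3
  have a2 : (t.1:ℝ) < t.2.1 := by exact_mod_cast h4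
  have a3 : (t.2.1:ℝ) < t.2.2 := by exact_mod_cast h5
  set p : ℝ := (t.1:ℝ)
  set q : ℝ := (t.2.1:ℝ)
  set r : ℝ := (t.2.2:ℝ)
  set y := x / (p * q) with hy
  have hp0 : 0 < p := by linarith
  have hq0 : 0 < q := by linarith
  have hpq : 0 < p * q := by positivity
  have hry : r ≤ y := by rw [hy, le_div_iff₀ hpq]; linarith
  have hy3 : x ≤ y^3 := by
    have : x = p * q * y := by rw [hy]; field_simp
    calc x = p * q * y := this
      _ ≤ y * y * y := by gcongr <;> linarith
      _ = _ := by ring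
  have hy2 : 2 ≤ y := by linarith
  have hlog : l1 x / 3 ≤ Real.log y := by
    have := Real.log_le_log hx0 hy3
    rw [Real.log_pow] at this
    unfold l1; push_cast at this; linarith
  have hb := fib_le S d (PP y) (by
    intro t' ht' he
    obtain ⟨p1', p2', p3', h3', h4', h5', h6'⟩ := mem_TT.mp (hS ht')
    rw [mem_PP]
    refine ⟨p3', ?_⟩
    have e1 : t'.1 = t.1 := by rw [← hd1, ← he]
    have e2 : t'.2.1 = t.2.1 := by rw [← hd2, ← he]
    rw [hy, le_div_iff₀ hpq]
    rw [e1, e2] at h6'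
    linarith)
  calc _ ≤ ((PP y).card : ℝ) := by exact_mod_cast hb
    _ ≤ C * (y / Real.log y) := h y hy2
    _ ≤ C * (y / (l1 x / 3)) := by gcongr
    _ = _ := by rw [hy]; field_simp

lemma GBsum : ∃ C > 0, ∀ x, Reg x → ∀ S ⊆ TT x, ∀ D : Finset (ℕ × ℕ), (∀ t ∈ S, (t.1, t.2.1) ∈ D) →
    (S.card : ℝ) ≤ C * (x / l1 x) * ∑ d ∈ D, (1 / (d.1:ℝ) * (1 / d.2)) := by
  obtain ⟨C, hC, h⟩ := GB
  refine ⟨C, hC, ?_⟩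
  intro x hx S hS D hD
  rw [Finset.card_eq_sum_card_fiberwise (f := fun t => (t.1, t.2.1)) (t := D) (fun t ht => hD t (by simpa using ht))]
  push_cast
  rw [Finset.mul_sum]
  exact Finset.sum_le_sum (fun d _ => h x hx S hS d)

lemma HR_nonneg (y : ℝ) : 0 ≤ HR y := by unfold HR; positivity

lemma PP_mono {a b : ℝ} (hab : a ≤ b) : PP a ⊆ PP b := fun _ hp =>
  mem_PP.mpr ⟨(mem_PP.mp hp).1, (mem_PP.mp hp).2.trans hab⟩

lemma HR_sub {a b : ℝ} (hab : a ≤ b) : ∑ q ∈ PP b \ PP a, 1 / (q:ℝ) = HR b - HR a := by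
  unfold HR
  rw [← Finset.sum_sdiff (PP_mono hab)]; ring

/-- the cutoff for q -/
noncomputable def zz (x : ℝ) : ℝ := Real.exp (l1 x / l3 x)

namespace Reg
lemma zz_log {x : ℝ} (h : Reg x) : Real.log (Real.log (zz x)) = l2 x - Real.log (l3 x) := by
  unfold zz
  have := h.l1_ge
  have := h.h3
  rw [Real.log_exp, Real.log_div (by linarith) (by linarith)]
  rfl
lemma zz_ge {x : ℝ} (h : Reg x) : l1 x ≤ zz x := by
  have h1 := h.l1_ge
  have h3 := h.h3
  have : l2 x ≤ l1 x / l3 x := by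
    rw [le_div_iff₀ (by linarith)]
    calc l2 x * l3 x ≤ l2 x * l2 x := by gcongr; have := h.l2_ge; linarith; exact h.l3_le_l2
      _ = l2 x ^ 2 := by ring
      _ ≤ _ := by have := h.pow_le 2 (by norm_num); have : 0 ≤ l2 x ^ 2 := by positivity
                  linarith
  calc l1 x = Real.exp (l2 x) := h.l1_eq
    _ ≤ _ := Real.exp_le_exp.mpr this
lemma zz_pow {x : ℝ} (h : Reg x) (k : ℕ) (hk : k ≤ 50) : zz x ^ k * l1 x ≤ x := by
  have h1 := h.l1_ge
  have h3 := h.h3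
  have a1 : zz x ^ k ≤ Real.exp (l1 x / 2) := by
    unfold zz
    rw [← Real.exp_nat_mul]
    apply Real.exp_le_exp.mpr
    rw [← mul_div_assoc, div_le_div_iff₀ (by linarith) (by norm_num)]
    have : (k:ℝ) ≤ 50 := by exact_mod_cast hk
    nlinarith
  have a2 : l1 x ≤ Real.exp (l1 x / 2) := by
    have := Real.add_one_le_exp (l1 x / 4)
    have e : Real.exp (l1 x / 2) = Real.exp (l1 x / 4) ^ 2 := by
      rw [← Real.exp_nat_mul]; congr 1; push_cast; ring
    rw [e]
    have : (l1 x / 4 + 1)^2 ≤ Real.exp (l1 x / 4) ^ 2 := by gcongr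
    nlinarith [sq_nonneg (l1 x / 4 - 1)]
  calc _ ≤ Real.exp (l1 x / 2) * Real.exp (l1 x / 2) := by gcongr
    _ = x := by rw [← Real.exp_add, add_halves, ← h.x_eq]
lemma zz_le {x : ℝ} (h : Reg x) : zz x ≤ x := by
  have := h.zz_pow 1 (by norm_num)
  have h1 := h.l1_ge
  have : 0 < zz x := Real.exp_pos _
  nlinarith
lemma HRx {x : ℝ} (h : Reg x) {C : ℝ} (hC : ∀ b ≥ 2, |HR b - Real.log (Real.log b)| ≤ C) : |HR x - l2 x| ≤ C := by
  apply hC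
  have := h.zz_ge; have := h.zz_le; have := h.l1_ge; linarith
lemma HRz {x : ℝ} (h : Reg x) {C : ℝ} (hC : ∀ b ≥ 2, |HR b - Real.log (Real.log b)| ≤ C) : |HR (zz x) - (l2 x - Real.log (l3 x))| ≤ C := by
  rw [← h.zz_log]
  apply hC
  have := h.zz_ge; have := h.l1_ge; linarith
end Reg

/-- error unit -/
noncomputable def EU (x : ℝ) : ℝ := x * l2 x ^ 2 / (l1 x * l3 x)

lemma EU_pos {x : ℝ} (h : Reg x) : 0 < EU x := by
  have := h.pos; have := h.l1_ge; have := h.l2_ge; have := h.h3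
  unfold EU
  have h1 : 0 < l1 x := by linarith
  have h2 : 0 < l2 x := by linarith
  have h3 : 0 < l3 x := by linarith
  positivity

/-- turn a bound on a reciprocal sum into a bound by the error unit -/
lemma to_EU {x : ℝ} (h : Reg x) {s K : ℝ} (hs : s * l3 x ≤ K * l2 x ^ 2) : (x / l1 x) * s ≤ K * EU x := by
  have := h.pos; have := h.l1_ge; have := h.h3
  have h1 : 0 < l1 x := by linarith
  have h3 : 0 < l3 x := by linarith
  have e : K * EU x = (x / l1 x) * (K * l2 x ^ 2 / l3 x) := by unfold EU; field_simp
  rw [e]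
  gcongr
  rwa [le_div_iff₀ h3]

lemma to_EU_mul {x : ℝ} (h : Reg x) {C s K : ℝ} (hC : 0 ≤ C) (hs : s * l3 x ≤ K * l2 x ^ 2) : C * (x / l1 x) * s ≤ C * K * EU x := by
  rw [mul_assoc, mul_assoc]
  exact mul_le_mul_of_nonneg_left (to_EU h hs) hC

lemma sum_recip (A B : Finset ℕ) : ∑ d ∈ A ×ˢ B, (1 / (d.1:ℝ) * (1 / d.2)) = (∑ p ∈ A, 1 / (p:ℝ)) * ∑ q ∈ B, 1 / (q:ℝ) := by
  rw [Finset.sum_mul_sum, Finset.sum_product]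

lemma E1 : ∃ K > 0, ∀ x, Reg x → ∀ S ⊆ TT x, (∀ t ∈ S, (t.1:ℝ) < l1 x ^ 8) → (S.card : ℝ) ≤ K * EU x := by
  obtain ⟨C, hC, h⟩ := GBsum
  obtain ⟨C', hC', hm⟩ := mertens
  refine ⟨C * ((4 + C') * (1 + C')), by positivity, ?_⟩
  intro x hx S hS hp
  have h1 := hx.l1_ge
  have h2 := hx.l2_ge
  have h3 := hx.h3
  have hb := h x hx S hS (PP (l1 x ^ 8) ×ˢ PP x) (by
    intro t ht
    have := mem_TT.mp (hS ht)
    rw [TT, Finset.subset_iff] at hS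
    have h4 := hS ht
    rw [Finset.mem_filter, Finset.mem_product, Finset.mem_product] at h4
    rw [Finset.mem_product]
    exact ⟨mem_PP.mpr ⟨this.1, (hp t ht).le⟩, h4.1.2.1⟩)
  rw [sum_recip] at hb
  change _ ≤ C * (x / l1 x) * (HR (l1 x ^ 8) * HR x) at hb
  refine hb.trans ?_
  have hH1 : HR (l1 x ^ 8) ≤ (4 + C') * l3 x := by
    have := (abs_le.mp (hm (l1 x ^ 8) (by
      have : l1 x ≤ l1 x ^ 8 := le_self_pow₀ (by linarith) (by norm_num)
      linarith))).2
    rw [Real.log_pow, Real.log_mul (by norm_num) (by change l2 x ≠ 0; linarith)] at this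
    change HR (l1 x ^ 8) - (Real.log ((8:ℕ):ℝ) + l3 x) ≤ C' at this
    have h8 : Real.log ((8:ℕ):ℝ) ≤ 7 := by
      have := Real.log_le_sub_one_of_pos (show (0:ℝ) < 8 by norm_num); push_cast; linarith
    nlinarith
  have hH2 : HR x ≤ (1 + C') * l2 x := by
    have := (abs_le.mp (hx.HRx hm)).2
    nlinarith
  apply to_EU_mul hx hC.le
  have hz := HR_nonneg x
  calc HR (l1 x ^ 8) * HR x * l3 x ≤ ((4 + C') * l3 x) * ((1 + C') * l2 x) * l3 x := by gcongr
    _ = ((4 + C') * (1 + C')) * (l3 x ^ 2 * l2 x) := by ring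
    _ ≤ ((4 + C') * (1 + C')) * (l2 x * l2 x) := by
        gcongr
        refine le_trans ?_ hx.h2
        apply pow_le_pow_right₀ (by linarith) (by norm_num)
    _ = _ := by ring

lemma E2 : ∃ K > 0, ∀ x, Reg x → ∀ S ⊆ TT x, (∀ t ∈ S, (t.2.1:ℝ) ≤ (t.1:ℝ)^4) → (S.card : ℝ) ≤ K * EU x := by
  obtain ⟨C, hC, h⟩ := GBsum
  obtain ⟨C', hC', hm⟩ := mertens
  refine ⟨C * ((1 + C') * (3 + 2*C')), by positivity, ?_⟩
  intro x hx S hS hp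
  have h1 := hx.l1_ge
  have h2 := hx.l2_ge
  have h3 := hx.h3
  have hb := h x hx S hS ((PP x).biUnion (fun p => (PP ((p:ℝ)^4) \ PP (p:ℝ)).image (fun q => (p, q)))) (by
    intro t ht
    have := mem_TT.mp (hS ht)
    rw [TT, Finset.subset_iff] at hS
    have h4 := hS ht
    rw [Finset.mem_filter, Finset.mem_product, Finset.mem_product] at h4
    rw [Finset.mem_biUnion]
    refine ⟨t.1, h4.1.1, ?_⟩
    rw [Finset.mem_image]
    refine ⟨t.2.1, ?_, rfl⟩
    rw [Finset.mem_sdiff, mem_PP, mem_PP]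
    refine ⟨⟨this.2.1, hp t ht⟩, ?_⟩
    rintro ⟨_, h5⟩
    have h5 : t.2.1 ≤ t.1 := by exact_mod_cast h5
    omega)
  refine hb.trans ?_
  apply to_EU_mul hx hC.le
  have hH2 : HR x ≤ (1 + C') * l2 x := by
    have := (abs_le.mp (hx.HRx hm)).2
    nlinarith
  have hs : ∑ d ∈ (PP x).biUnion (fun p => (PP ((p:ℝ)^4) \ PP (p:ℝ)).image (fun q => (p, q))), (1 / (d.1:ℝ) * (1 / d.2)) ≤ HR x * (3 + 2*C') := by
    rw [Finset.sum_biUnion]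
    · rw [HR, Finset.sum_mul]
      apply Finset.sum_le_sum
      intro p hpp
      have hp2 : (2:ℝ) ≤ p := by exact_mod_cast (mem_PP.mp hpp).1.two_le
      rw [Finset.sum_image (by intro a _ b _ hab; simpa using hab)]
      simp only
      rw [← Finset.mul_sum]
      gcongr
      rw [HR_sub (le_self_pow₀ (by linarith) (by norm_num))]
      have m1 := (abs_le.mp (hm p hp2)).1
      have m2 := (abs_le.mp (hm ((p:ℝ)^4) (hp2.trans (le_self_pow₀ (by linarith) (by norm_num))))).2
      have hl : 0 < Real.log p := Real.log_pos (by linarith)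
      rw [Real.log_pow, Real.log_mul (by norm_num) hl.ne'] at m2
      have h8 : Real.log ((4:ℕ):ℝ) ≤ 3 := by
        have := Real.log_le_sub_one_of_pos (show (0:ℝ) < 4 by norm_num); push_cast; linarith
      linarith
    · intro p _ p' _ hne
      simp only [Function.onFun]
      rw [Finset.disjoint_left]
      intro d hd hd'
      rw [Finset.mem_image] at hd hd'
      obtain ⟨a, _, ha⟩ := hd
      obtain ⟨b, _, hb⟩ := hd'
      apply hne
      rw [← hb] at ha
      simpa using (congrArg Prod.fst ha)
  calc _ ≤ ((1 + C') * l2 x) * (3 + 2*C') * l2 x := by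
        gcongr
        · refine hs.trans (by gcongr)
        · exact hx.l3_le_l2
    _ = _ := by ring

lemma log_l3_le {x : ℝ} (hx : Reg x) : Real.log (l3 x) ≤ l3 x := by
  have := Real.log_le_sub_one_of_pos (show 0 < l3 x by have := hx.h3; linarith); linarith

lemma log_l3_nonneg {x : ℝ} (hx : Reg x) : 0 ≤ Real.log (l3 x) :=
  Real.log_nonneg (by have := hx.h3; linarith)

lemma E3 : ∃ K > 0, ∀ x, Reg x → ∀ S ⊆ TT x, (∀ t ∈ S, zz x < (t.2.1:ℝ)) → (S.card : ℝ) ≤ K * EU x := by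
  obtain ⟨C, hC, h⟩ := GBsum
  obtain ⟨C', hC', hm⟩ := mertens
  refine ⟨C * ((1 + C') * (1 + 2*C')), by positivity, ?_⟩
  intro x hx S hS hp
  have h1 := hx.l1_ge
  have h2 := hx.l2_ge
  have h3 := hx.h3
  have hb := h x hx S hS (PP x ×ˢ (PP x \ PP (zz x))) (by
    intro t ht
    rw [TT, Finset.subset_iff] at hS
    have h4 := hS ht
    rw [Finset.mem_filter, Finset.mem_product, Finset.mem_product] at h4
    rw [Finset.mem_product]
    refine ⟨h4.1.1, ?_⟩
    rw [Finset.mem_sdiff]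
    refine ⟨h4.1.2.1, ?_⟩
    rw [mem_PP]
    have := hp t ht
    rintro ⟨_, h5⟩
    linarith)
  rw [sum_recip, HR_sub hx.zz_le] at hb
  change _ ≤ C * (x / l1 x) * (HR x * (HR x - HR (zz x))) at hb
  refine hb.trans ?_
  have hH2 : HR x ≤ (1 + C') * l2 x := by
    have := (abs_le.mp (hx.HRx hm)).2
    nlinarith
  have hH3 : HR x - HR (zz x) ≤ (1 + 2*C') * l3 x := by
    have m1 := (abs_le.mp (hx.HRx hm)).2
    have m2 := (abs_le.mp (hx.HRz hm)).1
    have := log_l3_le hx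
    nlinarith
  have hz := HR_nonneg x
  apply to_EU_mul hx hC.le
  calc HR x * (HR x - HR (zz x)) * l3 x ≤ ((1 + C') * l2 x) * ((1 + 2*C') * l3 x) * l3 x := by
        have : 0 ≤ (1 + 2*C') * l3 x := by positivity
        have : 0 ≤ l2 x := by linarith
        apply mul_le_mul_of_nonneg_right _ (by linarith)
        calc HR x * (HR x - HR (zz x)) ≤ HR x * ((1 + 2*C') * l3 x) := by gcongr
          _ ≤ _ := by gcongr
    _ = ((1 + C') * (1 + 2*C')) * (l3 x ^ 2 * l2 x) := by ring
    _ ≤ ((1 + C') * (1 + 2*C')) * (l2 x * l2 x) := by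
        gcongr
        refine le_trans ?_ hx.h2
        apply pow_le_pow_right₀ (by linarith) (by norm_num)
    _ = _ := by ring

lemma zpow_EU {x : ℝ} (hx : Reg x) (k : ℕ) (hk : k ≤ 50) : zz x ^ k ≤ EU x := by
  have h1 := hx.l1_ge
  have h2 := hx.l2_ge
  have h3 := hx.h3
  have h0 := hx.pos
  have a : zz x ^ k ≤ x / l1 x := by
    rw [le_div_iff₀ (by linarith)]; exact hx.zz_pow k hk
  have b : (x / l1 x) * 1 ≤ 1 * EU x := by
    apply to_EU hx
    have := hx.l3_le_l2
    nlinarith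
  linarith

lemma E4 : ∀ x, Reg x → ∀ S ⊆ TT x, (∀ t ∈ S, (t.2.2:ℝ) ≤ zz x) → (S.card : ℝ) ≤ 1 * EU x := by
  intro x hx S hS hr
  have : S ⊆ PP (zz x) ×ˢ PP (zz x) ×ˢ PP (zz x) := by
    intro t ht
    obtain ⟨p1, p2, p3, h3, h4, h5, h6⟩ := mem_TT.mp (hS ht)
    have := hr t ht
    have c2 : (t.2.1:ℝ) < t.2.2 := by exact_mod_cast h5
    have c1 : (t.1:ℝ) < t.2.1 := by exact_mod_cast h4
    rw [Finset.mem_product, Finset.mem_product, mem_PP, mem_PP, mem_PP]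
    exact ⟨⟨p1, by linarith⟩, ⟨p2, by linarith⟩, ⟨p3, by linarith⟩⟩
  have := Finset.card_le_card this
  rw [Finset.card_product, Finset.card_product] at this
  have hz : 0 ≤ zz x := (Real.exp_pos _).le
  have hc := card_PP_le hz
  calc (S.card : ℝ) ≤ ((PP (zz x)).card : ℝ) * ((PP (zz x)).card * (PP (zz x)).card) := by exact_mod_cast this
    _ ≤ zz x * (zz x * zz x) := by gcongr
    _ = zz x ^ 3 := by ring
    _ ≤ _ := by rw [one_mul]; exact zpow_EU hx 3 (by norm_num)

lemma y_range {x : ℝ} (hx : Reg x) {p q : ℝ} (hp : 1 ≤ p) (hpz : p ≤ zz x) (hq : 1 ≤ q) (hqz : q ≤ zz x) {e : ℝ} (he : 0 ≤ e) (he1 : e ≤ 2) :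
    x * Real.exp (-(4 * l1 x / l3 x)) ≤ x / (p * q) * Real.exp (-e) ∧ x / (p*q) * Real.exp (-e) ≤ x := by
  have hx0 := hx.pos
  have hl3 := hx.h3
  have hl1 := hx.l1_ge
  constructor
  · have h1 : p * q ≤ Real.exp (2 * (l1 x / l3 x)) := by
      have : 0 ≤ zz x := (Real.exp_pos _).le
      calc p * q ≤ zz x * zz x := by gcongr
        _ = _ := by rw [zz, ← Real.exp_add]; congr 1; ring
    have h2 : Real.exp (-(2 * (l1 x / l3 x))) ≤ (p*q)⁻¹ := by
      rw [Real.exp_neg]; gcongr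
    have h3 : 2 ≤ l1 x / l3 x := by
      have := hx.zz_ge
      rw [zz] at this
      have h4 := Real.log_le_log (by linarith) this
      rw [Real.log_exp] at h4
      have h5 := hx.l2_ge
      change l2 x ≤ _ at h4
      linarith
    calc x * Real.exp (-(4 * l1 x / l3 x)) ≤ x * (Real.exp (-(2 * (l1 x / l3 x))) * Real.exp (-e)) := by
          rw [← Real.exp_add]
          gcongr
          have : 4 * l1 x / l3 x = 2 * (l1 x / l3 x) + 2 * (l1 x / l3 x) := by ring
          linarith
      _ ≤ x * ((p*q)⁻¹ * Real.exp (-e)) := by gcongr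
      _ = _ := by ring
  · have h1 : 1 ≤ p * q := one_le_mul_of_one_le_of_one_le hp hq
    have h2 : Real.exp (-e) ≤ 1 := Real.exp_le_one_iff.mpr (by linarith)
    calc x / (p*q) * Real.exp (-e) ≤ x / 1 * 1 := by gcongr
      _ = x := by ring

lemma E5 : ∃ K > 0, ∀ x, Reg x → ∀ S ⊆ TT x, (∀ t ∈ S, (t.2.1:ℝ) ≤ zz x ∧ x / (t.1 * t.2.1) * Real.exp (-(2 / l3 x)) < t.2.2) → (S.card : ℝ) ≤ K * EU x := by
  obtain ⟨C, hC, h⟩ := PI_bd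
  obtain ⟨C', hC', hm⟩ := mertens
  refine ⟨(2 + 2 * C) * (1 + C')^2, by positivity, ?_⟩
  intro x hx S hS hp
  have h1 := hx.l1_ge
  have h2 := hx.l2_ge
  have h3 := hx.h3
  have hx0 := hx.pos
  have hl1 : 0 < l1 x := by linarith
  have hl3 : 0 < l3 x := by linarith
  have hmaps : ∀ t ∈ S, (t.1, t.2.1) ∈ PP (zz x) ×ˢ PP (zz x) := by
    intro t ht
    obtain ⟨p1, p2, p3, h3, h4, h5, h6⟩ := mem_TT.mp (hS ht)
    have := (hp t ht).1
    have c1 : (t.1:ℝ) < t.2.1 := by exact_mod_cast h4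
    rw [Finset.mem_product, mem_PP, mem_PP]
    exact ⟨⟨p1, by linarith⟩, ⟨p2, this⟩⟩
  have hfib : ∀ d ∈ PP (zz x) ×ˢ PP (zz x), ((S.filter (fun t => (t.1, t.2.1) = d)).card : ℝ) ≤ (2 + 2*C) / l3 x * (x / l1 x) * (1 / d.1 * (1 / d.2)) := by
    intro d hd
    rw [Finset.mem_product, mem_PP, mem_PP] at hd
    obtain ⟨⟨pd1, hd1⟩, pd2, hd2⟩ := hd
    have q1 : (1:ℝ) ≤ d.1 := by exact_mod_cast pd1.one_lt.le
    have q2 : (1:ℝ) ≤ d.2 := by exact_mod_cast pd2.one_lt.le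
    have hd10 : (0:ℝ) < d.1 := by linarith
    have hd20 : (0:ℝ) < d.2 := by linarith
    set y := x / (d.1 * d.2) with hy
    have hy0 : 0 < y := by positivity
    have ha := y_range hx q1 hd1 q2 hd2 (le_refl 0) (by norm_num)
    have hb := y_range hx q1 hd1 q2 hd2 (e := 2 / l3 x) (by positivity) (by rw [div_le_iff₀ hl3]; linarith)
    rw [neg_zero, Real.exp_zero, mul_one] at ha
    have u1 := h x hx y ha.1 ha.2
    have u2 := h x hx _ hb.1 hb.2
    rw [← hy] at u2
    set y' := y * Real.exp (-(2 / l3 x)) with hy'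
    have hyy : y' ≤ y := by
      have : Real.exp (-(2 / l3 x)) ≤ 1 := Real.exp_le_one_iff.mpr (by
        have : 0 ≤ 2 / l3 x := by positivity
        linarith)
      rw [hy']; nlinarith
    have hyy2 : y - y' ≤ 2 / l3 x * y := by
      have := Real.add_one_le_exp (-(2 / l3 x))
      rw [hy']; nlinarith
    have hf := fib_le S d (PP y \ PP y') (by
      intro t ht he
      obtain ⟨p1, p2, p3, h3, h4, h5, h6⟩ := mem_TT.mp (hS ht)
      have e1 : d.1 = t.1 := by rw [← he]
      have e2 : d.2 = t.2.1 := by rw [← he]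
      rw [Finset.mem_sdiff, mem_PP, mem_PP]
      have h7 := (hp t ht).2
      rw [← e1, ← e2] at h7 h6
      refine ⟨⟨p3, ?_⟩, ?_⟩
      · rw [hy, le_div_iff₀ (by positivity)]; linarith
      · rintro ⟨_, h8⟩
        rw [← hy, ← hy'] at h7
        linarith)
    rw [Finset.card_sdiff_of_subset (PP_mono hyy)] at hf
    have hcl : (PP y').card ≤ (PP y).card := Finset.card_le_card (PP_mono hyy)
    have hf' : ((S.filter (fun t => (t.1, t.2.1) = d)).card : ℝ) ≤ (PP y).card - (PP y').card := by
      rw [← Nat.cast_sub hcl]; exact_mod_cast hf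
    have v1 := (abs_le.mp u1).2
    have v2 := (abs_le.mp u2).1
    have v3 : C / l3 x * (y' / l1 x) ≤ C / l3 x * (y / l1 x) := by gcongr
    have v4 : y / l1 x - y' / l1 x ≤ 2 / l3 x * (y / l1 x) := by
      rw [← sub_div, ← mul_div_assoc]; gcongr
    have e : (2 + 2*C) / l3 x * (x / l1 x) * (1 / d.1 * (1 / d.2)) = 2 / l3 x * (y / l1 x) + 2 * (C / l3 x * (y / l1 x)) := by
      rw [hy]; field_simp
    rw [e]; linarith
  rw [Finset.card_eq_sum_card_fiberwise (f := fun t => (t.1, t.2.1)) (t := PP (zz x) ×ˢ PP (zz x)) (fun t ht => hmaps t (by simpa using ht))]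
  push_cast
  refine (Finset.sum_le_sum hfib).trans ?_
  rw [← Finset.mul_sum, sum_recip]
  change (2 + 2*C) / l3 x * (x / l1 x) * (HR (zz x) * HR (zz x)) ≤ _
  have hz := HR_nonneg (zz x)
  have hH : HR (zz x) ≤ (1 + C') * l2 x := by
    have := (abs_le.mp (hx.HRz hm)).2
    have := log_l3_nonneg hx
    nlinarith
  have : (x / l1 x) * ((2 + 2*C) / l3 x * (HR (zz x) * HR (zz x))) ≤ (2 + 2 * C) * (1 + C')^2 * EU x := by
    apply to_EU hx
    calc (2 + 2*C) / l3 x * (HR (zz x) * HR (zz x)) * l3 x = (2 + 2*C) * (HR (zz x) * HR (zz x)) := by field_simp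
      _ ≤ (2 + 2*C) * (((1 + C') * l2 x) * ((1 + C') * l2 x)) := by
          have : 0 ≤ l2 x := by linarith
          gcongr
      _ = _ := by ring
  linarith

end TP


namespace TP

lemma sym_sum (O : Finset ℕ) (f : ℕ → ℝ) :
    (∑ p ∈ O, f p)^2 = 2 * ∑ d ∈ (O ×ˢ O).filter (fun d => d.1 < d.2), f d.1 * f d.2 + ∑ p ∈ O, f p ^ 2 := by
  rw [Finset.sum_filter, Finset.sum_product, sq, Finset.sum_mul_sum]
  have h1 : ∀ p ∈ O, ∀ q ∈ O, f p * f q = (if p < q then f p * f q else 0) + (if q < p then f q * f p else 0) + (if p = q then f p ^ 2 else 0) := by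
    intro p _ q _
    rcases lt_trichotomy p q with h | h | h
    · simp [h, h.not_gt, h.ne]
    · subst h; simp; ring
    · simp [h, h.not_gt, h.ne', mul_comm]
  rw [Finset.sum_congr rfl (fun p hp => Finset.sum_congr rfl (h1 p hp))]
  simp only [Finset.sum_add_distrib]
  rw [Finset.sum_comm (f := fun p q => if q < p then f q * f p else 0)]
  have : ∑ p ∈ O, ∑ q ∈ O, (if p = q then f p ^ 2 else 0) = ∑ p ∈ O, f p ^ 2 := by
    apply Finset.sum_congr rfl
    intro p hp
    rw [Finset.sum_ite_eq]; simp [hp]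
  rw [this]; ring

/-- odd primes up to the cutoff -/
noncomputable def OO (x : ℝ) : Finset ℕ := (PP (zz x)).filter (fun p => 3 ≤ p)

lemma OO_bd (x : ℝ) : |HR (zz x) - ∑ p ∈ OO x, 1 / (p:ℝ)| ≤ 1 := by
  have : HR (zz x) - ∑ p ∈ OO x, 1 / (p:ℝ) = ∑ p ∈ (PP (zz x)).filter (fun p => ¬ 3 ≤ p), 1 / (p:ℝ) := by
    unfold HR OO
    rw [← Finset.sum_filter_add_sum_filter_not (PP (zz x)) (fun p => 3 ≤ p)]; ring
  rw [this, abs_of_nonneg (by positivity)]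
  calc _ ≤ ∑ p ∈ ({2} : Finset ℕ), 1 / (p:ℝ) := by
        apply Finset.sum_le_sum_of_subset_of_nonneg
        · intro p hp
          rw [Finset.mem_filter, mem_PP] at hp
          have := hp.1.1.two_le
          simp; omega
        · intros; positivity
    _ ≤ 1 := by norm_num

lemma fib_eq {x : ℝ} (d : ℕ × ℕ) (h1 : d.1.Prime) (h2 : d.2.Prime) (h3 : 3 ≤ d.1) (h4 : d.1 < d.2) (h5 : (d.2:ℝ) ≤ zz x) :
    ((((TT x).filter (fun t => (t.2.1:ℝ) ≤ zz x)).filter (fun t => (t.1, t.2.1) = d)).card) = (PP (x / (d.1 * d.2)) \ PP (d.2:ℝ)).card := by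
  have q1 : (0:ℝ) < d.1 := by exact_mod_cast h1.pos
  have q2 : (0:ℝ) < d.2 := by exact_mod_cast h2.pos
  apply le_antisymm
  · apply fib_le
    intro t ht he
    rw [Finset.mem_filter] at ht
    obtain ⟨p1, p2, p3, h3, h4, h5, h6⟩ := mem_TT.mp ht.1
    have e1 : d.1 = t.1 := by rw [← he]
    have e2 : d.2 = t.2.1 := by rw [← he]
    rw [Finset.mem_sdiff, mem_PP, mem_PP, le_div_iff₀ (by positivity)]
    refine ⟨⟨p3, ?_⟩, ?_⟩
    · rw [e1, e2]; linarith
    · rintro ⟨_, h8⟩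
      have : t.2.2 ≤ d.2 := by exact_mod_cast h8
      omega
  · apply Finset.card_le_card_of_injOn (fun r => (d.1, d.2, r))
    · intro r hr
      have hr := Finset.mem_coe.mp hr
      rw [Finset.mem_sdiff, mem_PP, mem_PP, le_div_iff₀ (by positivity)] at hr
      rw [Finset.mem_coe, Finset.mem_filter, Finset.mem_filter, mem_TT]
      obtain ⟨⟨a, b⟩, c⟩ := hr
      refine ⟨⟨⟨h1, h2, a, h3, h4, ?_, ?_⟩, h5⟩, rfl⟩
      · by_contra hc
        exact c ⟨a, by exact_mod_cast (not_lt.mp hc)⟩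
      · dsimp only; linarith
    · intro a _ b _ hab
      simpa using hab

set_option maxHeartbeats 1600000 in
lemma mainTT : ∃ K > 0, ∀ x, Reg x → |((TT x).card : ℝ) - x * l2 x ^ 2 / (2 * l1 x)| ≤ K * EU x := by
  obtain ⟨K3, hK3, hE3⟩ := E3
  obtain ⟨C, hC, h⟩ := PI_bd
  obtain ⟨C', hC', hm⟩ := mertens
  refine ⟨K3 + C * (3 + C')^2 + 1 + (3 + C') * (5 + C'), by positivity, ?_⟩
  intro x hx
  have h1 := hx.l1_ge
  have h2 := hx.l2_ge
  have h3 := hx.h3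
  have hx0 := hx.pos
  have hl1 : 0 < l1 x := by linarith
  have hl2 : 0 < l2 x := by linarith
  have hl3 : 0 < l3 x := by linarith
  have hl32 := hx.l3_le_l2
  have hz0 : 0 ≤ zz x := (Real.exp_pos _).le
  set S := (TT x).filter (fun t => (t.2.1:ℝ) ≤ zz x) with hS
  set D := (OO x ×ˢ OO x).filter (fun d => d.1 < d.2) with hD
  set σ := ∑ d ∈ D, (1 / (d.1:ℝ) * (1 / d.2)) with hσ
  set η := ∑ p ∈ OO x, 1 / (p:ℝ) with hη
  -- splitting
  have hsplit : ((TT x).card : ℝ) = S.card + ((TT x).filter (fun t => ¬ (t.2.1:ℝ) ≤ zz x)).card := by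
    rw [hS]; exact_mod_cast (Finset.card_filter_add_card_filter_not _).symm
  have hrest := hE3 x hx ((TT x).filter (fun t => ¬ (t.2.1:ℝ) ≤ zz x)) (Finset.filter_subset _ _) (by
    intro t ht; rw [Finset.mem_filter] at ht; exact not_le.mp ht.2)
  have hmaps : ∀ t ∈ S, (t.1, t.2.1) ∈ D := by
    intro t ht
    rw [hS, Finset.mem_filter] at ht
    obtain ⟨p1, p2, p3, h3, h4, h5, h6⟩ := mem_TT.mp ht.1
    have c1 : (t.1:ℝ) < t.2.1 := by exact_mod_cast h4
    rw [hD, Finset.mem_filter, Finset.mem_product, OO, Finset.mem_filter, Finset.mem_filter, mem_PP, mem_PP]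
    exact ⟨⟨⟨⟨p1, by linarith⟩, h3⟩, ⟨⟨p2, ht.2⟩, by simp only; omega⟩⟩, h4⟩
  have hfib : ∀ d ∈ D, |((S.filter (fun t => (t.1, t.2.1) = d)).card : ℝ) - (x / l1 x) * (1 / d.1 * (1 / d.2))| ≤ C / l3 x * (x / l1 x) * (1 / d.1 * (1 / d.2)) + zz x := by
    intro d hd
    rw [hD, Finset.mem_filter, Finset.mem_product, OO, Finset.mem_filter, Finset.mem_filter, mem_PP, mem_PP] at hd
    obtain ⟨⟨⟨⟨pd1, hd1⟩, hd3⟩, ⟨pd2, hd2⟩, _⟩, hdl⟩ := hd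
    have q1 : (1:ℝ) ≤ d.1 := by exact_mod_cast pd1.one_lt.le
    have q2 : (1:ℝ) ≤ d.2 := by exact_mod_cast pd2.one_lt.le
    have hd10 : (0:ℝ) < d.1 := by linarith
    have hd20 : (0:ℝ) < d.2 := by linarith
    rw [hS, fib_eq d pd1 pd2 hd3 hdl hd2]
    set y := x / (d.1 * d.2) with hy
    have ha := y_range hx q1 hd1 q2 hd2 (le_refl 0) (by norm_num)
    rw [neg_zero, Real.exp_zero, mul_one] at ha
    have u1 := h x hx y ha.1 ha.2
    have e : (x / l1 x) * (1 / d.1 * (1 / d.2)) = y / l1 x := by rw [hy]; field_simp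
    rw [mul_assoc, e]
    have c1 : ((PP y \ PP (d.2:ℝ)).card : ℝ) ≤ (PP y).card := by
      exact_mod_cast Finset.card_le_card Finset.sdiff_subset
    have c2 : ((PP y).card : ℝ) ≤ (PP y \ PP (d.2:ℝ)).card + (PP (d.2:ℝ)).card := by
      have := Finset.le_card_sdiff (PP (d.2:ℝ)) (PP y)
      have : (PP y).card ≤ (PP y \ PP (d.2:ℝ)).card + (PP (d.2:ℝ)).card := by omega
      exact_mod_cast this
    have c3 := card_PP_le hd20.le
    rw [abs_le] at u1 ⊢
    constructor <;> linarith [u1.1, u1.2]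
  have hScard : (S.card:ℝ) = ∑ d ∈ D, ((S.filter (fun t => (t.1, t.2.1) = d)).card : ℝ) := by
    rw [Finset.card_eq_sum_card_fiberwise (f := fun t => (t.1, t.2.1)) (t := D) (fun t ht => hmaps t (by simpa using ht))]
    push_cast; rfl
  have hDcard : (D.card : ℝ) ≤ zz x * zz x := by
    have a : D.card ≤ (PP (zz x)).card * (PP (zz x)).card := by
      rw [← Finset.card_product]
      apply Finset.card_le_card
      intro d hd
      rw [hD, Finset.mem_filter, Finset.mem_product, OO, Finset.mem_filter, Finset.mem_filter] at hd
      exact Finset.mem_product.mpr ⟨hd.1.1.1, hd.1.2.1⟩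
    have := card_PP_le hz0
    calc (D.card : ℝ) ≤ (PP (zz x)).card * (PP (zz x)).card := by exact_mod_cast a
      _ ≤ _ := by gcongr
  have hS1 : |(S.card:ℝ) - (x / l1 x) * σ| ≤ C / l3 x * (x / l1 x) * σ + zz x ^ 3 := by
    rw [hScard, hσ, Finset.mul_sum, ← Finset.sum_sub_distrib]
    refine (Finset.abs_sum_le_sum_abs _ _).trans ?_
    refine (Finset.sum_le_sum hfib).trans ?_
    rw [Finset.sum_add_distrib, ← Finset.mul_sum, Finset.sum_const, nsmul_eq_mul]
    have : D.card * zz x ≤ zz x ^ 3 := by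
      calc _ ≤ zz x * zz x * zz x := by gcongr
        _ = _ := by ring
    linarith
  -- the reciprocal sum
  have hη0 : 0 ≤ η := by rw [hη]; positivity
  have hσ0 : 0 ≤ σ := by rw [hσ]; positivity
  have hsym := sym_sum (OO x) (fun p => 1 / (p:ℝ))
  rw [← hη, ← hD, ← hσ] at hsym
  have hsq : ∑ p ∈ OO x, (1 / (p:ℝ))^2 ≤ η := by
    rw [hη]
    apply Finset.sum_le_sum
    intro p hp
    rw [OO, Finset.mem_filter] at hp
    have : (1:ℝ) ≤ p := by exact_mod_cast (le_trans (by norm_num) hp.2)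
    have h1 : 1 / (p:ℝ) ≤ 1 := by rw [div_le_one (by linarith)]; exact this
    have h0 : 0 ≤ 1 / (p:ℝ) := by positivity
    nlinarith
  have hsq0 : 0 ≤ ∑ p ∈ OO x, (1 / (p:ℝ))^2 := by positivity
  have hHz := abs_le.mp (hx.HRz hm)
  have hOO := abs_le.mp (OO_bd x)
  rw [← hη] at hOO
  have g1 := log_l3_nonneg hx
  have g2 := log_l3_le hx
  have hηd : |η - l2 x| ≤ (3 + C') * l3 x := by
    rw [abs_le]; constructor <;> nlinarith
  have hηu : η ≤ (3 + C') * l2 x := by nlinarith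
  have hσd : |σ - l2 x ^ 2 / 2| * l3 x ≤ ((3 + C') * (5 + C')) * l2 x ^ 2 := by
    have e : σ - l2 x ^ 2 / 2 = ((η - l2 x) * (η + l2 x) - ∑ p ∈ OO x, (1 / (p:ℝ))^2) / 2 := by
      linarith
    have b1 : |(η - l2 x) * (η + l2 x)| ≤ (3 + C') * l3 x * ((4 + C') * l2 x) := by
      rw [abs_mul, abs_of_nonneg (show 0 ≤ η + l2 x by linarith)]
      have : η + l2 x ≤ (4 + C') * l2 x := by linarith
      gcongr
    have b2 : |σ - l2 x ^ 2 / 2| ≤ (3 + C') * l3 x * ((4 + C') * l2 x) + (3 + C') * l2 x := by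
      rw [e, abs_div, abs_two]
      have : |(η - l2 x) * (η + l2 x) - ∑ p ∈ OO x, (1 / (p:ℝ))^2| ≤ (3 + C') * l3 x * ((4 + C') * l2 x) + (3 + C') * l2 x := by
        refine (abs_sub _ _).trans ?_
        rw [abs_of_nonneg hsq0]
        linarith
      have := abs_nonneg ((η - l2 x) * (η + l2 x) - ∑ p ∈ OO x, (1 / (p:ℝ))^2)
      linarith
    have b3 : l3 x ^ 2 ≤ l2 x := le_trans (pow_le_pow_right₀ (by linarith) (by norm_num)) hx.h2
    calc _ ≤ ((3 + C') * l3 x * ((4 + C') * l2 x) + (3 + C') * l2 x) * l3 x := by gcongr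
      _ = (3 + C') * (4 + C') * l2 x * l3 x ^ 2 + (3 + C') * l2 x * l3 x := by ring
      _ ≤ (3 + C') * (4 + C') * l2 x * l2 x + (3 + C') * l2 x * l2 x := by gcongr
      _ = _ := by ring
  have t1 := to_EU hx hσd
  have t2 : (x / l1 x) * (C / l3 x * σ) ≤ C * (3 + C')^2 * EU x := by
    apply to_EU hx
    have : σ ≤ ((3 + C') * l2 x)^2 := by
      have : η ^ 2 ≤ ((3 + C') * l2 x)^2 := by gcongr
      linarith
    calc C / l3 x * σ * l3 x = C * σ := by field_simp
      _ ≤ C * ((3 + C') * l2 x)^2 := by gcongr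
      _ = _ := by ring
  have t3 := zpow_EU hx 3 (by norm_num)
  have e1 : x * l2 x ^ 2 / (2 * l1 x) = (x / l1 x) * (l2 x ^ 2 / 2) := by field_simp
  have e2 : |(x / l1 x) * σ - (x / l1 x) * (l2 x ^ 2 / 2)| = (x / l1 x) * |σ - l2 x ^ 2 / 2| := by
    rw [← mul_sub, abs_mul, abs_of_nonneg (show 0 ≤ x / l1 x by positivity)]
  rw [e1, hsplit]
  rw [← e2] at t1
  have hr0 : (0:ℝ) ≤ (((TT x).filter (fun t => ¬ (t.2.1:ℝ) ≤ zz x)).card : ℝ) := by positivity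
  rw [abs_le] at t1 hS1 ⊢
  constructor <;> linarith [t1.1, t1.2, hS1.1, hS1.2]

end TP


namespace TP

/-- logarithmic index -/
noncomputable def iF (x : ℝ) (p : ℕ) : ℕ := ⌊Real.log p * l3 x⌋₊

/-- top of the r-range in the box -/
noncomputable def YY (x : ℝ) (i j : ℕ) : ℝ := x * Real.exp (-(((i:ℝ) + j + 2) / l3 x))

lemma iF_le {x : ℝ} (hx : Reg x) {p : ℕ} (hp : 1 ≤ p) : Real.exp ((iF x p : ℝ) / l3 x) ≤ p := by
  have hl3 : 0 < l3 x := by have := hx.h3; linarith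
  have hp1 : (1:ℝ) ≤ p := by exact_mod_cast hp
  have h : (iF x p : ℝ) ≤ Real.log p * l3 x := Nat.floor_le (mul_nonneg (Real.log_nonneg hp1) hl3.le)
  rw [← Real.le_log_iff_exp_le (by linarith), div_le_iff₀ hl3]
  exact h

lemma iF_lt {x : ℝ} (hx : Reg x) {p : ℕ} (hp : 1 ≤ p) : (p:ℝ) < Real.exp (((iF x p : ℝ) + 1) / l3 x) := by
  have hl3 : 0 < l3 x := by have := hx.h3; linarith
  have hp1 : (1:ℝ) ≤ p := by exact_mod_cast hp
  have h : Real.log p * l3 x < (iF x p : ℝ) + 1 := Nat.lt_floor_add_one _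
  rw [← Real.log_lt_iff_lt_exp (by linarith), lt_div_iff₀ hl3]
  exact h

lemma iF_lt_of {x : ℝ} (hx : Reg x) {p q : ℕ} (hp : 1 ≤ p) (hq : 1 ≤ q) (h : iF x p + 1 ≤ iF x q) : p < q := by
  have hl3 : 0 < l3 x := by have := hx.h3; linarith
  have h1 := iF_lt hx hp
  have h2 := iF_le hx hq
  have : Real.exp (((iF x p : ℝ) + 1) / l3 x) ≤ Real.exp ((iF x q : ℝ) / l3 x) := by
    gcongr; exact_mod_cast h
  have : (p:ℝ) < q := by linarith
  exact_mod_cast this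

lemma YY_mul {x : ℝ} (hx : Reg x) {p q : ℕ} (hp : 1 ≤ p) (hq : 1 ≤ q) : (p:ℝ) * q * YY x (iF x p) (iF x q) ≤ x := by
  have h1 := iF_lt hx hp
  have h2 := iF_lt hx hq
  have hx0 := hx.pos
  unfold YY
  calc _ ≤ Real.exp (((iF x p : ℝ) + 1) / l3 x) * Real.exp (((iF x q : ℝ) + 1) / l3 x) * (x * Real.exp (-(((iF x p:ℝ) + iF x q + 2) / l3 x))) := by gcongr
    _ = x * (Real.exp (((iF x p : ℝ) + 1) / l3 x) * Real.exp (((iF x q : ℝ) + 1) / l3 x) * Real.exp (-(((iF x p:ℝ) + iF x q + 2) / l3 x))) := by ring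
    _ = x * Real.exp 0 := by rw [← Real.exp_add, ← Real.exp_add]; congr 2; ring
    _ = x := by simp

lemma YY_ge {x : ℝ} (hx : Reg x) {p q : ℕ} (hp : 1 ≤ p) (hq : 1 ≤ q) : x / (p * q) * Real.exp (-(2 / l3 x)) ≤ YY x (iF x p) (iF x q) := by
  have h1 := iF_le hx hp
  have h2 := iF_le hx hq
  have hx0 := hx.pos
  unfold YY
  have e : Real.exp (-(((iF x p:ℝ) + iF x q + 2) / l3 x)) = (Real.exp ((iF x p : ℝ) / l3 x) * Real.exp ((iF x q : ℝ) / l3 x))⁻¹ * Real.exp (-(2 / l3 x)) := by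
    rw [← Real.exp_add, ← Real.exp_neg, ← Real.exp_add]; congr 1; ring
  rw [e, ← mul_assoc, div_eq_mul_inv]
  gcongr

/-- good triples -/
def good (x : ℝ) (t : ℕ × ℕ × ℕ) : Prop :=
  l1 x ^ 8 ≤ (t.1:ℝ) ∧ 3 * iF x t.1 + 1 ≤ iF x t.2.1 ∧ (t.2.1:ℝ) ≤ zz x ∧ zz x < (t.2.2:ℝ) ∧ (t.2.2:ℝ) ≤ YY x (iF x t.1) (iF x t.2.1)

open Classical in
/-- the set of good triples -/
noncomputable def GTr (x : ℝ) : Finset (ℕ × ℕ × ℕ) := (TT x).filter (good x)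

lemma bad_bd : ∃ K > 0, ∀ x, Reg x → ((TT x \ GTr x).card : ℝ) ≤ K * EU x := by
  classical
  obtain ⟨K1, hK1, hE1⟩ := E1
  obtain ⟨K2, hK2, hE2⟩ := E2
  obtain ⟨K3, hK3, hE3⟩ := E3
  obtain ⟨K5, hK5, hE5⟩ := E5
  refine ⟨K1 + K2 + K3 + 1 + K5, by positivity, ?_⟩
  intro x hx
  have hl3 : 0 < l3 x := by have := hx.h3; linarith
  have a1 := hE1 x hx ((TT x).filter (fun t => (t.1:ℝ) < l1 x ^ 8)) (Finset.filter_subset _ _) (fun t ht => (Finset.mem_filter.mp ht).2)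
  have a2 := hE2 x hx ((TT x).filter (fun t => (t.2.1:ℝ) ≤ (t.1:ℝ)^4)) (Finset.filter_subset _ _) (fun t ht => (Finset.mem_filter.mp ht).2)
  have a3 := hE3 x hx ((TT x).filter (fun t => zz x < (t.2.1:ℝ))) (Finset.filter_subset _ _) (fun t ht => (Finset.mem_filter.mp ht).2)
  have a4 := E4 x hx ((TT x).filter (fun t => (t.2.2:ℝ) ≤ zz x)) (Finset.filter_subset _ _) (fun t ht => (Finset.mem_filter.mp ht).2)
  have a5 := hE5 x hx ((TT x).filter (fun t => (t.2.1:ℝ) ≤ zz x ∧ x / (t.1 * t.2.1) * Real.exp (-(2 / l3 x)) < t.2.2)) (Finset.filter_subset _ _) (fun t ht => (Finset.mem_filter.mp ht).2)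
  set S1 := (TT x).filter (fun t => (t.1:ℝ) < l1 x ^ 8) with hS1
  set S2 := (TT x).filter (fun t => (t.2.1:ℝ) ≤ (t.1:ℝ)^4) with hS2
  set S3 := (TT x).filter (fun t => zz x < (t.2.1:ℝ)) with hS3
  set S4 := (TT x).filter (fun t => (t.2.2:ℝ) ≤ zz x) with hS4
  set S5 := (TT x).filter (fun t => (t.2.1:ℝ) ≤ zz x ∧ x / (t.1 * t.2.1) * Real.exp (-(2 / l3 x)) < t.2.2) with hS5
  have hsub : TT x \ GTr x ⊆ S1 ∪ (S2 ∪ (S3 ∪ (S4 ∪ S5))) := by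
    intro t ht
    rw [Finset.mem_sdiff, GTr, Finset.mem_filter] at ht
    obtain ⟨htT, hng⟩ := ht
    obtain ⟨p1, p2, p3, h3, h4, h5, h6⟩ := mem_TT.mp htT
    by_contra hc
    simp only [Finset.mem_union, hS1, hS2, hS3, hS4, hS5, Finset.mem_filter, htT, true_and, not_or, not_and, not_lt, not_le] at hc
    obtain ⟨c1, c2, c3, c4, c5⟩ := hc
    apply hng
    refine ⟨htT, c1, ?_, c3, c4, ?_⟩
    · by_contra hlt
      have hlt : iF x t.2.1 ≤ 3 * iF x t.1 := by omega
      have u1 := iF_lt hx p2.one_lt.le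
      have u2 := iF_le hx p1.one_lt.le
      have u3 : Real.exp (1 / l3 x) ≤ t.1 := by
        have : Real.exp (1 / l3 x) ≤ Real.exp 1 := by
          gcongr
          rw [div_le_one hl3]; have := hx.h3; linarith
        have e3 := Real.exp_one_lt_d9
        have : (3:ℝ) ≤ t.1 := by exact_mod_cast h3
        linarith
      have : (t.2.1:ℝ) ≤ (t.1:ℝ)^4 := by
        calc (t.2.1:ℝ) ≤ Real.exp (((iF x t.2.1 : ℝ) + 1) / l3 x) := u1.le
          _ ≤ Real.exp ((3 * (iF x t.1 : ℝ) + 1) / l3 x) := by gcongr; exact_mod_cast hlt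
          _ = Real.exp ((iF x t.1 : ℝ) / l3 x) ^ 3 * Real.exp (1 / l3 x) := by
              rw [← Real.exp_nat_mul, ← Real.exp_add]; congr 1; push_cast; ring
          _ ≤ (t.1:ℝ)^3 * t.1 := by gcongr
          _ = _ := by ring
      linarith
    · exact (c5 c3).trans (YY_ge hx p1.one_lt.le p2.one_lt.le)
  have hc := Finset.card_le_card hsub
  have d1 := Finset.card_union_le S1 (S2 ∪ (S3 ∪ (S4 ∪ S5)))
  have d2 := Finset.card_union_le S2 (S3 ∪ (S4 ∪ S5))
  have d3 := Finset.card_union_le S3 (S4 ∪ S5)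
  have d4 := Finset.card_union_le S4 S5
  have : (TT x \ GTr x).card ≤ S1.card + S2.card + S3.card + S4.card + S5.card := by omega
  have : ((TT x \ GTr x).card : ℝ) ≤ S1.card + S2.card + S3.card + S4.card + S5.card := by exact_mod_cast this
  linarith

/-- box sides -/
noncomputable def bP (x : ℝ) (i : ℕ) : Finset ℕ := (PP x).filter (fun p => 3 ≤ p ∧ l1 x ^ 8 ≤ (p:ℝ) ∧ iF x p = i)
noncomputable def bA (x : ℝ) (j : ℕ) : Finset ℕ := (PP (zz x)).filter (fun p => iF x p = j)
noncomputable def bR (x : ℝ) (i j : ℕ) : Finset ℕ := PP (YY x i j) \ PP (zz x)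

lemma fiber_eq {x : ℝ} (hx : Reg x) (i j : ℕ) (hij : 3 * i + 1 ≤ j) :
    (GTr x).filter (fun t => (iF x t.1, iF x t.2.1) = (i, j)) = bP x i ×ˢ bA x j ×ˢ bR x i j := by
  classical
  ext t
  rw [Finset.mem_product, Finset.mem_product, Finset.mem_filter, GTr, Finset.mem_filter, bP, bA, bR, Finset.mem_filter, Finset.mem_filter, Finset.mem_sdiff, mem_PP, mem_PP, mem_PP, mem_PP, mem_TT]
  simp only [Prod.mk.injEq]
  constructor
  · rintro ⟨⟨⟨p1, p2, p3, h3, h4, h5, h6⟩, g1, g2, g3, g4, g5⟩, hi, hj⟩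
    rw [hi, hj] at g5
    have c1 : (t.1:ℝ) < t.2.1 := by exact_mod_cast h4
    have := hx.zz_le
    refine ⟨⟨⟨p1, by linarith⟩, h3, g1, hi⟩, ⟨⟨p2, g3⟩, hj⟩, ⟨p3, g5⟩, ?_⟩
    rintro ⟨_, h⟩; linarith
  · rintro ⟨⟨⟨p1, _⟩, h3, g1, hi⟩, ⟨⟨p2, g3⟩, hj⟩, ⟨p3, g5⟩, hn⟩
    have g4 : zz x < t.2.2 := by
      by_contra hc; exact hn ⟨p3, not_lt.mp hc⟩
    refine ⟨⟨⟨p1, p2, p3, h3, ?_, ?_, ?_⟩, g1, ?_, g3, g4, ?_⟩, hi, hj⟩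
    · exact iF_lt_of hx p1.one_lt.le p2.one_lt.le (by rw [hi, hj]; omega)
    · have : (t.2.1:ℝ) < t.2.2 := by linarith
      exact_mod_cast this
    · have := YY_mul hx p1.one_lt.le p2.one_lt.le
      rw [hi, hj] at this
      refine le_trans ?_ this
      gcongr
    · rw [hi, hj]; exact hij
    · rw [hi, hj]; exact g5

lemma box_val {x : ℝ} (hx : Reg x) (M : ℕ → Finset (ℕ × ℕ)) (hM : ∀ p : ℕ, p.Prime → 3 ≤ p → ∀ ab ∈ M p, ab.1 < p ∧ ab.2 < p)
    (i j : ℕ) (hij : 3 * i + 1 ≤ j) : |∑ p ∈ bP x i, ∑ q ∈ bA x j, ∑ r ∈ bR x i j, WW M p q r| ≤ 48 * x / l1 x ^ 4 := by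
  have h1 := hx.l1_ge
  have h3 := hx.h3
  have hl3 : 0 < l3 x := by linarith
  have hl1 : 0 < l1 x := by linarith
  have hx0 := hx.pos
  have hpos : 0 ≤ 48 * x / l1 x ^ 4 := by positivity
  rcases Finset.eq_empty_or_nonempty (bP x i) with he | ⟨p, hp⟩
  · rw [he]; simpa using hpos
  rcases Finset.eq_empty_or_nonempty (bA x j) with he | ⟨q, hq⟩
  · rw [he]; simpa using hpos
  rcases Finset.eq_empty_or_nonempty (bR x i j) with he | ⟨r, hr⟩
  · rw [he]; simpa using hpos
  set P := Real.exp ((i:ℝ) / l3 x) with hP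
  set NA := Real.exp (((j:ℝ) + 1) / l3 x) with hNA
  have hP1 : 1 ≤ P := Real.one_le_exp (by positivity)
  have hP3 : P^3 ≤ Real.exp ((j:ℝ) / l3 x) := by
    rw [hP, ← Real.exp_nat_mul, ← mul_div_assoc]
    gcongr
    push_cast
    have : 3 * i ≤ j := by omega
    exact_mod_cast this
  have hp3 : ∀ p ∈ bP x i, P ≤ p ∧ (p:ℝ) ≤ 3 * P := by
    intro p hp
    rw [bP, Finset.mem_filter, mem_PP] at hp
    obtain ⟨⟨p1, _⟩, _, _, hi⟩ := hp
    have u1 := iF_le hx p1.one_lt.le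
    have u2 := iF_lt hx p1.one_lt.le
    rw [hi] at u1 u2
    refine ⟨u1, u2.le.trans ?_⟩
    rw [add_div, Real.exp_add, ← hP]
    have : Real.exp (1 / l3 x) ≤ Real.exp 1 := by
      gcongr
      rw [div_le_one hl3]; linarith
    have e3 := Real.exp_one_lt_d9
    nlinarith
  have hb := box_bd M (bP x i) (bA x j) (bR x i j) NA (YY x i j) P hP1
    (by intro p hp; rw [bP, Finset.mem_filter, mem_PP] at hp; exact hp.1.1)
    (by intro p hp; rw [bP, Finset.mem_filter, mem_PP] at hp; exact hM p hp.1.1 hp.2.1)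
    (fun p hp => (hp3 p hp).1) (fun p hp => (hp3 p hp).2)
    (by
      intro n hn; rw [bA, Finset.mem_filter, mem_PP] at hn
      refine ⟨hn.1.1.one_lt.le, ?_⟩
      have := iF_lt hx hn.1.1.one_lt.le
      rw [hn.2] at this; exact this.le)
    (by
      refine hP3.trans ?_
      rw [hNA]; gcongr; linarith)
    (by
      intro n hn; rw [bR, Finset.mem_sdiff, mem_PP] at hn
      exact ⟨hn.1.1.one_lt.le, hn.1.2⟩)
    (by
      rw [bR, Finset.mem_sdiff, mem_PP, mem_PP] at hr
      rw [bA, Finset.mem_filter, mem_PP] at hq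
      have u := iF_le hx hq.1.1.one_lt.le
      rw [hq.2] at u
      have : zz x < r := by
        by_contra hc; exact hr.2 ⟨hr.1.1, not_lt.mp hc⟩
      linarith [hr.1.2, hq.1.2])
  refine hb.trans ?_
  have hP0 : 0 < P := by linarith
  have hNN : NA * YY x i j ≤ x / P := by
    have : NA * YY x i j = x * Real.exp (-(((i:ℝ)+1) / l3 x)) := by
      rw [hNA, YY, mul_comm, mul_assoc, ← Real.exp_add]; congr 2; ring
    rw [this, div_eq_mul_inv x P, hP, ← Real.exp_neg]
    gcongr
    linarith
  have hsq : l1 x ^ 4 / 2 ≤ √P := by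
    apply Real.le_sqrt_of_sq_le
    have h8 := (hp3 p hp).2
    rw [bP, Finset.mem_filter] at hp
    have := hp.2.2.1
    have e : (l1 x ^ 4 / 2)^2 = l1 x ^ 8 / 4 := by ring
    rw [e]; linarith
  have hl4 : 0 < l1 x ^ 4 := by positivity
  calc 24 * NA * YY x i j * √P = 24 * (NA * YY x i j) * √P := by ring
    _ ≤ 24 * (x / P) * √P := by gcongr
    _ = 24 * x / √P := by
        have hs : √P ≠ 0 := (Real.sqrt_pos.mpr hP0).ne'
        have : P = √P * √P := (Real.mul_self_sqrt hP0.le).symm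
        field_simp
        rw [Real.sq_sqrt hP0.le]
    _ ≤ 24 * x / (l1 x ^ 4 / 2) := by gcongr
    _ = _ := by field_simp; ring

lemma boxes {x : ℝ} (hx : Reg x) (M : ℕ → Finset (ℕ × ℕ)) (hM : ∀ p : ℕ, p.Prime → 3 ≤ p → ∀ ab ∈ M p, ab.1 < p ∧ ab.2 < p) :
    |∑ t ∈ GTr x, WW M t.1 t.2.1 t.2.2| ≤ 1 * EU x := by
  classical
  have h1 := hx.l1_ge
  have h2 := hx.l2_ge
  have h3 := hx.h3
  have hl3 : 0 < l3 x := by linarith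
  have hl2 : 0 < l2 x := by linarith
  have hl1 : 0 < l1 x := by linarith
  have hx0 := hx.pos
  set n := ⌊l1 x * l3 x⌋₊ + 1 with hn
  have hidx : ∀ p : ℕ, 1 ≤ p → (p:ℝ) ≤ x → iF x p < n := by
    intro p hp hpx
    have hp1 : (1:ℝ) ≤ p := by exact_mod_cast hp
    rw [hn, Nat.lt_succ_iff]
    apply Nat.floor_le_floor
    gcongr
    exact Real.log_le_log (by linarith) hpx
  have hmaps : ∀ t ∈ GTr x, (iF x t.1, iF x t.2.1) ∈ Finset.range n ×ˢ Finset.range n := by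
    intro t ht
    rw [GTr, Finset.mem_filter, mem_TT] at ht
    obtain ⟨⟨p1, p2, p3, h3, h4, h5, h6⟩, g1, g2, g3, g4, g5⟩ := ht
    have c1 : (t.1:ℝ) < t.2.1 := by exact_mod_cast h4
    have := hx.zz_le
    rw [Finset.mem_product, Finset.mem_range, Finset.mem_range]
    exact ⟨hidx _ p1.one_lt.le (by linarith), hidx _ p2.one_lt.le (by linarith)⟩
  rw [← Finset.sum_fiberwise_of_maps_to hmaps]
  refine (Finset.abs_sum_le_sum_abs _ _).trans ?_
  have hterm : ∀ d ∈ Finset.range n ×ˢ Finset.range n, |∑ t ∈ (GTr x).filter (fun t => (iF x t.1, iF x t.2.1) = d), WW M t.1 t.2.1 t.2.2| ≤ 48 * x / l1 x ^ 4 := by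
    rintro ⟨i, j⟩ _
    by_cases hij : 3 * i + 1 ≤ j
    · rw [fiber_eq hx i j hij, Finset.sum_product]
      have := box_val hx M hM i j hij
      refine le_trans (le_of_eq ?_) this
      congr 1
      apply Finset.sum_congr rfl
      intro p _
      rw [Finset.sum_product]
    · have : (GTr x).filter (fun t => (iF x t.1, iF x t.2.1) = (i, j)) = ∅ := by
        rw [Finset.filter_eq_empty_iff]
        intro t ht he
        rw [GTr, Finset.mem_filter] at ht
        have := ht.2.2.1
        simp only [Prod.mk.injEq] at he
        rw [he.1, he.2] at this
        exact hij this
      rw [this]; simp; positivity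
  refine (Finset.sum_le_sum hterm).trans ?_
  rw [Finset.sum_const, Finset.card_product, Finset.card_range, nsmul_eq_mul]
  have hn2 : (n:ℝ) ≤ 2 * (l1 x * l3 x) := by
    rw [hn]; push_cast
    have := Nat.floor_le (show 0 ≤ l1 x * l3 x by positivity)
    nlinarith
  push_cast
  calc (n:ℝ) * n * (48 * x / l1 x ^ 4) ≤ (2 * (l1 x * l3 x)) * (2 * (l1 x * l3 x)) * (48 * x / l1 x ^ 4) := by gcongr
    _ = (x / l1 x) * (192 * l3 x ^ 2 / l1 x) := by field_simp; ring
    _ ≤ _ := by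
      apply to_EU hx
      have e : 192 * l3 x ^ 2 / l1 x * l3 x = 192 * l3 x ^ 3 / l1 x := by ring
      rw [e, one_mul, div_le_iff₀ hl1]
      have b3 : l3 x ^ 3 ≤ l2 x := le_trans (pow_le_pow_right₀ (by linarith) (by norm_num)) hx.h2
      have : l2 x ≤ l2 x ^ 2 := le_self_pow₀ (by linarith) (by norm_num)
      calc 192 * l3 x ^ 3 ≤ l1 x * l2 x ^ 2 := by gcongr; linarith; linarith
        _ = _ := by ring

end TP


namespace TP

lemma tri_inj {p q r p' q' r' : ℕ} (hp : p.Prime) (hq : q.Prime) (hr : r.Prime) (hp' : p'.Prime) (hq' : q'.Prime) (hr' : r'.Prime)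
    (h1 : p < q) (h2 : q < r) (h1' : p' < q') (h2' : q' < r') (h : p * q * r = p' * q' * r') : p = p' ∧ q = q' ∧ r = r' := by
  have key : ∀ s : ℕ, s.Prime → s ∣ p * q * r → s = p' ∨ s = q' ∨ s = r' := by
    intro s hs hd
    rw [h, hs.dvd_mul, hs.dvd_mul, Nat.prime_dvd_prime_iff_eq hs hp', Nat.prime_dvd_prime_iff_eq hs hq', Nat.prime_dvd_prime_iff_eq hs hr'] at hd
    tauto
  have a := key p hp ⟨q * r, by ring⟩
  have b := key q hq ⟨p * r, by ring⟩
  have c := key r hr ⟨p * q, by ring⟩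
  omega

lemma count_eq (M : ℕ → Finset (ℕ × ℕ)) (x : ℝ) :
    {n : ℕ | ∃ p q r : ℕ, p.Prime ∧ q.Prime ∧ r.Prime ∧
            3 ≤ p ∧ p < q ∧ q < r ∧ n = p * q * r ∧ (n : ℝ) ≤ x ∧
            (q % p, r % p) ∈ M p}.ncard = ((TT x).filter (fun t => (t.2.1 % t.1, t.2.2 % t.1) ∈ M t.1)).card := by
  have : {n : ℕ | ∃ p q r : ℕ, p.Prime ∧ q.Prime ∧ r.Prime ∧
            3 ≤ p ∧ p < q ∧ q < r ∧ n = p * q * r ∧ (n : ℝ) ≤ x ∧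
            (q % p, r % p) ∈ M p} = ((((TT x).filter (fun t => (t.2.1 % t.1, t.2.2 % t.1) ∈ M t.1)).image (fun t => t.1 * t.2.1 * t.2.2) : Finset ℕ) : Set ℕ) := by
    ext n
    rw [Set.mem_setOf_eq, Finset.mem_coe, Finset.mem_image]
    constructor
    · rintro ⟨p, q, r, hp, hq, hr, h3, h4, h5, rfl, h6, h7⟩
      refine ⟨(p, q, r), ?_, rfl⟩
      rw [Finset.mem_filter, mem_TT]
      push_cast at h6
      exact ⟨⟨hp, hq, hr, h3, h4, h5, h6⟩, h7⟩
    · rintro ⟨⟨p, q, r⟩, ht, rfl⟩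
      rw [Finset.mem_filter, mem_TT] at ht
      obtain ⟨⟨hp, hq, hr, h3, h4, h5, h6⟩, h7⟩ := ht
      refine ⟨p, q, r, hp, hq, hr, h3, h4, h5, rfl, ?_, h7⟩
      push_cast; exact h6
  rw [this, Set.ncard_coe_finset, Finset.card_image_of_injOn]
  rintro ⟨p, q, r⟩ ht ⟨p', q', r'⟩ ht' he
  have ht := (Finset.mem_filter.mp (Finset.mem_coe.mp ht)).1
  have ht' := (Finset.mem_filter.mp (Finset.mem_coe.mp ht')).1
  rw [mem_TT] at ht ht'
  obtain ⟨hp, hq, hr, h3, h4, h5, h6⟩ := ht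
  obtain ⟨hp', hq', hr', h3', h4', h5', h6'⟩ := ht'
  obtain ⟨a, b, c⟩ := tri_inj hp hq hr hp' hq' hr' h4 h5 h4' h5' he
  dsimp only at a b c
  rw [a, b, c]

lemma GTr_sub (x : ℝ) : GTr x ⊆ TT x := by
  classical
  unfold GTr; exact Finset.filter_subset _ _

lemma final (α : ℝ) (hα0 : 0 < α) (hα1 : α < 1) (M : ℕ → Finset (ℕ × ℕ)) (B : ℝ)
    (hM : ∀ p : ℕ, p.Prime → 3 ≤ p → ∀ ab ∈ M p, ab.1 < p ∧ ab.2 < p)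
    (hB : ∀ p : ℕ, p.Prime → 3 ≤ p → |((M p).card : ℝ) - α * (p : ℝ) ^ 2| ≤ B * p) :
    ∃ K > 0, ∀ x, Reg x → |(((TT x).filter (fun t => (t.2.1 % t.1, t.2.2 % t.1) ∈ M t.1)).card : ℝ) - α * (x * l2 x ^ 2 / (2 * l1 x))| ≤ K * EU x := by
  obtain ⟨K1, hK1, hmain⟩ := mainTT
  obtain ⟨K2, hK2, hbad⟩ := bad_bd
  have hB0 : 0 ≤ B := by
    have := (abs_nonneg _).trans (hB 3 (by norm_num) (le_refl _))
    push_cast at this; linarith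
  refine ⟨K1 + K2 + 1 + B * (1 + K1), by positivity, ?_⟩
  intro x hx
  have h1 := hx.l1_ge
  have h2 := hx.l2_ge
  have h3 := hx.h3
  have hl3 : 0 < l3 x := by linarith
  have hl2 : 0 < l2 x := by linarith
  have hl1 : 0 < l1 x := by linarith
  have hx0 := hx.pos
  have hEU := EU_pos hx
  have m := hmain x hx
  have b := hbad x hx
  have w := boxes hx M hM
  set ι : ℕ × ℕ × ℕ → ℝ := fun t => if (t.2.1 % t.1, t.2.2 % t.1) ∈ M t.1 then (1:ℝ) else 0 with hι
  have hN : (((TT x).filter (fun t => (t.2.1 % t.1, t.2.2 % t.1) ∈ M t.1)).card : ℝ) = ∑ t ∈ TT x, ι t := by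
    rw [hι, Finset.card_filter]; push_cast; rfl
  have hdec : ∑ t ∈ TT x, ι t - α * (TT x).card = ∑ t ∈ TT x \ GTr x, (ι t - α) + ∑ t ∈ GTr x, WW M t.1 t.2.1 t.2.2 + ∑ t ∈ GTr x, (((M t.1).card:ℝ) / (t.1:ℝ)^2 - α) := by
    have : ∑ t ∈ TT x, ι t - α * (TT x).card = ∑ t ∈ TT x, (ι t - α) := by
      rw [Finset.sum_sub_distrib, Finset.sum_const, nsmul_eq_mul]; ring
    rw [this, ← Finset.sum_sdiff (GTr_sub x), add_assoc, ← Finset.sum_add_distrib]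
    congr 1
    apply Finset.sum_congr rfl
    intro t _
    rw [hι, WW]; ring
  have s1 : |∑ t ∈ TT x \ GTr x, (ι t - α)| ≤ (TT x \ GTr x).card := by
    refine (Finset.abs_sum_le_sum_abs _ _).trans ?_
    refine (Finset.sum_le_card_nsmul _ _ 1 ?_).trans (by simp)
    intro t _
    rw [hι]; dsimp only
    rw [abs_le]
    split_ifs <;> constructor <;> linarith
  have s3 : |∑ t ∈ GTr x, (((M t.1).card:ℝ) / (t.1:ℝ)^2 - α)| ≤ (TT x).card * (B / l3 x) := by
    refine (Finset.abs_sum_le_sum_abs _ _).trans ?_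
    refine (Finset.sum_le_card_nsmul _ _ (B / l3 x) ?_).trans ?_
    · intro t ht
      have htT := mem_TT.mp (GTr_sub x ht)
      classical
      rw [GTr, Finset.mem_filter] at ht
      have h8 := ht.2.1
      have hh : l1 x ≤ l1 x ^ 8 := le_self_pow₀ (by linarith) (by norm_num)
      have hpl : l3 x ≤ t.1 := by
        have := hx.l3_le_l2; have := hx.l2_le_l1; linarith
      have hp0 : (0:ℝ) < t.1 := by linarith
      have e : ((M t.1).card:ℝ) / (t.1:ℝ)^2 - α = (((M t.1).card:ℝ) - α * (t.1:ℝ)^2) / (t.1:ℝ)^2 := by field_simp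
      rw [e, abs_div, abs_of_pos (show (0:ℝ) < (t.1:ℝ)^2 by positivity)]
      calc _ ≤ (B * t.1) / (t.1:ℝ)^2 := by gcongr; exact hB t.1 htT.1 htT.2.2.2.1
        _ = B / t.1 := by field_simp
        _ ≤ _ := by gcongr
    · rw [nsmul_eq_mul]
      have : ((GTr x).card : ℝ) ≤ (TT x).card := by exact_mod_cast Finset.card_le_card (GTr_sub x)
      gcongr
  have s4 : (TT x).card * (B / l3 x) ≤ B * (1 + K1) * EU x := by
    have u := (abs_le.mp m).2
    have e1 : x * l2 x ^ 2 / (2 * l1 x) = EU x * l3 x / 2 := by unfold EU; field_simp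
    have e2 : ((TT x).card : ℝ) ≤ (1 + K1) * EU x * l3 x := by
      have : EU x ≤ EU x * l3 x := by nlinarith
      have : K1 * EU x ≤ K1 * (EU x * l3 x) := by gcongr
      have : 0 ≤ EU x * l3 x := by positivity
      linarith
    calc _ ≤ (1 + K1) * EU x * l3 x * (B / l3 x) := by gcongr
      _ = _ := by field_simp
  have hfirst : |∑ t ∈ TT x, ι t - α * (TT x).card| ≤ (K2 + 1 + B * (1 + K1)) * EU x := by
    rw [hdec]
    refine (abs_add_le _ _).trans ?_
    have := abs_add_le (∑ t ∈ TT x \ GTr x, (ι t - α)) (∑ t ∈ GTr x, WW M t.1 t.2.1 t.2.2)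
    linarith
  have hsecond : |α * (TT x).card - α * (x * l2 x ^ 2 / (2 * l1 x))| ≤ K1 * EU x := by
    rw [← mul_sub, abs_mul, abs_of_pos hα0]
    have := abs_nonneg (((TT x).card:ℝ) - x * l2 x ^ 2 / (2 * l1 x))
    nlinarith
  rw [hN]
  have := abs_sub_le (∑ t ∈ TT x, ι t) (α * (TT x).card) (α * (x * l2 x ^ 2 / (2 * l1 x)))
  linarith

end TP

theorem ternary_congruence_pairs_asymptotic
    (α : ℝ) (hα0 : 0 < α) (hα1 : α < 1)
    (M : ℕ → Finset (ℕ × ℕ))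
    (hMrange : ∀ p : ℕ, p.Prime → Odd p → ∀ ab ∈ M p,
      1 ≤ ab.1 ∧ ab.1 ≤ p - 1 ∧ 1 ≤ ab.2 ∧ ab.2 ≤ p - 1)
    (hMcard : ∃ B : ℝ, ∀ p : ℕ, p.Prime → Odd p →
      |((M p).card : ℝ) - α * (p : ℝ) ^ 2| ≤ B * p) :
    ∃ C > (0 : ℝ), ∃ x₀ : ℝ, ∀ x ≥ x₀,
      |(({n : ℕ | ∃ p q r : ℕ, p.Prime ∧ q.Prime ∧ r.Prime ∧
            3 ≤ p ∧ p < q ∧ q < r ∧ n = p * q * r ∧ (n : ℝ) ≤ x ∧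
            (q % p, r % p) ∈ M p}.ncard : ℕ) : ℝ) -
          α * x * (Real.log (Real.log x)) ^ 2 / (2 * Real.log x)| ≤
        C * (x * (Real.log (Real.log x)) ^ 2) /
          (2 * Real.log x * Real.log (Real.log (Real.log x))) := by
  obtain ⟨B, hB⟩ := hMcard
  have hodd : ∀ p : ℕ, p.Prime → 3 ≤ p → Odd p := fun p hp h3 => hp.odd_of_ne_two (by omega)
  obtain ⟨K, hK, h⟩ := TP.final α hα0 hα1 M B
    (by
      intro p hp h3 ab hab
      have := hMrange p hp (hodd p hp h3) ab hab
      omega)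
    (fun p hp h3 => hB p hp (hodd p hp h3))
  obtain ⟨x₀, hx₀⟩ := Filter.eventually_atTop.mp TP.reg_ev
  refine ⟨2 * K, by positivity, x₀, ?_⟩
  intro x hx
  have hr := hx₀ x hx
  have := h x hr
  rw [TP.count_eq]
  have e1 : α * x * (Real.log (Real.log x)) ^ 2 / (2 * Real.log x) = α * (x * TP.l2 x ^ 2 / (2 * TP.l1 x)) := by
    unfold TP.l2 TP.l1; ring
  have e2 : 2 * K * (x * (Real.log (Real.log x)) ^ 2) / (2 * Real.log x * Real.log (Real.log (Real.log x))) = K * TP.EU x := by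
    unfold TP.EU TP.l3 TP.l2 TP.l1
    rw [mul_assoc 2 K, mul_assoc 2 (Real.log x), mul_div_mul_left _ _ (by norm_num), mul_div_assoc]
  rw [e1, e2]
  exact this
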